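/- arXiv:2010.10304 — 2 statements merged into one kernel-verified Lean document; each statement's English description precedes it below -/
import Mathlib

section
/- For every d ∈ ℕ, the class of countable virtually abelian groups having an abelian subgroup of index at most d is uniformly stable with respect to the family of unitary groups with normalized Hilbert–Schmidt metrics: for every δ>0 there exists ε>0 (depending only on δ and d, not on the group) such that for every countable group Γ with an abelian subgroup of index ≤ d, every n ∈ ℕ, and every map φ: Γ → U(n) with ‖φ(g)φ(h) − φ(gh)‖_{HS,n} < ε for all g,h ∈ Γ, there exists a group homomorphism π: Γ → U(n) with ‖φ(g) − π(g)‖_{HS,n} < δ for all g ∈ Γ. -/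
open scoped Matrix

/-- Normalized Hilbert–Schmidt norm: ‖A‖_{HS,n} = ((1/n)·Tr(A Aᴴ))^{1/2}. -/
noncomputable def hsNorm {n m : ℕ} (A : Matrix (Fin n) (Fin m) ℂ) : ℝ :=
  Real.sqrt ((1 / (n : ℝ)) * (Matrix.trace (A * Aᴴ)).re)

/-- Operator norm (largest singular value) of a rectangular complex matrix. -/
noncomputable def opNorm {n m : ℕ} (A : Matrix (Fin n) (Fin m) ℂ) : ℝ :=
  ‖LinearMap.toContinuousLinearMap (Matrix.toEuclideanLin A)‖

/-- Γ is uniformly HS stable: for every δ>0 there is ε>0 such that every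
ε-homomorphism into some U(n) (w.r.t. the normalized HS metric) is δ-close to a
genuine unitary representation of the same dimension. -/
def UniformlyHSStable (Γ : Type*) [Group Γ] : Prop :=
  ∀ δ : ℝ, 0 < δ → ∃ ε : ℝ, 0 < ε ∧
    ∀ (n : ℕ) (φ : Γ → Matrix.unitaryGroup (Fin n) ℂ),
      (∀ g h : Γ, hsNorm ((φ g : Matrix (Fin n) (Fin n) ℂ) * (φ h : Matrix (Fin n) (Fin n) ℂ)
        - (φ (g * h) : Matrix (Fin n) (Fin n) ℂ)) < ε) →
      ∃ π : Γ →* Matrix.unitaryGroup (Fin n) ℂ,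
        ∀ g : Γ, hsNorm ((φ g : Matrix (Fin n) (Fin n) ℂ) - (π g : Matrix (Fin n) (Fin n) ℂ)) < δ

/-- A unitary representation is irreducible if ℂⁿ has no nonzero proper invariant subspace. -/
def IsIrreducibleRep {Γ : Type*} [Group Γ] {n : ℕ}
    (π : Γ →* Matrix.unitaryGroup (Fin n) ℂ) : Prop :=
  ∀ W : Submodule ℂ (Fin n → ℂ),
    (∀ g : Γ, ∀ v ∈ W, Matrix.mulVec (π g : Matrix (Fin n) (Fin n) ℂ) v ∈ W) →
    W = ⊥ ∨ W = ⊤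

/-- Residual finiteness: every nonidentity element avoids some finite index normal subgroup. -/
def ResiduallyFinite (Γ : Type*) [Group Γ] : Prop :=
  ∀ x : Γ, x ≠ 1 → ∃ N : Subgroup Γ, N.Normal ∧ N.FiniteIndex ∧ x ∉ N

/-- Virtually abelian: there is an abelian subgroup of finite index. -/
def VirtuallyAbelian (Γ : Type*) [Group Γ] : Prop :=
  ∃ A : Subgroup Γ, A.FiniteIndex ∧ ∀ x ∈ A, ∀ y ∈ A, x * y = y * x

/-- Amenability: a finitely additive, left-invariant probability measure on all subsets. -/
def IsAmenable (Γ : Type*) [Group Γ] : Prop :=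
  ∃ μ : Set Γ → ℝ,
    (∀ S : Set Γ, 0 ≤ μ S) ∧
    μ Set.univ = 1 ∧
    (∀ S T : Set Γ, Disjoint S T → μ (S ∪ T) = μ S + μ T) ∧
    (∀ (g : Γ) (S : Set Γ), μ ((fun x => g * x) '' S) = μ S)

/-- A real-valued function is bounded. -/
def IsBoundedFun {X : Type*} (f : X → ℝ) : Prop := ∃ C, ∀ x, |f x| ≤ C

/-- The space of bounded real-valued functions. -/
def boundedFuns (X : Type*) : Submodule ℝ (X → ℝ) where
  carrier := {f | IsBoundedFun f}
  zero_mem' := ⟨0, by simp⟩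
  add_mem' := by
    rintro f g ⟨C, hC⟩ ⟨D, hD⟩
    exact ⟨C + D, fun x => (abs_add_le _ _).trans (add_le_add (hC x) (hD x))⟩
  smul_mem' := by
    rintro c f ⟨C, hC⟩
    refine ⟨|c| * C, fun x => ?_⟩
    simpa [abs_mul] using mul_le_mul_of_nonneg_left (hC x) (abs_nonneg c)

/-- A finitely additive mean on bounded functions on a group which is invariant under left
translation, extended linearly (in an arbitrary way) to all functions. -/
structure InvMean (Γ : Type*) [Group Γ] where
  toLin : (Γ → ℝ) →ₗ[ℝ] ℝ
  nonneg : ∀ f : Γ → ℝ, IsBoundedFun f → (∀ x, 0 ≤ f x) → 0 ≤ toLin f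
  one : toLin (fun _ => 1) = 1
  inv : ∀ (h : Γ) (f : Γ → ℝ), IsBoundedFun f → toLin (fun x => f (h * x)) = toLin f

/-- Left translation as a linear operator on functions. -/
def leftTranslate {Γ : Type*} [Group Γ] (a : Γ) : (Γ → ℝ) →ₗ[ℝ] (Γ → ℝ) where
  toFun f := fun x => f (a * x)
  map_add' _ _ := rfl
  map_smul' _ _ := rfl

lemma leftTranslate_pow {Γ : Type*} [Group Γ] (a : Γ) (k : ℕ) :
    leftTranslate a ^ k = leftTranslate (a ^ k) := by
  induction k with
  | zero => ext f x; simp [leftTranslate]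
  | succ k ih =>
    ext f x
    rw [pow_succ, ih, pow_succ', Module.End.mul_apply]
    simp [leftTranslate, mul_assoc]

lemma leftTranslate_commute {Γ : Type*} [Group Γ] {a b : Γ} (h : a * b = b * a) :
    Commute (leftTranslate a) (leftTranslate b) := by
  refine LinearMap.ext fun f => funext fun x => ?_
  simp only [Module.End.mul_apply, leftTranslate, LinearMap.coe_mk, AddHom.coe_mk, ← mul_assoc, h]

/-- The Cesàro averages of left translations. -/
noncomputable def cesaro {Γ : Type*} [Group Γ] (a : Γ) (k : ℕ) : (Γ → ℝ) →ₗ[ℝ] (Γ → ℝ) :=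
  ((k : ℝ) + 1)⁻¹ • ∑ j ∈ Finset.range (k + 1), leftTranslate a ^ j

lemma cesaro_apply {Γ : Type*} [Group Γ] (a : Γ) (k : ℕ) (f : Γ → ℝ) (x : Γ) :
    cesaro a k f x = ((k : ℝ) + 1)⁻¹ * ∑ j ∈ Finset.range (k + 1), f (a ^ j * x) := by
  simp only [cesaro, leftTranslate_pow, LinearMap.smul_apply, LinearMap.sum_apply, Pi.smul_apply,
    Finset.sum_apply, smul_eq_mul]
  rfl

lemma cesaro_le {Γ : Type*} [Group Γ] (a : Γ) (k : ℕ) {f : Γ → ℝ} {c : ℝ} (h : ∀ x, f x ≤ c)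
    (x : Γ) : cesaro a k f x ≤ c := by
  rw [cesaro_apply, inv_mul_le_iff₀ (by positivity)]
  refine (Finset.sum_le_card_nsmul _ _ c fun j _ => h _).trans ?_
  simp

/-- The monoid generated by Cesàro averages along elements of a subgroup. -/
def averagingMonoid {Γ : Type*} [Group Γ] (A : Subgroup Γ) : Submonoid (Module.End ℝ (Γ → ℝ)) :=
  Submonoid.closure {S | ∃ a ∈ A, ∃ k, S = cesaro a k}

lemma averagingMonoid_le {Γ : Type*} [Group Γ] {A : Subgroup Γ} {S : Module.End ℝ (Γ → ℝ)}
    (hS : S ∈ averagingMonoid A) {f : Γ → ℝ} {c : ℝ} (h : ∀ x, f x ≤ c) (x : Γ) : S f x ≤ c := by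
  induction hS using Submonoid.closure_induction generalizing f x with
  | mem S hS => obtain ⟨a, -, k, rfl⟩ := hS; exact cesaro_le a k h x
  | one => exact h x
  | mul S T _ _ hS hT => exact hS (fun y => hT h y) x

lemma averagingMonoid_comm {Γ : Type*} [Group Γ] {A : Subgroup Γ}
    (hA : ∀ x ∈ A, ∀ y ∈ A, x * y = y * x) {S T : Module.End ℝ (Γ → ℝ)}
    (hS : S ∈ averagingMonoid A) (hT : T ∈ averagingMonoid A) : Commute S T := by
  induction hS, hT using Submonoid.closure_induction₂ with
  | mem S T hS hT =>
    obtain ⟨a, ha, k, rfl⟩ := hS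
    obtain ⟨b, hb, l, rfl⟩ := hT
    refine Commute.smul_left (Commute.smul_right ?_ _) _
    exact Commute.sum_left _ _ _ fun i _ => Commute.sum_right _ _ _ fun j _ =>
      (leftTranslate_commute (hA a ha b hb)).pow_pow i j
  | one_left => exact Commute.one_left _
  | one_right => exact Commute.one_right _
  | mul_left _ _ _ _ _ _ h h' => exact h.mul_left h'
  | mul_right _ _ _ _ _ _ h h' => exact h.mul_right h'

/-- The set of uniform upper bounds of averages of a function. -/
def averageBounds {Γ : Type*} [Group Γ] (A : Subgroup Γ) (f : Γ → ℝ) : Set ℝ :=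
  {c | ∃ S ∈ averagingMonoid A, ∀ x, S f x ≤ c}

lemma averageBounds_nonempty {Γ : Type*} [Group Γ] (A : Subgroup Γ) {f : Γ → ℝ}
    (hf : IsBoundedFun f) : (averageBounds A f).Nonempty := by
  obtain ⟨C, hC⟩ := hf
  exact ⟨C, 1, one_mem _, fun x => (abs_le.1 (hC x)).2⟩

lemma averageBounds_bddBelow {Γ : Type*} [Group Γ] (A : Subgroup Γ) {f : Γ → ℝ}
    (hf : IsBoundedFun f) : BddBelow (averageBounds A f) := by
  obtain ⟨C, hC⟩ := hf
  refine ⟨-C, ?_⟩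
  rintro c ⟨S, hS, h⟩
  have := averagingMonoid_le hS (f := -f) (c := C)
    (fun x => by have := (abs_le.1 (hC x)).1; simp; linarith) 1
  have h1 := h 1
  simp only [map_neg, Pi.neg_apply] at this
  linarith

open Pointwise in
lemma averageBounds_smul {Γ : Type*} [Group Γ] (A : Subgroup Γ) (f : Γ → ℝ) {r : ℝ}
    (hr : 0 < r) : averageBounds A (r • f) = r • averageBounds A f := by
  ext c
  rw [Set.mem_smul_set_iff_inv_smul_mem₀ hr.ne']
  refine exists_congr fun S => and_congr_right fun _ => forall_congr' fun x => ?_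
  rw [map_smul, Pi.smul_apply, smul_eq_mul, smul_eq_mul, ← div_eq_inv_mul, le_div_iff₀ hr,
    mul_comm]

/-- Existence of a mean invariant under translation by a commutative subgroup. -/
lemma exists_mean_of_comm {Γ : Type*} [Group Γ] (A : Subgroup Γ)
    (hA : ∀ x ∈ A, ∀ y ∈ A, x * y = y * x) :
    ∃ m : (Γ → ℝ) →ₗ[ℝ] ℝ, (∀ f : Γ → ℝ, IsBoundedFun f → (∀ x, 0 ≤ f x) → 0 ≤ m f) ∧
      m (fun _ => 1) = 1 ∧
      ∀ a ∈ A, ∀ f : Γ → ℝ, IsBoundedFun f → m (fun x => f (a * x)) = m f := by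
  have hsmul : ∀ c : ℝ, 0 < c → ∀ f : boundedFuns Γ,
      sInf (averageBounds A (c • f : boundedFuns Γ)) = c * sInf (averageBounds A f) := by
    intro c hc f
    simp only [Submodule.coe_smul, averageBounds_smul A _ hc]
    rw [Real.sInf_smul_of_nonneg hc.le, smul_eq_mul]
  have hadd : ∀ f g : boundedFuns Γ, sInf (averageBounds A (f + g : boundedFuns Γ)) ≤
      sInf (averageBounds A f) + sInf (averageBounds A g) := by
    rintro ⟨f, hf⟩ ⟨g, hg⟩
    simp only [Submodule.coe_add]
    refine le_of_forall_pos_lt_add fun η hη => ?_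
    obtain ⟨c, ⟨S, hS, hSc⟩, hc⟩ := Real.lt_sInf_add_pos (averageBounds_nonempty A hf)
      (half_pos hη)
    obtain ⟨d, ⟨T, hT, hTd⟩, hd⟩ := Real.lt_sInf_add_pos (averageBounds_nonempty A hg)
      (half_pos hη)
    have : sInf (averageBounds A (f + g)) ≤ c + d := by
      refine csInf_le (averageBounds_bddBelow A ((boundedFuns Γ).add_mem hf hg))
        ⟨S * T, mul_mem hS hT, fun x => ?_⟩
      rw [map_add, Pi.add_apply]
      refine add_le_add ?_ (averagingMonoid_le hS hTd x)
      rw [(averagingMonoid_comm hA hS hT).eq]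
      exact averagingMonoid_le hT hSc x
    linarith
  have hzero : ∀ f : (⊥ : boundedFuns Γ →ₗ.[ℝ] ℝ).domain, (⊥ : boundedFuns Γ →ₗ.[ℝ] ℝ) f ≤
      sInf (averageBounds A (f : boundedFuns Γ)) := by
    intro f
    obtain rfl : f = 0 := Subtype.ext ((Submodule.mem_bot ℝ).1 f.2)
    rw [LinearPMap.map_zero]
    refine le_csInf (averageBounds_nonempty A ⟨0, by simp⟩) ?_
    rintro c ⟨S, -, h⟩
    simpa using h 1
  obtain ⟨g, -, hg⟩ := exists_extension_of_le_sublinear (⊥ : boundedFuns Γ →ₗ.[ℝ] ℝ)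
    (fun f => sInf (averageBounds A f)) hsmul hadd hzero
  obtain ⟨m, hm⟩ := g.exists_extend
  have hle : ∀ f : Γ → ℝ, IsBoundedFun f → ∀ c ∈ averageBounds A f, m f ≤ c := by
    intro f hf c hc
    have h1 : m f = g ⟨f, hf⟩ := DFunLike.congr_fun hm ⟨f, hf⟩
    rw [h1]
    exact (hg ⟨f, hf⟩).trans (csInf_le (averageBounds_bddBelow A hf) hc)
  have hneg : ∀ f : Γ → ℝ, IsBoundedFun f → IsBoundedFun (-f) :=
    fun f hf => (boundedFuns Γ).neg_mem hf
  have hle' : ∀ f : Γ → ℝ, IsBoundedFun f → ∀ c, (∀ x, f x ≤ c) → m f ≤ c :=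
    fun f hf c hc => hle f hf c ⟨1, one_mem _, hc⟩
  have hone : IsBoundedFun (fun _ : Γ => (1 : ℝ)) := ⟨1, by simp⟩
  have hinv : ∀ a ∈ A, ∀ f : Γ → ℝ, IsBoundedFun f → m f ≤ m (fun x => f (a * x)) := by
    intro a ha f hf
    obtain ⟨C, hC⟩ := id hf
    have hf' : IsBoundedFun (fun x => f (a * x)) := ⟨C, fun x => hC _⟩
    have hd : IsBoundedFun (f - fun x => f (a * x)) := (boundedFuns Γ).sub_mem hf hf'
    have key : ∀ k : ℕ, m f - m (fun x => f (a * x)) ≤ (2 * C) * (1 / ((k : ℝ) + 1)) := by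
      intro k
      rw [← map_sub]
      refine hle _ hd _ ⟨cesaro a k, Submonoid.subset_closure ⟨a, ha, k, rfl⟩, fun x => ?_⟩
      rw [cesaro_apply, one_div, mul_comm]
      refine mul_le_mul_of_nonneg_right ?_ (by positivity)
      have : ∑ j ∈ Finset.range (k + 1), (f - fun x => f (a * x)) (a ^ j * x)
          = f x - f (a ^ (k + 1) * x) := by
        rw [← neg_inj, ← Finset.sum_neg_distrib]
        have := Finset.sum_range_sub (fun j => f (a ^ j * x)) (k + 1)
        simpa [pow_succ', mul_assoc] using this
      rw [this]
      have h1 := abs_le.1 (hC x)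
      have h2 := abs_le.1 (hC (a ^ (k + 1) * x))
      linarith
    have hlim := (tendsto_one_div_add_atTop_nhds_zero_nat (𝕜 := ℝ)).const_mul (2 * C)
    have := ge_of_tendsto' hlim key
    linarith
  refine ⟨m, fun f hf h0 => ?_, le_antisymm (hle' _ hone 1 fun _ => le_rfl) ?_, ?_⟩
  · have := hle' (-f) (hneg f hf) 0 (fun x => by simpa using h0 x)
    rw [map_neg] at this
    linarith
  · have := hle' (-fun _ => 1) (hneg _ hone) (-1) (fun x => by simp)
    rw [map_neg] at this
    linarith
  · intro a ha f hf
    refine le_antisymm ?_ (hinv a ha f hf)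
    have := hinv a⁻¹ (inv_mem ha) (fun x => f (a * x)) (hf.imp fun C hC x => hC _)
    simpa using this

/-- Virtually abelian groups are amenable. -/
lemma exists_invMean {Γ : Type*} [Group Γ] (A : Subgroup Γ) (hi : A.index ≠ 0)
    (hA : ∀ x ∈ A, ∀ y ∈ A, x * y = y * x) : Nonempty (InvMean Γ) := by
  obtain ⟨m, hpos, hone, hinv⟩ := exists_mean_of_comm A hA
  have : A.FiniteIndex := ⟨hi⟩
  have : Fintype (Γ ⧸ A) := Fintype.ofFinite _
  have hcard : (0 : ℝ) < Fintype.card (Γ ⧸ A) := by exact_mod_cast Fintype.card_pos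
  have hb : ∀ (h : Γ) (f : Γ → ℝ), IsBoundedFun f → IsBoundedFun (fun x => f (h * x)) :=
    fun h f hf => hf.imp fun C hC x => hC _
  refine ⟨⟨(Fintype.card (Γ ⧸ A) : ℝ)⁻¹ • ∑ c : Γ ⧸ A, m ∘ₗ leftTranslate c.out, ?_, ?_, ?_⟩⟩
  · intro f hf h0
    simp only [LinearMap.smul_apply, LinearMap.sum_apply, LinearMap.comp_apply, smul_eq_mul]
    exact mul_nonneg (inv_nonneg.2 hcard.le)
      (Finset.sum_nonneg fun c _ => hpos _ (hb _ f hf) fun x => h0 _)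
  · simp only [LinearMap.smul_apply, LinearMap.sum_apply, LinearMap.comp_apply, smul_eq_mul]
    have : ∀ c : Γ ⧸ A, m (leftTranslate c.out (fun _ => 1)) = 1 := fun c => hone
    simp [this, hcard.ne']
  · intro h f hf
    simp only [LinearMap.smul_apply, LinearMap.sum_apply, LinearMap.comp_apply, smul_eq_mul]
    congr 1
    refine Fintype.sum_equiv (MulAction.toPerm h) _ _ fun c => ?_
    have hc : (h • c).out⁻¹ * (h * c.out) ∈ A := by
      rw [← QuotientGroup.eq, QuotientGroup.out_eq']
      conv_lhs => rw [← QuotientGroup.out_eq' c]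
      rfl
    have := hinv _ hc (fun x => f ((h • c).out * x)) (hb _ f hf)
    simpa [leftTranslate, mul_assoc] using this

namespace InvMean

variable {Γ : Type*} [Group Γ] (M : InvMean Γ) {E : Type*} [NormedAddCommGroup E]
  [InnerProductSpace ℂ E]

/-- The complex-linear extension of an invariant mean. -/
noncomputable def complexMean (F : Γ → ℂ) : ℂ :=
  (M.toLin fun x => (F x).re : ℂ) + (M.toLin fun x => (F x).im : ℂ) * Complex.I

lemma complexMean_re (F : Γ → ℂ) : (M.complexMean F).re = M.toLin fun x => (F x).re := by
  simp [complexMean]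

lemma complexMean_add (F G : Γ → ℂ) :
    M.complexMean (fun x => F x + G x) = M.complexMean F + M.complexMean G := by
  have h1 : (fun x => (F x + G x).re) = (fun x => (F x).re) + fun x => (G x).re := rfl
  have h2 : (fun x => (F x + G x).im) = (fun x => (F x).im) + fun x => (G x).im := rfl
  simp only [complexMean, h1, h2, map_add]
  push_cast
  ring

lemma complexMean_mul (c : ℂ) (F : Γ → ℂ) :
    M.complexMean (fun x => c * F x) = c * M.complexMean F := by
  have h1 : (fun x => (c * F x).re) = c.re • (fun x => (F x).re) - c.im • fun x => (F x).im := by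
    ext x; simp
  have h2 : (fun x => (c * F x).im) = c.re • (fun x => (F x).im) + c.im • fun x => (F x).re := by
    ext x; simp
  simp only [complexMean, h1, h2, map_add, map_sub, map_smul, smul_eq_mul]
  apply Complex.ext <;> simp

lemma complexMean_conj (F : Γ → ℂ) :
    M.complexMean (fun x => (starRingEnd ℂ) (F x)) = (starRingEnd ℂ) (M.complexMean F) := by
  have h2 : (fun x => ((starRingEnd ℂ) (F x)).im) = -fun x => (F x).im := by ext x; simp
  simp only [complexMean, h2, map_neg]
  apply Complex.ext <;> simp

lemma mono {f g : Γ → ℝ} (hf : IsBoundedFun f) (hg : IsBoundedFun g) (h : ∀ x, f x ≤ g x) :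
    M.toLin f ≤ M.toLin g := by
  have := M.nonneg (g - f) ((boundedFuns Γ).sub_mem hg hf) (fun x => by simpa using h x)
  rw [map_sub] at this
  linarith

lemma const (c : ℝ) : M.toLin (fun _ => c) = c := by
  have : (fun _ : Γ => c) = c • fun _ => (1 : ℝ) := by ext; simp
  rw [this, map_smul, M.one, smul_eq_mul, mul_one]

lemma le_of_forall_le {f : Γ → ℝ} (hf : IsBoundedFun f) {c : ℝ} (h : ∀ x, f x ≤ c) :
    M.toLin f ≤ c := by
  simpa only [M.const] using M.mono hf ⟨|c|, fun _ => le_rfl⟩ h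

lemma le_of_forall_ge {f : Γ → ℝ} (hf : IsBoundedFun f) {c : ℝ} (h : ∀ x, c ≤ f x) :
    c ≤ M.toLin f := by
  simpa only [M.const] using M.mono ⟨|c|, fun _ => le_rfl⟩ hf h

end InvMean

/-- The space of bounded functions on a group with values in an inner product space. -/
def boundedMaps (Γ E : Type*) [NormedAddCommGroup E] [InnerProductSpace ℂ E] :
    Submodule ℂ (Γ → E) where
  carrier := {f | ∃ C, ∀ x, ‖f x‖ ≤ C}
  zero_mem' := ⟨0, by simp⟩
  add_mem' := by
    rintro f g ⟨C, hC⟩ ⟨D, hD⟩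
    exact ⟨C + D, fun x => (norm_add_le _ _).trans (add_le_add (hC x) (hD x))⟩
  smul_mem' := by
    rintro c f ⟨C, hC⟩
    refine ⟨‖c‖ * C, fun x => ?_⟩
    simpa [norm_smul] using mul_le_mul_of_nonneg_left (hC x) (norm_nonneg c)

/-- Bounded functions on a group, regarded as a pre-Hilbert space through an invariant mean. -/
def PreL2 {Γ : Type*} [Group Γ] (_ : InvMean Γ) (E : Type*) [NormedAddCommGroup E]
    [InnerProductSpace ℂ E] : Type _ :=
  boundedMaps Γ E

namespace PreL2

variable {Γ : Type*} [Group Γ] {M : InvMean Γ} {E : Type*} [NormedAddCommGroup E]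
  [InnerProductSpace ℂ E]

noncomputable instance : AddCommGroup (PreL2 M E) := inferInstanceAs (AddCommGroup (boundedMaps Γ E))

noncomputable instance : Module ℂ (PreL2 M E) := inferInstanceAs (Module ℂ (boundedMaps Γ E))

instance : CoeFun (PreL2 M E) fun _ => Γ → E := ⟨fun f => f.1⟩

lemma add_apply (f g : PreL2 M E) (x : Γ) : (f + g) x = f x + g x := rfl

lemma smul_apply (c : ℂ) (f : PreL2 M E) (x : Γ) : (c • f) x = c • f x := rfl

lemma isBoundedFun_norm_sq (f : PreL2 M E) : IsBoundedFun fun x => ‖f x‖ ^ 2 := by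
  obtain ⟨C, hC⟩ := f.2
  exact ⟨C ^ 2, fun x => by
    rw [abs_of_nonneg (by positivity)]; exact pow_le_pow_left₀ (norm_nonneg _) (hC x) 2⟩

/-- The mean of the pointwise inner product. -/
@[reducible]
noncomputable def core (M : InvMean Γ) (E : Type*) [NormedAddCommGroup E]
    [InnerProductSpace ℂ E] : PreInnerProductSpace.Core ℂ (PreL2 M E) where
  inner f g := M.complexMean fun x => inner ℂ (f x) (g x)
  conj_inner_symm f g := by
    rw [← M.complexMean_conj]
    simp only [inner_conj_symm]
  re_inner_nonneg f := by
    change 0 ≤ (M.complexMean _).re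
    rw [M.complexMean_re]
    have : (fun x => (inner ℂ (f x) (f x)).re) = fun x => ‖f x‖ ^ 2 := by
      ext x; exact inner_self_eq_norm_sq (𝕜 := ℂ) (f x)
    rw [this]
    exact M.nonneg _ f.isBoundedFun_norm_sq fun x => by positivity
  add_left f g h := by
    simp only [add_apply, inner_add_left, M.complexMean_add]
  smul_left f g c := by
    simp only [smul_apply, inner_smul_left, M.complexMean_mul]

noncomputable instance : SeminormedAddCommGroup (PreL2 M E) :=
  @InnerProductSpace.Core.toSeminormedAddCommGroup ℂ (PreL2 M E) _ _ _ (core M E)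

noncomputable instance : InnerProductSpace ℂ (PreL2 M E) :=
  InnerProductSpace.ofCore (core M E)

lemma norm_sq (f : PreL2 M E) : ‖f‖ ^ 2 = M.toLin fun x => ‖f x‖ ^ 2 := by
  rw [← inner_self_eq_norm_sq (𝕜 := ℂ)]
  change (M.complexMean fun x => inner ℂ (f x) (f x)).re = _
  rw [M.complexMean_re]
  congr 1
  ext x
  exact inner_self_eq_norm_sq (𝕜 := ℂ) (f x)

/-- Left translation on bounded functions, as an isometry. -/
noncomputable def translateIsometry (M : InvMean Γ) (E : Type*) [NormedAddCommGroup E]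
    [InnerProductSpace ℂ E] (h : Γ) : PreL2 M E →ₗᵢ[ℂ] PreL2 M E where
  toFun f := ⟨fun x => f (h⁻¹ * x), f.2.imp fun _ hC _ => hC _⟩
  map_add' _ _ := rfl
  map_smul' _ _ := rfl
  norm_map' f := by
    rw [← sq_eq_sq₀ (norm_nonneg _) (norm_nonneg _), norm_sq, norm_sq]
    exact M.inv h⁻¹ (fun x => ‖f x‖ ^ 2) f.isBoundedFun_norm_sq

/-- The translation action on the completed space. -/
noncomputable def translation (M : InvMean Γ) (E : Type*) [NormedAddCommGroup E]
    [InnerProductSpace ℂ E] :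
    Γ →* Module.End ℂ (UniformSpace.Completion (PreL2 M E)) where
  toFun h := (translateIsometry M E h).toContinuousLinearMap.completion.toLinearMap
  map_one' := by
    ext ξ
    induction ξ using UniformSpace.Completion.induction_on with
    | hp => exact isClosed_eq (ContinuousLinearMap.continuous _) continuous_id
    | ih f =>
      simp only [ContinuousLinearMap.coe_coe, ContinuousLinearMap.completion_apply_coe]
      congr 1
      exact Subtype.ext (funext fun x => by
        change f (1⁻¹ * x) = f x
        simp)
  map_mul' g h := by
    ext ξ
    induction ξ using UniformSpace.Completion.induction_on with
    | hp =>
      exact isClosed_eq (ContinuousLinearMap.continuous _)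
        ((translateIsometry M E g).toContinuousLinearMap.completion.continuous.comp
          (translateIsometry M E h).toContinuousLinearMap.completion.continuous)
    | ih f =>
      simp only [ContinuousLinearMap.coe_coe, ContinuousLinearMap.completion_apply_coe,
        Module.End.mul_apply]
      congr 1
      exact Subtype.ext (funext fun x => by
        change f ((g * h)⁻¹ * x) = f (h⁻¹ * (g⁻¹ * x))
        simp [mul_assoc])

lemma translation_coe (h : Γ) (f : PreL2 M E) :
    translation M E h (f : UniformSpace.Completion (PreL2 M E)) =
      (translateIsometry M E h f : PreL2 M E) :=
  ContinuousLinearMap.completion_apply_coe _ _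

lemma norm_translation (h : Γ) (ξ : UniformSpace.Completion (PreL2 M E)) :
    ‖translation M E h ξ‖ = ‖ξ‖ := by
  induction ξ using UniformSpace.Completion.induction_on with
  | hp =>
    exact isClosed_eq (continuous_norm.comp (ContinuousLinearMap.continuous _)) continuous_norm
  | ih f =>
    rw [translation_coe, UniformSpace.Completion.norm_coe, UniformSpace.Completion.norm_coe]
    exact (translateIsometry M E h).norm_map f

end PreL2

section Compactness

variable {H K : Type*} [NormedAddCommGroup H] [InnerProductSpace ℂ H]
  [NormedAddCommGroup K] [InnerProductSpace ℂ K]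

lemma Orthonormal.fin_cons {k : ℕ} {w : Fin k → H} (hw : Orthonormal ℂ w) {x : H} (hx : ‖x‖ = 1)
    (h : ∀ i, inner ℂ (w i) x = 0) : Orthonormal ℂ (Fin.cons x w : Fin (k + 1) → H) := by
  refine ⟨fun i => ?_, fun i j hij => ?_⟩
  · induction i using Fin.cases with
    | zero => simpa using hx
    | succ i => simpa using hw.1 i
  · induction i using Fin.cases with
    | zero =>
      induction j using Fin.cases with
      | zero => exact absurd rfl hij
      | succ j => simpa using inner_eq_zero_symm.1 (h j)
    | succ i =>
      induction j using Fin.cases with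
      | zero => simpa using h i
      | succ j => simpa using hw.2 (fun hij' => hij (by rw [hij']))

/-- A bounded operator whose square sums over orthonormal systems are uniformly bounded is
small off a finite-dimensional subspace. -/
lemma exists_finiteDimensional_of_sum_le (B : H →L[ℂ] K) {C : ℝ}
    (hB : ∀ (k : ℕ) (w : Fin k → H), Orthonormal ℂ w → ∑ j, ‖B (w j)‖ ^ 2 ≤ C) {η : ℝ}
    (hη : 0 < η) :
    ∃ F : Submodule ℂ H, FiniteDimensional ℂ F ∧ ∀ x ∈ Fᗮ, ‖B x‖ ^ 2 ≤ η * ‖x‖ ^ 2 := by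
  set S : Set ℝ := {t | ∃ (k : ℕ) (w : Fin k → H), Orthonormal ℂ w ∧ t = ∑ j, ‖B (w j)‖ ^ 2}
  have hne : S.Nonempty := ⟨_, 0, Fin.elim0, ⟨fun i => i.elim0, fun i => i.elim0⟩, rfl⟩
  have hbdd : BddAbove S := by
    refine ⟨C, ?_⟩
    rintro t ⟨k, w, hw, rfl⟩
    exact hB k w hw
  obtain ⟨t, ⟨k, w, hw, rfl⟩, ht⟩ := exists_lt_of_lt_csSup hne (sub_lt_self (sSup S) hη)
  refine ⟨Submodule.span ℂ (Set.range w), FiniteDimensional.span_of_finite ℂ (Set.finite_range w),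
    fun x hx => ?_⟩
  rcases eq_or_ne x 0 with rfl | hx0
  · simp
  have hxn : 0 < ‖x‖ := norm_pos_iff.2 hx0
  set y : H := ((‖x‖⁻¹ : ℝ) : ℂ) • x with hy
  have hyn : ‖y‖ = 1 := by
    rw [hy, norm_smul, Complex.norm_real, norm_inv, norm_norm, inv_mul_cancel₀ hxn.ne']
  have horth : ∀ i, inner ℂ (w i) y = 0 := fun i => by
    rw [hy, inner_smul_right, hx (w i) (Submodule.subset_span ⟨i, rfl⟩), mul_zero]
  have h1 : ∑ j, ‖B ((Fin.cons y w : Fin (k + 1) → H) j)‖ ^ 2 ≤ sSup S :=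
    le_csSup hbdd ⟨k + 1, _, hw.fin_cons hyn horth, rfl⟩
  rw [Fin.sum_univ_succ] at h1
  simp only [Fin.cons_zero, Fin.cons_succ] at h1
  have h2 : ‖B y‖ ^ 2 ≤ η := by linarith
  rw [hy, map_smul, norm_smul, Complex.norm_real, norm_inv, norm_norm, mul_pow, inv_pow,
    inv_mul_le_iff₀ (by positivity)] at h2
  linarith

lemma isCompactOperator_of_sum_le [CompleteSpace K] (B : H →L[ℂ] K) {C : ℝ}
    (hB : ∀ (k : ℕ) (w : Fin k → H), Orthonormal ℂ w → ∑ j, ‖B (w j)‖ ^ 2 ≤ C) :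
    IsCompactOperator B := by
  have : B ∈ closure {f : H →L[ℂ] K | IsCompactOperator f} := by
    refine Metric.mem_closure_iff.2 fun r hr => ?_
    obtain ⟨F, hF, h⟩ := exists_finiteDimensional_of_sum_le B hB (η := (r / 2) ^ 2) (by positivity)
    refine ⟨B ∘L F.starProjection, ?_, ?_⟩
    · have h1 : IsCompactOperator F.orthogonalProjectionOnto :=
        isCompactOperator_of_locallyCompactSpace_dom _
      exact h1.clm_comp (B ∘L F.subtypeL)
    · rw [dist_eq_norm]
      refine (ContinuousLinearMap.opNorm_le_bound _ (half_pos hr).le fun x => ?_).trans_lt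
        (half_lt_self hr)
      have h2 := h _ (F.sub_starProjection_mem_orthogonal x)
      rw [← mul_pow, map_sub] at h2
      refine ((sq_le_sq₀ (norm_nonneg _) (by positivity)).1 h2).trans ?_
      refine mul_le_mul_of_nonneg_left ?_ (by positivity)
      rw [← Submodule.starProjection_orthogonal_val]
      exact (Fᗮ.starProjection.le_of_opNorm_le Fᗮ.starProjection_norm_le x).trans (by simp)
  rwa [isClosed_setOfPred_isCompactOperator.closure_eq] at this

end Compactness

section UnitaryRep

variable {Γ : Type*} [Group Γ] {H : Type*} [NormedAddCommGroup H] [InnerProductSpace ℂ H]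
  {ρ : Γ →* Module.End ℂ H}

/-- A representation is unitary if it preserves the norm. -/
def IsUnitaryRep (ρ : Γ →* Module.End ℂ H) : Prop := ∀ g x, ‖ρ g x‖ = ‖x‖

/-- A subspace is invariant under a representation. -/
def IsInvariantSubspace (ρ : Γ →* Module.End ℂ H) (W : Submodule ℂ H) : Prop :=
  ∀ g, ∀ x ∈ W, ρ g x ∈ W

lemma rep_mul_apply (g h : Γ) (x : H) : ρ (g * h) x = ρ g (ρ h x) := by
  rw [map_mul, Module.End.mul_apply]

lemma rep_inv_apply (g : Γ) (x : H) : ρ g (ρ g⁻¹ x) = x := by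
  rw [← rep_mul_apply, mul_inv_cancel, map_one, Module.End.one_apply]

lemma IsUnitaryRep.inner_map_map (hρ : IsUnitaryRep ρ) (g : Γ) (x y : H) :
    inner ℂ (ρ g x) (ρ g y) = inner ℂ x y :=
  (⟨ρ g, hρ g⟩ : H →ₗᵢ[ℂ] H).inner_map_map x y

lemma IsUnitaryRep.inner_map_left (hρ : IsUnitaryRep ρ) (g : Γ) (x y : H) :
    inner ℂ (ρ g x) y = inner ℂ x (ρ g⁻¹ y) := by
  rw [← hρ.inner_map_map g x, rep_inv_apply]

lemma IsUnitaryRep.inner_map_right (hρ : IsUnitaryRep ρ) (g : Γ) (x y : H) :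
    inner ℂ x (ρ g y) = inner ℂ (ρ g⁻¹ x) y := by
  rw [hρ.inner_map_left, inv_inv]

lemma IsUnitaryRep.orthonormal (hρ : IsUnitaryRep ρ) (g : Γ) {ι : Type*} {v : ι → H}
    (hv : Orthonormal ℂ v) : Orthonormal ℂ fun i => ρ g (v i) :=
  hv.comp_linearIsometry ⟨ρ g, hρ g⟩

lemma IsInvariantSubspace.orthogonal (hρ : IsUnitaryRep ρ) {W : Submodule ℂ H}
    (hW : IsInvariantSubspace ρ W) : IsInvariantSubspace ρ Wᗮ := by
  intro g x hx w hw
  rw [hρ.inner_map_right]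
  exact hx _ (hW _ _ hw)

lemma IsInvariantSubspace.sup {V W : Submodule ℂ H} (hV : IsInvariantSubspace ρ V)
    (hW : IsInvariantSubspace ρ W) : IsInvariantSubspace ρ (V ⊔ W) := by
  intro g x hx
  obtain ⟨v, hv, w, hw, rfl⟩ := Submodule.mem_sup.1 hx
  rw [map_add]
  exact Submodule.add_mem_sup (hV g v hv) (hW g w hw)

lemma IsInvariantSubspace.inf {V W : Submodule ℂ H} (hV : IsInvariantSubspace ρ V)
    (hW : IsInvariantSubspace ρ W) : IsInvariantSubspace ρ (V ⊓ W) :=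
  fun g x hx => ⟨hV g x hx.1, hW g x hx.2⟩

lemma IsInvariantSubspace.starProjection (hρ : IsUnitaryRep ρ) {W : Submodule ℂ H}
    [W.HasOrthogonalProjection] (hW : IsInvariantSubspace ρ W) (g : Γ) (x : H) :
    W.starProjection (ρ g x) = ρ g (W.starProjection x) := by
  refine Submodule.eq_starProjection_of_mem_orthogonal'
    (hW g _ (W.starProjection_apply_mem x))
    (hW.orthogonal hρ g _ (W.sub_starProjection_mem_orthogonal x)) ?_
  rw [← map_add, add_sub_cancel]

end UnitaryRep

section Spectral

variable {Γ : Type*} [Group Γ] {H K : Type*} [NormedAddCommGroup H] [InnerProductSpace ℂ H]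
  [NormedAddCommGroup K] [InnerProductSpace ℂ K] {ρ : Γ →* Module.End ℂ H}

lemma inner_map_map_of_norm_eq {B : H →L[ℂ] K} {S : H →ₗ[ℂ] H} (h : ∀ x, ‖B (S x)‖ = ‖B x‖)
    (x y : H) : inner ℂ (B (S x)) (B (S y)) = inner ℂ (B x) (B y) := by
  simp only [inner_eq_sum_norm_sq_div_four, ← map_add, ← map_sub, ← map_smul, h]

/-- The conditions on the spectral subspace of a positive operator above a threshold. -/
structure IsSpectralSubspace (ρ : Γ →* Module.End ℂ H) (B : H →L[ℂ] K) (c : ℝ)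
    (W : Submodule ℂ H) : Prop where
  finiteDimensional : FiniteDimensional ℂ W
  invariant : IsInvariantSubspace ρ W
  le_norm_sq : ∀ x ∈ W, c * ‖x‖ ^ 2 ≤ ‖B x‖ ^ 2
  inner_eq_zero : ∀ x ∈ W, ∀ y ∈ Wᗮ, inner ℂ (B x) (B y) = 0

lemma IsSpectralSubspace.finrank_le {B : H →L[ℂ] K} {c C : ℝ} {W : Submodule ℂ H}
    (hW : IsSpectralSubspace ρ B c W)
    (hB : ∀ (k : ℕ) (w : Fin k → H), Orthonormal ℂ w → ∑ j, ‖B (w j)‖ ^ 2 ≤ C) :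
    c * Module.finrank ℂ W ≤ C := by
  have := hW.finiteDimensional
  set b := stdOrthonormalBasis ℂ W
  have hb : Orthonormal ℂ fun i => (b i : H) := b.orthonormal.comp_linearIsometry W.subtypeₗᵢ
  refine le_trans ?_ (hB _ _ hb)
  have : ∀ i, c ≤ ‖B (b i)‖ ^ 2 := fun i => by
    have h1 := hW.le_norm_sq (b i) (b i).2
    rw [hb.1 i] at h1
    simpa using h1
  calc c * Module.finrank ℂ W = ∑ i : Fin (Module.finrank ℂ W), c := by simp [mul_comm]
    _ ≤ _ := Finset.sum_le_sum fun i _ => this i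

variable [CompleteSpace H] [CompleteSpace K]

/-- A compact operator has a singular value equal to its norm. -/
lemma IsCompactOperator.exists_singular_subspace {B : H →L[ℂ] K} (hB : IsCompactOperator B)
    {c : ℝ} (hc : 0 < c) {x : H} (hx : c * ‖x‖ ^ 2 < ‖B x‖ ^ 2) :
    ∃ μ : ℝ, c < μ ∧ ∃ W : Submodule ℂ H, FiniteDimensional ℂ W ∧ W ≠ ⊥ ∧
      ∀ w, w ∈ W ↔ ∀ y, inner ℂ (B w) (B y) = μ * inner ℂ w y := by
  set T : H →L[ℂ] H := ContinuousLinearMap.adjoint B ∘L B with hT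
  have hpos : T.IsPositive := ContinuousLinearMap.isPositive_adjoint_comp_self B
  have hcomp : IsCompactOperator T := hB.clm_comp (ContinuousLinearMap.adjoint B)
  have hx0 : x ≠ 0 := by rintro rfl; simp at hx
  have : Nontrivial H := ⟨x, 0, hx0⟩
  have hnorm : c < ‖T‖ := by
    rw [hT, ContinuousLinearMap.norm_adjoint_comp_self, ← sq]
    have h1 := pow_le_pow_left₀ (norm_nonneg _) (B.le_opNorm x) 2
    rw [mul_pow] at h1
    have : 0 < ‖x‖ ^ 2 := by have := norm_pos_iff.2 hx0; positivity
    exact lt_of_mul_lt_mul_right (hx.trans_le h1) this.le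
  obtain ⟨z, hz, hzn⟩ := spectrum.exists_nnnorm_eq_spectralRadius T
  rw [T.spectralRadius_eq_nnnorm hpos.isSelfAdjoint] at hzn
  have hzn' : ‖z‖ = ‖T‖ := by
    have : ‖z‖₊ = ‖T‖₊ := by exact_mod_cast hzn
    exact congrArg NNReal.toReal this
  have hz0 : z ≠ 0 := by
    rintro rfl
    rw [norm_zero] at hzn'
    linarith
  have hev := (hcomp.hasEigenvalue_iff_mem_spectrum hz0).2 hz
  obtain ⟨v, hv⟩ := hev.exists_hasEigenvector
  have hTv : T v = z • v := hv.apply_eq_smul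
  have hin : ∀ w y, inner ℂ (T w) y = inner ℂ (B w) (B y) := fun w y => by
    rw [hT, ContinuousLinearMap.comp_apply, ContinuousLinearMap.adjoint_inner_left]
  have hzreal : z = (‖T‖ : ℝ) := by
    have h1 := hin v v
    rw [hTv, inner_smul_left, inner_self_eq_norm_sq_to_K, inner_self_eq_norm_sq_to_K] at h1
    have hvn : (0 : ℝ) < ‖v‖ ^ 2 := by have := norm_pos_iff.2 hv.2; positivity
    have h2 : (starRingEnd ℂ) z = ((‖B v‖ ^ 2 / ‖v‖ ^ 2 : ℝ) : ℂ) := by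
      push_cast
      rw [eq_div_iff (by exact_mod_cast hvn.ne')]
      exact h1
    have h3 : z = ((‖B v‖ ^ 2 / ‖v‖ ^ 2 : ℝ) : ℂ) := by
      rw [← Complex.conj_conj z, h2, Complex.conj_ofReal]
    rw [← hzn', h3, Complex.norm_real, Real.norm_of_nonneg (by positivity)]
  refine ⟨‖T‖, hnorm, Module.End.eigenspace (T : H →ₗ[ℂ] H) z,
    ContinuousLinearMap.finite_dimensional_eigenspace hcomp z hz0, hev, fun w => ?_⟩
  rw [Module.End.mem_eigenspace_iff]
  constructor
  · intro h y
    have h' : T w = z • w := h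
    rw [← hin, h', inner_smul_left, hzreal, Complex.conj_ofReal]
  · intro h
    refine ext_inner_right ℂ fun y => ?_
    change inner ℂ (T w) y = _
    rw [hin, h, inner_smul_left, hzreal, Complex.conj_ofReal]

lemma IsSpectralSubspace.exists_larger (hρ : IsUnitaryRep ρ) {B : H →L[ℂ] K}
    (hB : IsCompactOperator B) (hinv : ∀ g x, ‖B (ρ g x)‖ = ‖B x‖) {c : ℝ} (hc : 0 < c)
    {W : Submodule ℂ H} (hW : IsSpectralSubspace ρ B c W) {x : H} (hx : x ∈ Wᗮ)
    (hxc : c * ‖x‖ ^ 2 < ‖B x‖ ^ 2) :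
    ∃ W', IsSpectralSubspace ρ B c W' ∧ W < W' := by
  have := hW.finiteDimensional
  set P := Wᗮ.starProjection
  have hP : ∀ y ∈ Wᗮ, P y = y := fun y hy => Submodule.starProjection_eq_self_iff.2 hy
  obtain ⟨μ, hμ, V, hVf, hV0, hV⟩ := IsCompactOperator.exists_singular_subspace
    (B := B ∘L P) (hB.comp_clm P) hc (x := x) (by simpa [hP x hx] using hxc)
  have hμ0 : μ ≠ 0 := (hc.trans hμ).ne'
  have hVW : V ≤ Wᗮ := by
    intro v hv w hw
    have h1 := (hV v).1 hv w
    have h2 : P w = 0 := Submodule.starProjection_orthogonal_apply_eq_zero hw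
    rw [ContinuousLinearMap.comp_apply, ContinuousLinearMap.comp_apply, h2, map_zero,
      inner_zero_right] at h1
    have h3 := (mul_eq_zero.1 h1.symm).resolve_left (by exact_mod_cast hμ0)
    exact inner_eq_zero_symm.1 h3
  have hVB : ∀ v ∈ V, ∀ y ∈ Wᗮ, inner ℂ (B v) (B y) = μ * inner ℂ v y := by
    intro v hv y hy
    have h1 := (hV v).1 hv y
    rwa [ContinuousLinearMap.comp_apply, ContinuousLinearMap.comp_apply, hP v (hVW hv),
      hP y hy] at h1
  have hVinv : IsInvariantSubspace ρ V := by
    intro g v hv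
    rw [hV]
    intro y
    have hcomm : ∀ y, (B ∘L P) (ρ g y) = B (ρ g (P y)) := fun y => by
      rw [ContinuousLinearMap.comp_apply, (hW.invariant.orthogonal hρ).starProjection hρ]
    have hnorm : ∀ y, ‖(B ∘L P) (ρ g y)‖ = ‖(B ∘L P) y‖ := fun y => by
      rw [hcomm, hinv]; rfl
    have h1 := inner_map_map_of_norm_eq hnorm v (ρ g⁻¹ y)
    rw [rep_inv_apply] at h1
    rw [h1, (hV v).1 hv, hρ.inner_map_left]
  refine ⟨W ⊔ V, ⟨inferInstance, hW.invariant.sup hVinv, ?_, ?_⟩, ?_⟩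
  · intro x hx
    obtain ⟨w, hw, v, hv, rfl⟩ := Submodule.mem_sup.1 hx
    have h1 := norm_add_sq_eq_norm_sq_add_norm_sq_of_inner_eq_zero w v (hVW hv w hw)
    have h2 := norm_add_sq_eq_norm_sq_add_norm_sq_of_inner_eq_zero (B w) (B v)
      (hW.inner_eq_zero w hw v (hVW hv))
    have h3 := hW.le_norm_sq w hw
    have h4 : ‖B v‖ ^ 2 = μ * ‖v‖ ^ 2 := by
      have := hVB v hv v (hVW hv)
      rw [inner_self_eq_norm_sq_to_K, inner_self_eq_norm_sq_to_K] at this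
      refine Complex.ofReal_injective ?_
      push_cast
      exact this
    have h5 : c * ‖v‖ ^ 2 ≤ μ * ‖v‖ ^ 2 := by gcongr
    rw [map_add]
    nlinarith
  · intro x hx y hy
    obtain ⟨w, hw, v, hv, rfl⟩ := Submodule.mem_sup.1 hx
    have hy1 : y ∈ Wᗮ := Submodule.orthogonal_le le_sup_left hy
    have hy2 : y ∈ Vᗮ := Submodule.orthogonal_le le_sup_right hy
    rw [map_add, inner_add_left, hW.inner_eq_zero w hw y hy1, hVB v hv y hy1, hy2 v hv]
    simp
  · refine lt_of_le_of_ne le_sup_left fun h => hV0 ?_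
    have hVW' : V ≤ W := by rw [h]; exact le_sup_right
    rw [eq_bot_iff, ← W.inf_orthogonal_eq_bot]
    exact le_inf hVW' hVW

/-- A compact operator invariant under a unitary representation has an invariant spectral
subspace for every positive threshold. -/
lemma exists_isSpectralSubspace (hρ : IsUnitaryRep ρ) {B : H →L[ℂ] K}
    (hinv : ∀ g x, ‖B (ρ g x)‖ = ‖B x‖) {c C : ℝ} (hc : 0 < c)
    (hB : ∀ (k : ℕ) (w : Fin k → H), Orthonormal ℂ w → ∑ j, ‖B (w j)‖ ^ 2 ≤ C) :
    ∃ W, IsSpectralSubspace ρ B c W ∧ ∀ x ∈ Wᗮ, ‖B x‖ ^ 2 ≤ c * ‖x‖ ^ 2 := by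
  set S : Set ℕ := {k | ∃ W, IsSpectralSubspace ρ B c W ∧ Module.finrank ℂ W = k}
  have hne : S.Nonempty := by
    refine ⟨_, ⊥, ⟨inferInstance, ?_, ?_, ?_⟩, rfl⟩
    · rintro g x hx
      rw [Submodule.mem_bot] at hx ⊢
      rw [hx, map_zero]
    · rintro x hx
      simp [(Submodule.mem_bot ℂ).1 hx]
    · rintro x hx
      simp [(Submodule.mem_bot ℂ).1 hx]
  have hbdd : BddAbove S := by
    refine ⟨⌊C / c⌋₊, ?_⟩
    rintro k ⟨W, hW, rfl⟩
    refine Nat.le_floor ?_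
    rw [le_div_iff₀ hc, mul_comm]
    exact hW.finrank_le hB
  obtain ⟨W, hW, hk⟩ := Nat.sSup_mem hne hbdd
  refine ⟨W, hW, fun x hx => ?_⟩
  by_contra! h
  obtain ⟨W', hW', hlt⟩ := hW.exists_larger hρ (isCompactOperator_of_sum_le B hB) hinv hc hx h
  have := hW'.finiteDimensional
  have h1 := Submodule.finrank_lt_finrank_of_lt hlt
  have h2 := le_csSup hbdd ⟨W', hW', rfl⟩
  omega

end Spectral

section Averaging

variable {Γ : Type*} [Group Γ] {H : Type*} [NormedAddCommGroup H] [InnerProductSpace ℂ H]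
  {ρ : Γ →* Module.End ℂ H} {n : ℕ} {v : Fin n → H}

lemma sum_coeff_le (hρ : IsUnitaryRep ρ) (hv : Orthonormal ℂ v) (g : Γ) (x : H) :
    ∑ i, ‖(inner ℂ (ρ g (v i)) x : ℂ)‖ ^ 2 ≤ ‖x‖ ^ 2 :=
  (hρ.orthonormal g hv).sum_inner_products_le x (s := Finset.univ)

lemma isBoundedFun_sum_coeff (hρ : IsUnitaryRep ρ) (hv : Orthonormal ℂ v) (x : H) :
    IsBoundedFun fun g => ∑ i, ‖(inner ℂ (ρ g (v i)) x : ℂ)‖ ^ 2 :=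
  ⟨‖x‖ ^ 2, fun g => by
    rw [abs_of_nonneg (Finset.sum_nonneg fun i _ => by positivity)]
    exact sum_coeff_le hρ hv g x⟩

/-- The map sending a vector to the function of its coefficients along translates of an
orthonormal system. -/
noncomputable def coeffMap (M : InvMean Γ) (hρ : IsUnitaryRep ρ) (hv : Orthonormal ℂ v) :
    H →L[ℂ] PreL2 M (EuclideanSpace ℂ (Fin n)) :=
  LinearMap.mkContinuous
    { toFun := fun x => ⟨fun g => WithLp.toLp 2 fun i => inner ℂ (ρ g (v i)) x, ‖x‖, fun g => by
        rw [← sq_le_sq₀ (norm_nonneg _) (norm_nonneg _), EuclideanSpace.norm_sq_eq]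
        exact sum_coeff_le hρ hv g x⟩
      map_add' := fun x y => Subtype.ext <| funext fun g => by
        ext i
        exact inner_add_right _ _ _
      map_smul' := fun c x => Subtype.ext <| funext fun g => by
        ext i
        exact inner_smul_right _ _ _ } 1 fun x => by
    rw [one_mul, ← sq_le_sq₀ (norm_nonneg _) (norm_nonneg _), PreL2.norm_sq]
    refine M.le_of_forall_le (PreL2.isBoundedFun_norm_sq _) fun g => ?_
    change ‖(WithLp.toLp 2 _ : EuclideanSpace ℂ (Fin n))‖ ^ 2 ≤ _
    rw [EuclideanSpace.norm_sq_eq]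
    exact sum_coeff_le hρ hv g x

lemma norm_sq_coeffMap (M : InvMean Γ) (hρ : IsUnitaryRep ρ) (hv : Orthonormal ℂ v) (x : H) :
    ‖(coeffMap M hρ hv x : UniformSpace.Completion (PreL2 M (EuclideanSpace ℂ (Fin n))))‖ ^ 2 =
      M.toLin fun g => ∑ i, ‖(inner ℂ (ρ g (v i)) x : ℂ)‖ ^ 2 := by
  rw [UniformSpace.Completion.norm_coe, PreL2.norm_sq]
  congr 1
  ext g
  change ‖(WithLp.toLp 2 _ : EuclideanSpace ℂ (Fin n))‖ ^ 2 = _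
  rw [EuclideanSpace.norm_sq_eq]

/-- The averaged coefficients are invariant. -/
lemma toLin_coeff_map (M : InvMean Γ) (hρ : IsUnitaryRep ρ) (hv : Orthonormal ℂ v) (h : Γ)
    (x : H) : (M.toLin fun g => ∑ i, ‖(inner ℂ (ρ g (v i)) (ρ h x) : ℂ)‖ ^ 2) =
      M.toLin fun g => ∑ i, ‖(inner ℂ (ρ g (v i)) x : ℂ)‖ ^ 2 := by
  rw [← M.inv h⁻¹ _ (isBoundedFun_sum_coeff hρ hv x)]
  congr 1
  ext g
  refine Finset.sum_congr rfl fun i _ => ?_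
  rw [hρ.inner_map_right, rep_mul_apply]

lemma sum_toLin_coeff_le (M : InvMean Γ) (hρ : IsUnitaryRep ρ) (hv : Orthonormal ℂ v) {k : ℕ}
    {w : Fin k → H} (hw : Orthonormal ℂ w) :
    ∑ j, (M.toLin fun g => ∑ i, ‖(inner ℂ (ρ g (v i)) (w j) : ℂ)‖ ^ 2) ≤ n := by
  rw [← map_sum]
  refine M.le_of_forall_le
    ((boundedFuns Γ).sum_mem fun j _ => isBoundedFun_sum_coeff hρ hv (w j)) fun g => ?_
  rw [Finset.sum_apply, Finset.sum_comm]
  calc _ ≤ ∑ i : Fin n, (1 : ℝ) := Finset.sum_le_sum fun i _ => ?_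
    _ = n := by simp
  have := hw.sum_inner_products_le (ρ g (v i)) (s := Finset.univ)
  rw [hρ, hv.1 i] at this
  simpa only [norm_inner_symm, one_pow] using this

/-- An almost invariant orthonormal system is close to an invariant finite-dimensional subspace of
almost the same dimension. -/
lemma exists_invariant_near [CompleteSpace H] (M : InvMean Γ) (hρ : IsUnitaryRep ρ)
    (hv : Orthonormal ℂ v) {e : ℝ} (he : 0 < e) (he1 : e < 1)
    (h : ∀ g, (1 - e ^ 2) * n ≤ ∑ j, ∑ i, ‖(inner ℂ (ρ g (v i)) (v j) : ℂ)‖ ^ 2) :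
    ∃ (W : Submodule ℂ H) (_ : FiniteDimensional ℂ W), IsInvariantSubspace ρ W ∧
      (1 - e) * Module.finrank ℂ W ≤ n ∧ (1 - e) * n ≤ ∑ i, ‖W.starProjection (v i)‖ ^ 2 := by
  set B : H →L[ℂ] UniformSpace.Completion (PreL2 M (EuclideanSpace ℂ (Fin n))) :=
    UniformSpace.Completion.toComplL ∘L coeffMap M hρ hv
  have hB : ∀ x, ‖B x‖ ^ 2 = M.toLin fun g => ∑ i, ‖(inner ℂ (ρ g (v i)) x : ℂ)‖ ^ 2 :=
    norm_sq_coeffMap M hρ hv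
  have hB1 : ∀ x, ‖B x‖ ^ 2 ≤ ‖x‖ ^ 2 := fun x => by
    rw [hB]
    exact M.le_of_forall_le (isBoundedFun_sum_coeff hρ hv x) fun g => sum_coeff_le hρ hv g x
  have htr : ∀ (k : ℕ) (w : Fin k → H), Orthonormal ℂ w → ∑ j, ‖B (w j)‖ ^ 2 ≤ (n : ℝ) := by
    intro k w hw
    simp only [hB]
    exact sum_toLin_coeff_le M hρ hv hw
  have hinv : ∀ g x, ‖B (ρ g x)‖ = ‖B x‖ := fun g x => by
    rw [← sq_eq_sq₀ (norm_nonneg _) (norm_nonneg _), hB, hB, toLin_coeff_map M hρ hv]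
  obtain ⟨W, hW, hWc⟩ := exists_isSpectralSubspace hρ hinv (sub_pos.2 he1) htr
  have := hW.finiteDimensional
  refine ⟨W, this, hW.invariant, hW.finrank_le htr, ?_⟩
  have hlow : (1 - e ^ 2) * n ≤ ∑ j, ‖B (v j)‖ ^ 2 := by
    simp only [hB]
    rw [← map_sum]
    refine M.le_of_forall_ge
      ((boundedFuns Γ).sum_mem fun j _ => isBoundedFun_sum_coeff hρ hv (v j)) fun g => ?_
    rw [Finset.sum_apply]
    exact h g
  have hup : ∀ j, ‖B (v j)‖ ^ 2 ≤ e * ‖W.starProjection (v j)‖ ^ 2 + (1 - e) := by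
    intro j
    set x := W.starProjection (v j)
    set y := v j - x with hy
    have hx : x ∈ W := W.starProjection_apply_mem _
    have hyW : y ∈ Wᗮ := W.sub_starProjection_mem_orthogonal _
    have hxy : v j = x + y := by rw [hy, add_sub_cancel]
    have h1 := norm_add_sq_eq_norm_sq_add_norm_sq_of_inner_eq_zero x y (hyW x hx)
    have h2 := norm_add_sq_eq_norm_sq_add_norm_sq_of_inner_eq_zero (B x) (B y)
      (hW.inner_eq_zero x hx y hyW)
    have h3 := hB1 x
    have h4 := hWc y hyW
    rw [← hxy, hv.1 j] at h1
    rw [← map_add, ← hxy] at h2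
    nlinarith
  have hsum := hlow.trans (Finset.sum_le_sum fun j _ => hup j)
  rw [Finset.sum_add_distrib, ← Finset.mul_sum] at hsum
  simp only [Finset.sum_const, Finset.card_univ, Fintype.card_fin, nsmul_eq_mul] at hsum
  refine le_of_mul_le_mul_left ?_ he
  linarith

end Averaging

section Dimension

variable {Γ : Type*} [Group Γ] {H : Type*} [NormedAddCommGroup H] [InnerProductSpace ℂ H]
  {ρ : Γ →* Module.End ℂ H}

/-- Commuting operators of a representation have a common eigenvector in every nonzero invariant
finite-dimensional subspace. -/
lemma exists_common_eigenvector {A : Subgroup Γ} (hA : ∀ x ∈ A, ∀ y ∈ A, x * y = y * x)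
    {W : Submodule ℂ H} [FiniteDimensional ℂ W] (hW : ∀ a ∈ A, ∀ x ∈ W, ρ a x ∈ W)
    (hW0 : W ≠ ⊥) : ∃ v ∈ W, v ≠ 0 ∧ ∀ a ∈ A, ∃ μ : ℂ, ρ a v = μ • v := by
  set S : Set ℕ := {k | ∃ U ≤ W, U ≠ ⊥ ∧ (∀ a ∈ A, ∀ x ∈ U, ρ a x ∈ U) ∧ Module.finrank ℂ U = k}
  have hS : S.Nonempty := ⟨_, W, le_rfl, hW0, hW, rfl⟩
  obtain ⟨U, hUW, hU0, hU, hUk⟩ := Nat.sInf_mem hS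
  have : FiniteDimensional ℂ U := Submodule.finiteDimensional_of_le hUW
  obtain ⟨v, hv, hv0⟩ := Submodule.exists_mem_ne_zero_of_ne_bot hU0
  refine ⟨v, hUW hv, hv0, fun a ha => ?_⟩
  have : Nontrivial U := Submodule.nontrivial_iff_ne_bot.2 hU0
  obtain ⟨μ, hμ⟩ := Module.End.exists_eigenvalue ((ρ a).restrict (hU a ha))
  obtain ⟨u, hu⟩ := hμ.exists_hasEigenvector
  have hua : ρ a u = μ • (u : H) := congrArg Subtype.val hu.apply_eq_smul
  refine ⟨μ, ?_⟩
  set V : Submodule ℂ H := U ⊓ Module.End.eigenspace (ρ a) μ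
  have hV : V = U := by
    refine Submodule.eq_of_le_of_finrank_le inf_le_left ?_
    rw [hUk]
    refine Nat.sInf_le ⟨V, inf_le_left.trans hUW, ?_, ?_, rfl⟩
    · refine (Submodule.ne_bot_iff _).2 ⟨u, ⟨u.2, Module.End.mem_eigenspace_iff.2 hua⟩, ?_⟩
      exact fun h => hu.2 (Subtype.ext h)
    · rintro b hb x ⟨hx, hxa⟩
      refine ⟨hU b hb x hx, Module.End.mem_eigenspace_iff.2 ?_⟩
      rw [← rep_mul_apply, hA a ha b hb, rep_mul_apply, Module.End.mem_eigenspace_iff.1 hxa,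
        map_smul]
  rw [← hV] at hv
  exact Module.End.mem_eigenspace_iff.1 hv.2

lemma exists_small_invariantSubspace {A : Subgroup Γ} (hi : A.index ≠ 0)
    (hA : ∀ x ∈ A, ∀ y ∈ A, x * y = y * x) {W : Submodule ℂ H} [FiniteDimensional ℂ W]
    (hW : IsInvariantSubspace ρ W) (hW0 : W ≠ ⊥) :
    ∃ U ≤ W, U ≠ ⊥ ∧ IsInvariantSubspace ρ U ∧ Module.finrank ℂ U ≤ A.index := by
  obtain ⟨v, hv, hv0, hμ⟩ := exists_common_eigenvector hA (fun a _ => hW a) hW0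
  have : A.FiniteIndex := ⟨hi⟩
  have : Fintype (Γ ⧸ A) := Fintype.ofFinite _
  have hmem : ∀ g, ρ g v ∈ Submodule.span ℂ (Set.range fun c : Γ ⧸ A => ρ c.out v) := by
    intro g
    have hg : (g : Γ ⧸ A).out⁻¹ * g ∈ A := by
      rw [← QuotientGroup.eq, QuotientGroup.out_eq']
    obtain ⟨μ, h⟩ := hμ _ hg
    have : ρ g v = μ • ρ (g : Γ ⧸ A).out v := by
      rw [← map_smul, ← h, ← rep_mul_apply, mul_inv_cancel_left]
    rw [this]
    exact Submodule.smul_mem _ _ (Submodule.subset_span ⟨_, rfl⟩)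
  refine ⟨Submodule.span ℂ (Set.range fun c : Γ ⧸ A => ρ c.out v), ?_, ?_, ?_, ?_⟩
  · refine Submodule.span_le.2 ?_
    rintro _ ⟨c, rfl⟩
    exact hW _ v hv
  · refine (Submodule.ne_bot_iff _).2 ⟨v, ?_, hv0⟩
    simpa using hmem 1
  · intro g x hx
    induction hx using Submodule.span_induction with
    | mem x hx =>
      obtain ⟨c, rfl⟩ := hx
      simp only [← rep_mul_apply]
      exact hmem _
    | zero => rw [map_zero]; exact zero_mem _
    | add x y _ _ hx hy => rw [map_add]; exact add_mem hx hy
    | smul c x _ hx => rw [map_smul]; exact Submodule.smul_mem _ _ hx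
  · refine (finrank_range_le_card _).trans ?_
    rw [Subgroup.index, Nat.card_eq_fintype_card]

lemma exists_invariantSubspace_finrank_le (hρ : IsUnitaryRep ρ) {A : Subgroup Γ}
    (hi : A.index ≠ 0) (hA : ∀ x ∈ A, ∀ y ∈ A, x * y = y * x) {W : Submodule ℂ H}
    [FiniteDimensional ℂ W] (hW : IsInvariantSubspace ρ W) {n : ℕ}
    (hn : n < Module.finrank ℂ W) :
    ∃ W₁ ≤ W, IsInvariantSubspace ρ W₁ ∧ Module.finrank ℂ W₁ ≤ n ∧
      n < Module.finrank ℂ W₁ + A.index := by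
  set S : Set ℕ :=
    {k | ∃ U ≤ W, IsInvariantSubspace ρ U ∧ Module.finrank ℂ U ≤ n ∧ Module.finrank ℂ U = k}
  have hne : S.Nonempty := by
    refine ⟨_, ⊥, bot_le, ?_, by simp, rfl⟩
    rintro g x hx
    rw [Submodule.mem_bot] at hx ⊢
    rw [hx, map_zero]
  have hbdd : BddAbove S := ⟨n, by rintro k ⟨U, -, -, h, rfl⟩; exact h⟩
  obtain ⟨W₁, hle, hinv, hfin, hk⟩ := Nat.sSup_mem hne hbdd
  refine ⟨W₁, hle, hinv, hfin, ?_⟩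
  have hd := Submodule.finrank_add_inf_finrank_orthogonal hle
  have h0 : W₁ᗮ ⊓ W ≠ ⊥ := by
    intro h
    rw [h, finrank_bot] at hd
    omega
  obtain ⟨U, hU, hU0, hUinv, hUd⟩ :=
    exists_small_invariantSubspace hi hA ((hinv.orthogonal hρ).inf hW) h0
  have : FiniteDimensional ℂ W₁ := Submodule.finiteDimensional_of_le hle
  have : FiniteDimensional ℂ U := Submodule.finiteDimensional_of_le hU
  have hlt : W₁ < W₁ ⊔ U := by
    refine lt_of_le_of_ne le_sup_left fun h => hU0 ?_
    rw [eq_bot_iff, ← W₁.inf_orthogonal_eq_bot]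
    exact le_inf (le_sup_right.trans h.ge) (hU.trans inf_le_left)
  have h1 := Submodule.finrank_lt_finrank_of_lt hlt
  have h2 := Submodule.finrank_add_le_finrank_add_finrank W₁ U
  by_contra! h3
  have h4 := le_csSup hbdd ⟨W₁ ⊔ U, sup_le hle (hU.trans inf_le_right), hinv.sup hUinv,
    by omega, rfl⟩
  omega

lemma sum_norm_sq_starProjection_le {n : ℕ} {v : Fin n → H} (hv : Orthonormal ℂ v)
    (U : Submodule ℂ H) [FiniteDimensional ℂ U] :
    ∑ i, ‖U.starProjection (v i)‖ ^ 2 ≤ Module.finrank ℂ U := by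
  set b := stdOrthonormalBasis ℂ U
  have h1 : ∀ i, ‖U.starProjection (v i)‖ ^ 2 = ∑ k, ‖(inner ℂ (b k : H) (v i) : ℂ)‖ ^ 2 := by
    intro i
    rw [Submodule.starProjection_apply, ← Submodule.coe_norm, ← b.sum_sq_norm_inner_right]
    simp only [Submodule.inner_orthogonalProjectionOnto_eq_of_mem_left]
  simp only [h1]
  rw [Finset.sum_comm]
  calc _ ≤ ∑ k : Fin (Module.finrank ℂ U), (1 : ℝ) := Finset.sum_le_sum fun k _ => ?_
    _ = _ := by simp
  have := hv.sum_inner_products_le (b k : H) (s := Finset.univ)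
  rw [← Submodule.coe_norm, b.norm_eq_one] at this
  simpa only [norm_inner_symm, one_pow] using this

lemma norm_sq_starProjection_eq_add {W₁ W : Submodule ℂ H} [FiniteDimensional ℂ W]
    [FiniteDimensional ℂ W₁] (h : W₁ ≤ W) (x : H) :
    ‖W.starProjection x‖ ^ 2 =
      ‖W₁.starProjection x‖ ^ 2 + ‖(W₁ᗮ ⊓ W).starProjection x‖ ^ 2 := by
  set y := W₁.starProjection x with hy
  set z := (W₁ᗮ ⊓ W).starProjection x with hz
  have hyW : y ∈ W₁ := W₁.starProjection_apply_mem x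
  have hzW : z ∈ W₁ᗮ ⊓ W := (W₁ᗮ ⊓ W).starProjection_apply_mem x
  have hyz : W.starProjection x = y + z := by
    refine Submodule.eq_starProjection_of_mem_orthogonal (add_mem (h hyW) hzW.2) ?_
    rw [← Submodule.sup_orthogonal_inf_of_hasOrthogonalProjection h, ← Submodule.inf_orthogonal]
    constructor
    · rw [← sub_sub]
      exact sub_mem (W₁.sub_starProjection_mem_orthogonal x) hzW.1
    · rw [add_comm, ← sub_sub]
      refine sub_mem ((W₁ᗮ ⊓ W).sub_starProjection_mem_orthogonal x) ?_
      exact fun u hu => inner_eq_zero_symm.1 (hu.1 y hyW)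
  rw [hyz]
  simpa only [sq] using norm_add_sq_eq_norm_sq_add_norm_sq_of_inner_eq_zero y z (hzW.1 y hyW)

lemma exists_invariant_near_finrank_le [CompleteSpace H] {A : Subgroup Γ} (hi : A.index ≠ 0)
    (hA : ∀ x ∈ A, ∀ y ∈ A, x * y = y * x) (hρ : IsUnitaryRep ρ) {n : ℕ} {v : Fin n → H}
    (hv : Orthonormal ℂ v) {e : ℝ} (he : 0 < e) (he1 : e ≤ 1 / 2)
    (h : ∀ g, (1 - e ^ 2) * n ≤ ∑ j, ∑ i, ‖(inner ℂ (ρ g (v i)) (v j) : ℂ)‖ ^ 2) :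
    ∃ (W : Submodule ℂ H) (_ : FiniteDimensional ℂ W), IsInvariantSubspace ρ W ∧
      Module.finrank ℂ W ≤ n ∧
      n - ∑ i, ‖W.starProjection (v i)‖ ^ 2 ≤ (3 + 2 * A.index) * e * n := by
  obtain ⟨M⟩ := exists_invMean A hi hA
  obtain ⟨W, hWf, hW, hWn, hWv⟩ := exists_invariant_near M hρ hv he (by linarith) h
  have hn0 : (0 : ℝ) ≤ n := Nat.cast_nonneg n
  have hd0 : (0 : ℝ) ≤ A.index := Nat.cast_nonneg _
  rcases le_or_gt (Module.finrank ℂ W) n with hle | hlt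
  · refine ⟨W, hWf, hW, hle, ?_⟩
    have : 0 ≤ (2 + 2 * A.index) * e * n := by positivity
    linarith
  obtain ⟨W₁, hW₁, hinv, hfin, hd⟩ := exists_invariantSubspace_finrank_le hρ hi hA hW hlt
  have hW₁f : FiniteDimensional ℂ W₁ := Submodule.finiteDimensional_of_le hW₁
  refine ⟨W₁, hW₁f, hinv, hfin, ?_⟩
  have h1 := sum_norm_sq_starProjection_le hv (W₁ᗮ ⊓ W)
  have h2 : ∑ i, ‖W.starProjection (v i)‖ ^ 2 = ∑ i, ‖W₁.starProjection (v i)‖ ^ 2 +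
      ∑ i, ‖(W₁ᗮ ⊓ W).starProjection (v i)‖ ^ 2 := by
    rw [← Finset.sum_add_distrib]
    exact Finset.sum_congr rfl fun i _ => norm_sq_starProjection_eq_add hW₁ (v i)
  have h3 : (Module.finrank ℂ W₁ : ℝ) + Module.finrank ℂ (W₁ᗮ ⊓ W : Submodule ℂ H) =
      Module.finrank ℂ W := by
    exact_mod_cast Submodule.finrank_add_inf_finrank_orthogonal hW₁
  have h4 : (n : ℝ) ≤ Module.finrank ℂ W₁ + A.index := by exact_mod_cast hd.le
  have h5 : (n : ℝ) + 1 ≤ Module.finrank ℂ W := by exact_mod_cast hlt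
  have h6 : (Module.finrank ℂ W : ℝ) - n ≤ 2 * e * n := by nlinarith
  have h7 : (A.index : ℝ) ≤ A.index * (2 * e * n) :=
    le_mul_of_one_le_right hd0 (by linarith)
  linarith

end Dimension

section FiniteDimensional

variable {E F : Type*} [NormedAddCommGroup E] [InnerProductSpace ℂ E] [FiniteDimensional ℂ E]
  [NormedAddCommGroup F] [InnerProductSpace ℂ F] [FiniteDimensional ℂ F] {n : ℕ}

lemma sum_norm_sq_map_eq (S : E →ₗ[ℂ] F) (b c : OrthonormalBasis (Fin n) ℂ E) :
    ∑ i, ‖S (b i)‖ ^ 2 = ∑ i, ‖S (c i)‖ ^ 2 := by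
  have key : ∀ b : OrthonormalBasis (Fin n) ℂ E, ∑ i, ‖S (b i)‖ ^ 2 =
      ∑ k, ‖LinearMap.adjoint S (stdOrthonormalBasis ℂ F k)‖ ^ 2 := by
    intro b
    simp only [← (stdOrthonormalBasis ℂ F).sum_sq_norm_inner_right (S _),
      ← b.sum_sq_norm_inner_left (LinearMap.adjoint S _), LinearMap.adjoint_inner_left]
    exact Finset.sum_comm
  rw [key b, key c]

/-- Singular value decomposition between spaces of equal dimension. -/
lemma exists_singularValueDecomposition (S : E →ₗ[ℂ] F) (hE : Module.finrank ℂ E = n)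
    (hF : Module.finrank ℂ F = n) :
    ∃ (u : OrthonormalBasis (Fin n) ℂ E) (w : OrthonormalBasis (Fin n) ℂ F),
      ∀ i, S (u i) = ((‖S (u i)‖ : ℝ) : ℂ) • w i := by
  have hT := LinearMap.isSymmetric_adjoint_comp_self S
  set u := hT.eigenvectorBasis hE
  have hin : ∀ i j, i ≠ j → inner ℂ (S (u i)) (S (u j)) = 0 := by
    intro i j hij
    rw [← LinearMap.adjoint_inner_right, ← LinearMap.comp_apply, hT.apply_eigenvectorBasis,
      inner_smul_right, u.orthonormal.2 hij, mul_zero]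
  set s : Set (Fin n) := {i | S (u i) ≠ 0}
  set f : Fin n → F := fun i => ((‖S (u i)‖⁻¹ : ℝ) : ℂ) • S (u i)
  have hf : Orthonormal ℂ (s.domRestrict f) := by
    refine ⟨fun i => ?_, fun i j hij => ?_⟩
    · have : ‖S (u i)‖ ≠ 0 := norm_ne_zero_iff.2 i.2
      change ‖((‖S (u i)‖⁻¹ : ℝ) : ℂ) • S (u i)‖ = 1
      rw [norm_smul, Complex.norm_real, norm_inv, norm_norm, inv_mul_cancel₀ this]
    · change inner ℂ (((‖S (u i)‖⁻¹ : ℝ) : ℂ) • S (u i)) (((‖S (u j)‖⁻¹ : ℝ) : ℂ) • S (u j)) = 0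
      rw [inner_smul_left, inner_smul_right, hin _ _ (fun h => hij (Subtype.ext h)), mul_zero,
        mul_zero]
  obtain ⟨w, hw⟩ := hf.exists_orthonormalBasis_extension_of_card_eq (by simpa using hF)
  refine ⟨u, w, fun i => ?_⟩
  by_cases hi : S (u i) = 0
  · simp [hi]
  · rw [hw i hi, smul_smul, ← Complex.ofReal_mul, mul_inv_cancel₀ (norm_ne_zero_iff.2 hi),
      Complex.ofReal_one, one_smul]

/-- A contraction of almost full Hilbert–Schmidt norm is close to a unitary. -/
lemma exists_linearIsometryEquiv_near (S : E →ₗ[ℂ] F) (hS : ∀ x, ‖S x‖ ≤ ‖x‖)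
    (hF : Module.finrank ℂ F = n) (b : OrthonormalBasis (Fin n) ℂ E) :
    ∃ U : E ≃ₗᵢ[ℂ] F, ∀ c : OrthonormalBasis (Fin n) ℂ E,
      ∑ i, ‖U (c i) - S (c i)‖ ^ 2 ≤ n - ∑ i, ‖S (b i)‖ ^ 2 := by
  have hE : Module.finrank ℂ E = n := by
    rw [Module.finrank_eq_card_basis b.toBasis, Fintype.card_fin]
  obtain ⟨u, w, h⟩ := exists_singularValueDecomposition S hE hF
  refine ⟨u.equiv w (Equiv.refl _), fun c => ?_⟩
  set U := u.equiv w (Equiv.refl _)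
  have h1 := sum_norm_sq_map_eq ((U.toLinearEquiv : E →ₗ[ℂ] F) - S) c u
  have h2 : ∑ i, ‖U (c i) - S (c i)‖ ^ 2 = ∑ i, ‖U (u i) - S (u i)‖ ^ 2 := h1
  rw [h2, sum_norm_sq_map_eq S b u]
  have h3 : (n : ℝ) = ∑ i : Fin n, (1 : ℝ) := by simp
  rw [h3, ← Finset.sum_sub_distrib]
  refine Finset.sum_le_sum fun i _ => ?_
  have h4 : U (u i) = w i := by simp [U]
  have h5 : U (u i) - S (u i) = ((1 - ‖S (u i)‖ : ℝ) : ℂ) • w i := by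
    rw [h4]
    conv_lhs => rw [h i]
    push_cast
    rw [sub_smul, one_smul]
  have h6 : ‖S (u i)‖ ≤ 1 := by simpa using hS (u i)
  rw [h5, norm_smul, w.norm_eq_one, Complex.norm_real, mul_one, Real.norm_eq_abs, sq_abs]
  nlinarith [norm_nonneg (S (u i))]

end FiniteDimensional

section Matrices

variable {Γ : Type*} [Group Γ]

/-- The group of isometries determined by a unitary representation. -/
noncomputable def IsUnitaryRep.toLinearIsometryEquiv {H : Type*} [NormedAddCommGroup H]
    [InnerProductSpace ℂ H] {ρ : Γ →* Module.End ℂ H} (hρ : IsUnitaryRep ρ) :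
    Γ →* (H ≃ₗᵢ[ℂ] H) where
  toFun g :=
    { ρ g with
      invFun := ρ g⁻¹
      left_inv := fun x => by simp
      right_inv := rep_inv_apply g
      norm_map' := hρ g }
  map_one' := by
    ext x
    change ρ 1 x = x
    rw [map_one, Module.End.one_apply]
  map_mul' g h := by
    ext x
    change ρ (g * h) x = ρ g (ρ h x)
    rw [rep_mul_apply]

/-- Unitary matrices are the isometries of the standard Euclidean space. -/
noncomputable def unitaryGroupEquiv (n : ℕ) :
    Matrix.unitaryGroup (Fin n) ℂ ≃*
      (EuclideanSpace ℂ (Fin n) ≃ₗᵢ[ℂ] EuclideanSpace ℂ (Fin n)) :=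
  (Unitary.mapEquiv { Matrix.toEuclideanCLM (n := Fin n) (𝕜 := ℂ) with }).toMulEquiv.trans
    Unitary.linearIsometryEquiv

lemma unitaryGroupEquiv_apply {n : ℕ} (A : Matrix.unitaryGroup (Fin n) ℂ)
    (x : EuclideanSpace ℂ (Fin n)) :
    unitaryGroupEquiv n A x = (A : Matrix (Fin n) (Fin n) ℂ).toEuclideanLin x := rfl

/-- A unitary representation on the standard Euclidean space, as a matrix representation. -/
lemma IsUnitaryRep.exists_matrix {n : ℕ} {ρ : Γ →* Module.End ℂ (EuclideanSpace ℂ (Fin n))}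
    (hρ : IsUnitaryRep ρ) : ∃ π : Γ →* Matrix.unitaryGroup (Fin n) ℂ, ∀ g x,
      unitaryGroupEquiv n (π g) x = ρ g x := by
  refine ⟨(unitaryGroupEquiv n).symm.toMonoidHom.comp hρ.toLinearIsometryEquiv, fun g x => ?_⟩
  exact congrArg (fun f => f x) ((unitaryGroupEquiv n).apply_symm_apply _)

lemma hsNorm_sq_mul {n : ℕ} (A : Matrix (Fin n) (Fin n) ℂ) :
    n * hsNorm A ^ 2 = ∑ i, ‖A.toEuclideanLin (EuclideanSpace.basisFun (Fin n) ℂ i)‖ ^ 2 := by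
  have h : (Matrix.trace (A * Aᴴ)).re = ∑ i, ∑ j, ‖A i j‖ ^ 2 := by
    simp [Matrix.trace, Matrix.mul_apply, Complex.mul_conj, ← Complex.normSq_eq_norm_sq]
  have h0 : 0 ≤ (Matrix.trace (A * Aᴴ)).re := by rw [h]; positivity
  rw [hsNorm, Real.sq_sqrt (by positivity)]
  rcases Nat.eq_zero_or_pos n with rfl | hn
  · simp
  · rw [one_div, mul_inv_cancel_left₀ (by positivity), h, Finset.sum_comm]
    simp [EuclideanSpace.norm_sq_eq, Matrix.toLpLin_apply]

/-- A contraction of almost full Hilbert–Schmidt norm that almost intertwines a map with a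
representation of the same dimension yields a nearby representation. -/
lemma exists_unitaryGroup_near {n : ℕ} {F : Type*} [NormedAddCommGroup F] [InnerProductSpace ℂ F]
    [FiniteDimensional ℂ F] (hF : Module.finrank ℂ F = n) {σ : Γ →* Module.End ℂ F}
    (hσ : IsUnitaryRep σ) (φ : Γ → Matrix.unitaryGroup (Fin n) ℂ)
    (S : EuclideanSpace ℂ (Fin n) →ₗ[ℂ] F) (hS : ∀ x, ‖S x‖ ≤ ‖x‖)
    (e : OrthonormalBasis (Fin n) ℂ (EuclideanSpace ℂ (Fin n))) {a b : ℝ} (ha : 0 ≤ a)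
    (hb : 0 ≤ b) (hSa : n - ∑ i, ‖S (e i)‖ ^ 2 ≤ a ^ 2)
    (hSb : ∀ g, ∑ i, ‖σ g (S (e i)) - S (unitaryGroupEquiv n (φ g) (e i))‖ ^ 2 ≤ b ^ 2) :
    ∃ π : Γ →* Matrix.unitaryGroup (Fin n) ℂ, ∀ g,
      ∑ i, ‖unitaryGroupEquiv n (φ g) (e i) - unitaryGroupEquiv n (π g) (e i)‖ ^ 2 ≤
        (2 * a + b) ^ 2 := by
  obtain ⟨U, hU⟩ := exists_linearIsometryEquiv_near S hS hF e
  let τ : Γ →* Module.End ℂ (EuclideanSpace ℂ (Fin n)) :=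
    (U.symm.toLinearEquiv.conjRingEquiv : Module.End ℂ F →* _).comp σ
  have hτ : ∀ g x, τ g x = U.symm (σ g (U x)) := fun g x => rfl
  obtain ⟨π, hπ⟩ := IsUnitaryRep.exists_matrix (ρ := τ) fun g x => by
    rw [hτ, U.symm.norm_map, hσ, U.norm_map]
  refine ⟨π, fun g => ?_⟩
  let G := PiLp 2 fun _ : Fin n => F
  let u : G := WithLp.toLp 2 fun i =>
    U (unitaryGroupEquiv n (φ g) (e i)) - S (unitaryGroupEquiv n (φ g) (e i))
  let v : G := WithLp.toLp 2 fun i => σ g (S (e i)) - S (unitaryGroupEquiv n (φ g) (e i))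
  let w : G := WithLp.toLp 2 fun i => σ g (U (e i)) - σ g (S (e i))
  have hu : ‖u‖ ≤ a := by
    refine abs_le_of_sq_le_sq' ?_ ha |>.2
    rw [PiLp.norm_sq_eq_of_L2]
    exact (hU (e.map (unitaryGroupEquiv n (φ g)))).trans hSa
  have hv : ‖v‖ ≤ b := by
    refine abs_le_of_sq_le_sq' ?_ hb |>.2
    rw [PiLp.norm_sq_eq_of_L2]
    exact hSb g
  have hw : ‖w‖ ≤ a := by
    refine abs_le_of_sq_le_sq' ?_ ha |>.2
    rw [PiLp.norm_sq_eq_of_L2]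
    refine le_trans (le_of_eq (Finset.sum_congr rfl fun i _ => ?_)) ((hU e).trans hSa)
    change ‖σ g (U (e i)) - σ g (S (e i))‖ ^ 2 = _
    rw [← map_sub, hσ]
  have key : ∑ i, ‖unitaryGroupEquiv n (φ g) (e i) - unitaryGroupEquiv n (π g) (e i)‖ ^ 2 =
      ‖u - v - w‖ ^ 2 := by
    rw [PiLp.norm_sq_eq_of_L2]
    refine Finset.sum_congr rfl fun i _ => ?_
    rw [hπ, hτ, ← U.norm_map, map_sub, U.apply_symm_apply]
    congr 2
    change _ = U (unitaryGroupEquiv n (φ g) (e i)) - S (unitaryGroupEquiv n (φ g) (e i)) -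
      (σ g (S (e i)) - S (unitaryGroupEquiv n (φ g) (e i))) - (σ g (U (e i)) - σ g (S (e i)))
    abel
  rw [key]
  refine pow_le_pow_left₀ (norm_nonneg _) ?_ 2
  linarith [norm_sub_le (u - v) w, norm_sub_le u v]

/-- An almost invariant embedding into a unitary representation which is close to a small invariant
subspace yields a nearby representation. -/
lemma exists_unitaryGroup_near_of_invariantSubspace {n : ℕ} {H : Type*} [NormedAddCommGroup H]
    [InnerProductSpace ℂ H] {ρ : Γ →* Module.End ℂ H} (hρ : IsUnitaryRep ρ)
    (φ : Γ → Matrix.unitaryGroup (Fin n) ℂ) (V : EuclideanSpace ℂ (Fin n) →ₗᵢ[ℂ] H)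
    (e : OrthonormalBasis (Fin n) ℂ (EuclideanSpace ℂ (Fin n))) {W : Submodule ℂ H}
    [FiniteDimensional ℂ W] (hW : IsInvariantSubspace ρ W) (hWn : Module.finrank ℂ W ≤ n)
    {a b : ℝ} (ha : 0 ≤ a) (hb : 0 ≤ b)
    (hWa : n - ∑ i, ‖W.starProjection (V (e i))‖ ^ 2 ≤ a ^ 2)
    (hVb : ∀ g, ∑ i, ‖ρ g (V (e i)) - V (unitaryGroupEquiv n (φ g) (e i))‖ ^ 2 ≤ b ^ 2) :
    ∃ π : Γ →* Matrix.unitaryGroup (Fin n) ℂ, ∀ g,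
      ∑ i, ‖unitaryGroupEquiv n (φ g) (e i) - unitaryGroupEquiv n (π g) (e i)‖ ^ 2 ≤
        (2 * a + b) ^ 2 := by
  let K := EuclideanSpace ℂ (Fin (n - Module.finrank ℂ W))
  let F := WithLp 2 (W × K)
  have hF : Module.finrank ℂ F = n := by
    rw [(WithLp.linearEquiv 2 ℂ (W × K)).finrank_eq, Module.finrank_prod,
      finrank_euclideanSpace_fin]
    omega
  let ι := (WithLp.linearEquiv 2 ℂ (W × K)).symm
  let ρW : Γ →* Module.End ℂ W :=
    { toFun := fun g => (ρ g).restrict (hW g)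
      map_one' := by ext x; simp
      map_mul' := fun g h => by ext x; simp }
  let σ : Γ →* Module.End ℂ F :=
    (ι.conjRingEquiv : Module.End ℂ (W × K) →* _).comp
      { toFun := fun g => (ρW g).prodMap LinearMap.id
        map_one' := by ext x <;> simp
        map_mul' := fun g h => by ext x <;> simp }
  have hσ : ∀ g (x : F), σ g x = WithLp.toLp 2 (ρW g x.fst, x.snd) := fun g x => rfl
  let S : EuclideanSpace ℂ (Fin n) →ₗ[ℂ] F :=
    ι ∘ₗ LinearMap.inl ℂ W K ∘ₗ W.orthogonalProjectionOnto.toLinearMap ∘ₗ V.toLinearMap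
  have hS : ∀ x, S x = WithLp.toLp 2 (W.orthogonalProjectionOnto (V x), 0) := fun x => rfl
  have hinl : ∀ x : W, ‖(WithLp.toLp 2 (x, 0) : F)‖ = ‖(x : H)‖ := fun x =>
    WithLp.norm_toLp_fst 2 _ _ x
  refine exists_unitaryGroup_near hF (σ := σ) (fun g x => ?_) φ S (fun x => ?_) e ha hb ?_
    fun g => ?_
  · rw [← sq_eq_sq₀ (norm_nonneg _) (norm_nonneg _), WithLp.prod_norm_sq_eq_of_L2,
      WithLp.prod_norm_sq_eq_of_L2, hσ]
    congr 2
    exact hρ g _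
  · rw [hS, hinl, ← V.norm_map]
    exact W.norm_orthogonalProjectionOnto_apply_le _
  · simp only [hS, hinl]
    exact hWa
  · refine le_trans (Finset.sum_le_sum fun i _ => ?_) (hVb g)
    have h : σ g (S (e i)) - S (unitaryGroupEquiv n (φ g) (e i)) =
        WithLp.toLp 2 (W.orthogonalProjectionOnto
          (ρ g (V (e i)) - V (unitaryGroupEquiv n (φ g) (e i))), 0) := by
      rw [hσ, hS, hS, map_sub, ← WithLp.toLp_sub, Prod.mk_sub_mk, sub_zero]
      congr 3
      exact Subtype.ext (hW.starProjection hρ g (V (e i))).symm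
    rw [h, hinl]
    exact pow_le_pow_left₀ (norm_nonneg _) (W.norm_orthogonalProjectionOnto_apply_le _) 2

end Matrices

section Embedding

variable {Γ : Type*} [Group Γ] {n : ℕ}

/-- The orbit map of a unitary-valued map, as an isometry into the square-integrable functions. -/
noncomputable def orbitIsometry (M : InvMean Γ) (φ : Γ → Matrix.unitaryGroup (Fin n) ℂ) :
    EuclideanSpace ℂ (Fin n) →ₗᵢ[ℂ] PreL2 M (EuclideanSpace ℂ (Fin n)) where
  toFun v := ⟨fun x => unitaryGroupEquiv n (φ x⁻¹) v, ‖v‖, fun x => by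
    rw [LinearIsometryEquiv.norm_map]⟩
  map_add' v w := Subtype.ext (funext fun x => map_add (unitaryGroupEquiv n (φ x⁻¹)) v w)
  map_smul' c v := Subtype.ext (funext fun x => map_smul (unitaryGroupEquiv n (φ x⁻¹)) c v)
  norm_map' v := by
    rw [← sq_eq_sq₀ (norm_nonneg _) (norm_nonneg _), PreL2.norm_sq, ← M.const (‖v‖ ^ 2)]
    congr 1
    ext x
    exact congrArg (· ^ 2) ((unitaryGroupEquiv n (φ x⁻¹)).norm_map v)

/-- The orbit map almost intertwines an almost homomorphism with translation. -/
lemma sum_norm_sq_translation_orbitIsometry_le (M : InvMean Γ)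
    (φ : Γ → Matrix.unitaryGroup (Fin n) ℂ)
    (e : OrthonormalBasis (Fin n) ℂ (EuclideanSpace ℂ (Fin n))) {c : ℝ}
    (h : ∀ x g, ∑ i, ‖unitaryGroupEquiv n (φ (x * g)) (e i) -
      unitaryGroupEquiv n (φ x) (unitaryGroupEquiv n (φ g) (e i))‖ ^ 2 ≤ c) (g : Γ) :
    ∑ i, ‖PreL2.translateIsometry M _ g (orbitIsometry M φ (e i)) -
      orbitIsometry M φ (unitaryGroupEquiv n (φ g) (e i))‖ ^ 2 ≤ c := by
  simp only [PreL2.norm_sq, ← map_sum]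
  refine M.le_of_forall_le ((boundedFuns Γ).sum_mem fun i _ => PreL2.isBoundedFun_norm_sq _)
    fun x => ?_
  rw [Finset.sum_apply]
  refine le_trans (le_of_eq (Finset.sum_congr rfl fun i _ => ?_)) (h x⁻¹ g)
  change ‖unitaryGroupEquiv n (φ (g⁻¹ * x)⁻¹) (e i) -
    unitaryGroupEquiv n (φ x⁻¹) (unitaryGroupEquiv n (φ g) (e i))‖ ^ 2 = _
  rw [mul_inv_rev, inv_inv]

/-- An orthonormal family close to the span of another one has large overlap with it. -/
lemma le_sum_sum_norm_inner_sq {H : Type*} [NormedAddCommGroup H] [InnerProductSpace ℂ H]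
    (V : EuclideanSpace ℂ (Fin n) →ₗᵢ[ℂ] H)
    (e : OrthonormalBasis (Fin n) ℂ (EuclideanSpace ℂ (Fin n))) {w : Fin n → H}
    (hw : ∀ i, ‖w i‖ = 1) (y : Fin n → EuclideanSpace ℂ (Fin n)) :
    n - ∑ i, ‖w i - V (y i)‖ ^ 2 ≤ ∑ j, ∑ i, ‖(inner ℂ (w i) (V (e j)) : ℂ)‖ ^ 2 := by
  have key : ∀ i, 1 - ‖w i - V (y i)‖ ^ 2 ≤ ∑ j, ‖(inner ℂ (w i) (V (e j)) : ℂ)‖ ^ 2 := by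
    intro i
    set z : EuclideanSpace ℂ (Fin n) := ∑ j, (inner ℂ (V (e j)) (w i) : ℂ) • e j
    have hz : ∀ x, inner ℂ z x = inner ℂ (w i) (V x) := by
      intro x
      conv_rhs => rw [← e.sum_repr' x]
      simp only [z, sum_inner, inner_smul_left, inner_conj_symm, map_sum, map_smul, inner_sum,
        inner_smul_right, mul_comm]
    have hz2 : ∑ j, ‖(inner ℂ (w i) (V (e j)) : ℂ)‖ ^ 2 = ‖z‖ ^ 2 := by
      simp only [← hz]
      exact e.sum_sq_norm_inner_left z
    have h1 := norm_sub_sq (𝕜 := ℂ) (w i) (V (y i))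
    have h2 := norm_sub_sq (𝕜 := ℂ) z (y i)
    rw [← hz, V.norm_map, hw] at h1
    rw [hz2]
    nlinarith [sq_nonneg ‖z - y i‖]
  have h3 : (n : ℝ) = ∑ i : Fin n, (1 : ℝ) := by simp
  rw [h3, ← Finset.sum_sub_distrib, Finset.sum_comm]
  exact Finset.sum_le_sum fun i _ => key i

/-- An almost homomorphism of a virtually abelian group is close to a representation. -/
lemma exists_unitaryGroup_near_of_almost_hom {A : Subgroup Γ} (hi : A.index ≠ 0)
    (hA : ∀ x ∈ A, ∀ y ∈ A, x * y = y * x) (φ : Γ → Matrix.unitaryGroup (Fin n) ℂ)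
    (e : OrthonormalBasis (Fin n) ℂ (EuclideanSpace ℂ (Fin n))) {ε : ℝ} (hε : 0 < ε)
    (hε' : ε ≤ 1 / 2)
    (h : ∀ x g, ∑ i, ‖unitaryGroupEquiv n (φ (x * g)) (e i) -
      unitaryGroupEquiv n (φ x) (unitaryGroupEquiv n (φ g) (e i))‖ ^ 2 ≤ ε ^ 2 * n) :
    ∃ π : Γ →* Matrix.unitaryGroup (Fin n) ℂ, ∀ g,
      ∑ i, ‖unitaryGroupEquiv n (φ g) (e i) - unitaryGroupEquiv n (π g) (e i)‖ ^ 2 ≤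
        (2 * √((3 + 2 * A.index) * ε) + ε) ^ 2 * n := by
  obtain ⟨M⟩ := exists_invMean A hi hA
  set ρ := PreL2.translation M (EuclideanSpace ℂ (Fin n))
  have hρ : IsUnitaryRep ρ := PreL2.norm_translation
  let V := UniformSpace.Completion.toComplₗᵢ.comp (orbitIsometry M φ)
  have hV : ∀ g, ∑ i, ‖ρ g (V (e i)) - V (unitaryGroupEquiv n (φ g) (e i))‖ ^ 2 ≤ ε ^ 2 * n := by
    intro g
    refine le_trans (le_of_eq (Finset.sum_congr rfl fun i _ => ?_))
      (sum_norm_sq_translation_orbitIsometry_le M φ e h g)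
    change ‖PreL2.translation M _ g ((orbitIsometry M φ (e i) : PreL2 M _) :
      UniformSpace.Completion (PreL2 M (EuclideanSpace ℂ (Fin n)))) -
        (orbitIsometry M φ (unitaryGroupEquiv n (φ g) (e i)) : PreL2 M _)‖ ^ 2 = _
    rw [PreL2.translation_coe, ← UniformSpace.Completion.coe_sub, UniformSpace.Completion.norm_coe]
  obtain ⟨W, _, hW, hWn, hWd⟩ := exists_invariant_near_finrank_le hi hA hρ
    (e.orthonormal.comp_linearIsometry V) hε hε' fun g => by
      have := le_sum_sum_norm_inner_sq V e (w := fun i => ρ g (V (e i)))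
        (fun i => by simp [hρ g]) (fun i => unitaryGroupEquiv n (φ g) (e i))
      simp only [Function.comp_apply]
      linarith [hV g]
  obtain ⟨π, hπ⟩ := exists_unitaryGroup_near_of_invariantSubspace hρ φ V e hW hWn
    (a := √((3 + 2 * A.index) * ε) * √n) (b := ε * √n) (by positivity) (by positivity)
    (by
      rw [mul_pow, Real.sq_sqrt (by positivity), Real.sq_sqrt (by positivity)]
      exact hWd)
    fun g => by
      rw [mul_pow, Real.sq_sqrt (by positivity)]
      exact hV g
  refine ⟨π, fun g => (hπ g).trans_eq ?_⟩
  rw [← mul_assoc, ← add_mul, mul_pow _ √(n : ℝ), Real.sq_sqrt (by positivity)]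

end Embedding

lemma hsNorm_sub_sq_mul {n : ℕ} (A B : Matrix.unitaryGroup (Fin n) ℂ) :
    n * hsNorm ((A : Matrix (Fin n) (Fin n) ℂ) - (B : Matrix (Fin n) (Fin n) ℂ)) ^ 2 =
      ∑ i, ‖unitaryGroupEquiv n A (EuclideanSpace.basisFun (Fin n) ℂ i) -
        unitaryGroupEquiv n B (EuclideanSpace.basisFun (Fin n) ℂ i)‖ ^ 2 := by
  simp only [hsNorm_sq_mul, map_sub, LinearMap.sub_apply, unitaryGroupEquiv_apply]

/-- Uniform stability for the class of countable virtually abelian groups with an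
abelian subgroup of index ≤ d: ε depends only on δ and d, not on the group. -/
theorem stmt_1 (d : ℕ) :
    ∀ δ : ℝ, 0 < δ → ∃ ε : ℝ, 0 < ε ∧
      ∀ (Γ : Type) [Group Γ] [Countable Γ],
        (∃ A : Subgroup Γ, A.index ≠ 0 ∧ A.index ≤ d ∧ ∀ x ∈ A, ∀ y ∈ A, x * y = y * x) →
        ∀ (n : ℕ) (φ : Γ → Matrix.unitaryGroup (Fin n) ℂ),
          (∀ g h : Γ, hsNorm ((φ g : Matrix (Fin n) (Fin n) ℂ) * (φ h : Matrix (Fin n) (Fin n) ℂ)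
            - (φ (g * h) : Matrix (Fin n) (Fin n) ℂ)) < ε) →
          ∃ π : Γ →* Matrix.unitaryGroup (Fin n) ℂ,
            ∀ g : Γ, hsNorm ((φ g : Matrix (Fin n) (Fin n) ℂ)
              - (π g : Matrix (Fin n) (Fin n) ℂ)) < δ := by
  intro δ hδ
  refine ⟨min (1 / 4) (min (δ / 4) (δ ^ 2 / (16 * (3 + 2 * d)))), by positivity, ?_⟩
  set ε := min (1 / 4) (min (δ / 4) (δ ^ 2 / (16 * (3 + 2 * d))))
  have hε0 : 0 < ε := by positivity
  have hε1 : ε ≤ 1 / 4 := min_le_left _ _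
  have hε2 : ε ≤ δ / 4 := (min_le_right _ _).trans (min_le_left _ _)
  have hε3 : (3 + 2 * d) * ε ≤ (δ / 4) ^ 2 := by
    have : ε ≤ δ ^ 2 / (16 * (3 + 2 * d)) := (min_le_right _ _).trans (min_le_right _ _)
    rw [le_div_iff₀ (by positivity)] at this
    linarith
  rintro Γ _ _ ⟨A, hi, hd, hA⟩ n φ hφ
  rcases Nat.eq_zero_or_pos n with rfl | hn
  · exact ⟨1, fun g => by simpa [hsNorm] using hδ⟩
  have hn' : (0 : ℝ) < n := Nat.cast_pos.2 hn
  obtain ⟨π, hπ⟩ := exists_unitaryGroup_near_of_almost_hom hi hA φ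
    (EuclideanSpace.basisFun (Fin n) ℂ) hε0 (hε1.trans (by norm_num)) fun x g => by
      have h1 := hsNorm_sub_sq_mul (φ x * φ g) (φ (x * g))
      simp only [norm_sub_rev (unitaryGroupEquiv n (φ (x * g)) _), map_mul] at h1 ⊢
      refine h1.symm.le.trans ?_
      rw [mul_comm]
      refine mul_le_mul_of_nonneg_right ?_ hn'.le
      exact pow_le_pow_left₀ (Real.sqrt_nonneg _) (hφ x g).le 2
  refine ⟨π, fun g => ?_⟩
  have h2 := hπ g
  rw [← hsNorm_sub_sq_mul, mul_comm, mul_le_mul_iff_left₀ hn'] at h2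
  have h3 := (abs_le_of_sq_le_sq' h2 (by positivity)).2
  have h4 : √((3 + 2 * A.index) * ε) ≤ δ / 4 := by
    refine Real.sqrt_le_iff.2 ⟨by positivity, le_trans ?_ hε3⟩
    gcongr
  linarith
end

section
/- Let d ∈ ℕ and let Γ be a countable amenable group all of whose finite dimensional irreducible unitary representations have dimension at most d. Then for every ε>0, every n ∈ ℕ, and every map φ: Γ → U(n) with ‖φ(g)φ(h) − φ(gh)‖_{HS,n} < ε for all g,h ∈ Γ, there exists a group homomorphism ρ: Γ → U(n) such that ‖φ(g) − ρ(g)‖_{HS,n} < 161ε + 100((√2+1)·√(1+2500ε²) + √(d−1))·ε for all g ∈ Γ. -/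
open scoped Matrix

open Filter Topology

section Mean

variable {Γ : Type*}

/-- A finitely additive set function is additive along the fibres of a map. -/
lemma finitelyAdditive_preimage_finset {α : Type*} (μ : Set Γ → ℝ)
    (hadd : ∀ S T : Set Γ, Disjoint S T → μ (S ∪ T) = μ S + μ T) (c : Γ → α) (s : Finset α) :
    μ {x | c x ∈ s} = ∑ a ∈ s, μ {x | c x = a} := by
  classical
  have h0 : μ ∅ = 0 := by simpa using hadd ∅ ∅ (by simp)
  induction s using Finset.induction_on with
  | empty => simpa using h0
  | insert a s ha ih =>
    rw [Finset.sum_insert ha, ← ih, ← hadd]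
    · congr 1
      ext x
      simp
    · rw [Set.disjoint_left]
      rintro x hx hmem
      simp only [Set.mem_ofPred_eq] at hx hmem
      exact ha (hx ▸ hmem)

/-- A finitely additive probability measure agrees on any given finite collection of sets with a
convex combination of point evaluations. -/
lemma exists_linearMap_eq_on_finset (μ : Set Γ → ℝ) (h0 : ∀ S : Set Γ, 0 ≤ μ S)
    (h1 : μ Set.univ = 1)
    (hadd : ∀ S T : Set Γ, Disjoint S T → μ (S ∪ T) = μ S + μ T) [Nonempty Γ]
    (F : Finset (Set Γ)) :
    ∃ L : (Γ → ℝ) →ₗ[ℝ] ℝ, (∀ f, (∀ x, 0 ≤ f x) → 0 ≤ L f) ∧ L 1 = 1 ∧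
      ∀ S ∈ F, L (S.indicator 1) = μ S := by
  classical
  have hempty : μ ∅ = 0 := by simpa using hadd ∅ ∅ (by simp)
  let c : Γ → Finset (Set Γ) := fun x => F.filter (fun S => x ∈ S)
  have hc : ∀ x, c x ∈ F.powerset := fun x => by simp [c]
  let r : Finset (Set Γ) → Γ := Function.invFun c
  have hr : ∀ a, (∃ x, c x = a) → c (r a) = a := fun a h => Function.invFun_eq h
  have hz : ∀ a, (¬ ∃ x, c x = a) → μ {x | c x = a} = 0 := by
    intro a h
    rw [← hempty]
    congr 1
    ext x
    simpa using fun hx => h ⟨x, hx⟩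
  refine ⟨∑ a ∈ F.powerset, μ {x | c x = a} • LinearMap.proj (r a), ?_, ?_, ?_⟩
  · intro f hf
    simp only [LinearMap.sum_apply, LinearMap.smul_apply, LinearMap.proj_apply, smul_eq_mul]
    exact Finset.sum_nonneg fun a _ => mul_nonneg (h0 _) (hf _)
  · simp only [LinearMap.sum_apply, LinearMap.smul_apply, LinearMap.proj_apply, smul_eq_mul,
      Pi.one_apply, mul_one]
    rw [← finitelyAdditive_preimage_finset μ hadd, ← h1]
    congr 1
    ext x
    simpa using hc x
  · intro S hS
    simp only [LinearMap.sum_apply, LinearMap.smul_apply, LinearMap.proj_apply, smul_eq_mul]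
    have key : ∀ a ∈ F.powerset, μ {x | c x = a} * S.indicator 1 (r a) =
        if S ∈ a then μ {x | c x = a} else 0 := by
      intro a _
      by_cases h : ∃ x, c x = a
      · have hmem : r a ∈ S ↔ S ∈ a := by
          conv_rhs => rw [← hr a h]
          simp [c, hS]
        by_cases hSa : S ∈ a
        · simp [hSa, hmem.2 hSa]
        · simp [hSa, mt hmem.1 hSa]
      · simp [hz a h]
    rw [Finset.sum_congr rfl key, ← Finset.sum_filter, ← finitelyAdditive_preimage_finset μ hadd]
    congr 1
    ext x
    simp [c, hS]

/-- The real functions on `Γ` with bounded range. -/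
def boundedFunctions (Γ : Type*) : Submodule ℝ (Γ → ℝ) where
  carrier := {f | ∃ C, ∀ x, |f x| ≤ C}
  add_mem' := by
    rintro f g ⟨C, hC⟩ ⟨D, hD⟩
    exact ⟨C + D, fun x => (abs_add_le _ _).trans (add_le_add (hC x) (hD x))⟩
  zero_mem' := ⟨0, by simp⟩
  smul_mem' := by
    rintro c f ⟨C, hC⟩
    refine ⟨|c| * C, fun x => ?_⟩
    simpa [abs_mul] using mul_le_mul_of_nonneg_left (hC x) (abs_nonneg c)

lemma abs_map_le_of_nonneg (L : (Γ → ℝ) →ₗ[ℝ] ℝ)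
    (hL : ∀ f ∈ boundedFunctions Γ, (∀ x, 0 ≤ f x) → 0 ≤ L f) (hL1 : L 1 = 1)
    {f : Γ → ℝ} {C : ℝ} (hf : ∀ x, |f x| ≤ C) : |L f| ≤ C := by
  have hmem : f ∈ boundedFunctions Γ := ⟨C, hf⟩
  have h1 : (1 : Γ → ℝ) ∈ boundedFunctions Γ := ⟨1, by simp⟩
  have hC := Submodule.smul_mem _ C h1
  have ha := hL _ (Submodule.sub_mem _ hC hmem) (fun x => by
    simpa using (abs_le.1 (hf x)).2)
  have hb := hL _ (Submodule.add_mem _ hC hmem) (fun x => by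
    have := (abs_le.1 (hf x)).1
    simp only [Pi.add_apply, Pi.smul_apply, Pi.one_apply, smul_eq_mul, mul_one]
    linarith)
  simp only [map_sub, map_add, map_smul, hL1, smul_eq_mul, mul_one] at ha hb
  exact abs_le.2 ⟨by linarith, by linarith⟩

/-- A finitely additive probability measure is the restriction to indicators of a mean. -/
lemma exists_mean_of_finitelyAdditive (μ : Set Γ → ℝ) (h0 : ∀ S : Set Γ, 0 ≤ μ S)
    (h1 : μ Set.univ = 1)
    (hadd : ∀ S T : Set Γ, Disjoint S T → μ (S ∪ T) = μ S + μ T) [Nonempty Γ] :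
    ∃ L : (Γ → ℝ) →ₗ[ℝ] ℝ, (∀ f ∈ boundedFunctions Γ, (∀ x, 0 ≤ f x) → 0 ≤ L f) ∧ L 1 = 1 ∧
      ∀ S, L (S.indicator 1) = μ S := by
  classical
  choose L hL hL1 hLS using exists_linearMap_eq_on_finset μ h0 h1 hadd
  let U : Ultrafilter (Finset (Set Γ)) := Ultrafilter.of atTop
  have hU : (U : Filter (Finset (Set Γ))) ≤ atTop := Ultrafilter.of_le _
  have hlim : ∀ f : boundedFunctions Γ, ∃ l, Tendsto (fun F => L F f) U (𝓝 l) := by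
    rintro ⟨f, C, hC⟩
    have hmem : ∀ F, L F f ∈ Set.Icc (-C) C := fun F =>
      abs_le.1 (abs_map_le_of_nonneg (L F) (fun f _ hf => hL F f hf) (hL1 F) hC)
    obtain ⟨l, -, hl⟩ := (isCompact_Icc (a := -C) (b := C)).ultrafilter_le_nhds
      (U.map fun F => L F f) (by
        simp only [Ultrafilter.coe_map, le_principal_iff, mem_map]
        exact Filter.univ_mem' hmem)
    exact ⟨l, hl⟩
  choose m hm using hlim
  let m' : boundedFunctions Γ →ₗ[ℝ] ℝ :=
    { toFun := m
      map_add' := fun f g => tendsto_nhds_unique (hm (f + g)) (by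
        simpa using (hm f).add (hm g))
      map_smul' := fun c f => tendsto_nhds_unique (hm (c • f)) (by
        simpa using (hm f).const_mul c) }
  obtain ⟨M, hM⟩ := m'.exists_extend
  have hMm : ∀ f (hf : f ∈ boundedFunctions Γ), M f = m ⟨f, hf⟩ := fun f hf =>
    congrArg (fun T => T ⟨f, hf⟩) hM
  refine ⟨M, ?_, ?_, ?_⟩
  · intro f hf hpos
    rw [hMm f hf]
    exact ge_of_tendsto' (hm _) fun F => hL F f hpos
  · rw [hMm 1 ⟨1, by simp⟩]
    exact tendsto_nhds_unique (hm _) (by simp [hL1])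
  · intro S
    have hS : S.indicator (1 : Γ → ℝ) ∈ boundedFunctions Γ :=
      ⟨1, fun x => by by_cases h : x ∈ S <;> simp [h]⟩
    rw [hMm _ hS]
    refine tendsto_nhds_unique (hm _) (tendsto_const_nhds.congr' ?_)
    filter_upwards [hU (eventually_ge_atTop {S})] with F hF
    exact (hLS F S (hF (by simp))).symm

/-- Every bounded function is uniformly close to a combination of indicators. -/
lemma exists_sum_indicator_close {f : Γ → ℝ} (hf : f ∈ boundedFunctions Γ) {δ : ℝ} (hδ : 0 < δ) :
    ∃ (s : Finset ℤ) (a : ℤ → ℝ) (S : ℤ → Set Γ),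
      ∀ x, |f x - (∑ k ∈ s, a k • (S k).indicator (1 : Γ → ℝ)) x| ≤ δ := by
  classical
  obtain ⟨C, hC⟩ := hf
  refine ⟨Finset.Icc ⌊-C / δ⌋ ⌊C / δ⌋, fun k => k * δ, fun k => {x | ⌊f x / δ⌋ = k}, fun x => ?_⟩
  have hmem : ⌊f x / δ⌋ ∈ Finset.Icc ⌊-C / δ⌋ ⌊C / δ⌋ := by
    have := abs_le.1 (hC x)
    rw [Finset.mem_Icc]
    constructor <;> apply Int.floor_mono <;> gcongr <;> linarith
  simp only [Finset.sum_apply, Pi.smul_apply, smul_eq_mul]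
  rw [Finset.sum_eq_single_of_mem _ hmem]
  · have h1 := Int.floor_le (f x / δ)
    have h2 := Int.lt_floor_add_one (f x / δ)
    rw [le_div_iff₀ hδ] at h1
    rw [div_lt_iff₀ hδ] at h2
    simp only [Set.mem_ofPred_eq, Set.indicator_of_mem, Pi.one_apply, mul_one]
    exact abs_le.2 ⟨by linarith, by linarith⟩
  · intro k _ hk
    simp [hk.symm]

lemma IsAmenable.exists_leftInvariant_mean [Group Γ] (h : IsAmenable Γ) :
    ∃ L : (Γ → ℝ) →ₗ[ℝ] ℝ, (∀ f ∈ boundedFunctions Γ, (∀ x, 0 ≤ f x) → 0 ≤ L f) ∧ L 1 = 1 ∧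
      ∀ g, ∀ f ∈ boundedFunctions Γ, L (fun x => f (g * x)) = L f := by
  obtain ⟨μ, h0, h1, hadd, hinv⟩ := h
  obtain ⟨L, hL, hL1, hLS⟩ := exists_mean_of_finitelyAdditive μ h0 h1 hadd
  refine ⟨L, hL, hL1, fun g f hf => ?_⟩
  have hind : ∀ S : Set Γ, L (fun x => S.indicator (1 : Γ → ℝ) (g * x)) =
      L (S.indicator (1 : Γ → ℝ)) := by
    intro S
    have : (fun x => S.indicator (1 : Γ → ℝ) (g * x)) =
        ((fun x => g⁻¹ * x) '' S).indicator 1 := by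
      ext x
      have : x ∈ (fun x => g⁻¹ * x) '' S ↔ g * x ∈ S := by simp
      by_cases hx : g * x ∈ S <;> simp [hx]
    rw [this, hLS, hLS, hinv]
  refine eq_of_abs_sub_le_all fun δ hδ => ?_
  obtain ⟨s, a, S, hs⟩ := exists_sum_indicator_close hf (half_pos hδ)
  set t := ∑ k ∈ s, a k • (S k).indicator (1 : Γ → ℝ) with ht
  have e : L (fun x => t (g * x)) = L t := by
    have : (fun x => t (g * x)) =
        ∑ k ∈ s, a k • (fun x => (S k).indicator (1 : Γ → ℝ) (g * x)) := by
      ext x; simp [ht]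
    rw [this, ht]
    simp only [map_sum, map_smul, hind]
  have e1 := abs_map_le_of_nonneg L hL hL1 (f := f - t) hs
  have e2 := abs_map_le_of_nonneg L hL hL1 (f := (fun x => f (g * x)) - fun x => t (g * x))
    (fun x => hs (g * x))
  rw [map_sub] at e1 e2
  rw [e] at e2
  rw [abs_le] at *
  constructor <;> linarith [e1.1, e1.2, e2.1, e2.2]

end Mean

section ComplexMean

variable {Γ : Type*}

/-- The complex linear extension of a real functional. -/
noncomputable def complexMean (L : (Γ → ℝ) →ₗ[ℝ] ℝ) : (Γ → ℂ) →ₗ[ℂ] ℂ where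
  toFun f := L (fun x => (f x).re) + Complex.I * L (fun x => (f x).im)
  map_add' f g := by
    have h1 : (fun x => ((f + g) x).re) = (fun x => (f x).re) + fun x => (g x).re := by
      ext; simp
    have h2 : (fun x => ((f + g) x).im) = (fun x => (f x).im) + fun x => (g x).im := by
      ext; simp
    rw [h1, h2, map_add, map_add]
    push_cast
    ring
  map_smul' c f := by
    have h1 : (fun x => ((c • f) x).re) = c.re • (fun x => (f x).re) - c.im • fun x => (f x).im := by
      ext; simp
    have h2 : (fun x => ((c • f) x).im) = c.re • (fun x => (f x).im) + c.im • fun x => (f x).re := by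
      ext; simp
    rw [h1, h2]
    apply Complex.ext <;> simp

lemma complexMean_re (L : (Γ → ℝ) →ₗ[ℝ] ℝ) (f : Γ → ℂ) :
    (complexMean L f).re = L (fun x => (f x).re) := by
  simp [complexMean]

lemma complexMean_im (L : (Γ → ℝ) →ₗ[ℝ] ℝ) (f : Γ → ℂ) :
    (complexMean L f).im = L (fun x => (f x).im) := by
  simp [complexMean]

lemma complexMean_conj (L : (Γ → ℝ) →ₗ[ℝ] ℝ) (f : Γ → ℂ) :
    complexMean L (fun x => starRingEnd ℂ (f x)) = starRingEnd ℂ (complexMean L f) := by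
  have h : (fun x => -(f x).im) = -fun x => (f x).im := rfl
  apply Complex.ext <;> simp [complexMean_re, complexMean_im, h]

lemma complexMean_invariant {L : (Γ → ℝ) →ₗ[ℝ] ℝ} {t : Γ → Γ}
    (ht : ∀ f ∈ boundedFunctions Γ, L (fun x => f (t x)) = L f) {f : Γ → ℂ} {C : ℝ}
    (hf : ∀ x, ‖f x‖ ≤ C) : complexMean L (fun x => f (t x)) = complexMean L f := by
  apply Complex.ext
  · rw [complexMean_re, complexMean_re]
    exact ht _ ⟨C, fun x => (Complex.abs_re_le_norm _).trans (hf x)⟩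
  · rw [complexMean_im, complexMean_im]
    exact ht _ ⟨C, fun x => (Complex.abs_im_le_norm _).trans (hf x)⟩

lemma complexMean_const {L : (Γ → ℝ) →ₗ[ℝ] ℝ} (h1 : L 1 = 1) (c : ℂ) :
    complexMean L (fun _ => c) = c := by
  have h : ∀ r : ℝ, L (fun _ => r) = r := fun r => by
    have : (fun _ : Γ => r) = r • (1 : Γ → ℝ) := by ext; simp
    rw [this, map_smul, h1, smul_eq_mul, mul_one]
  apply Complex.ext <;> simp [complexMean_re, complexMean_im, h]

lemma norm_complexMean_le {L : (Γ → ℝ) →ₗ[ℝ] ℝ}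
    (hL : ∀ f ∈ boundedFunctions Γ, (∀ x, 0 ≤ f x) → 0 ≤ L f) (h1 : L 1 = 1)
    {f : Γ → ℂ} {C : ℝ} (hf : ∀ x, ‖f x‖ ≤ C) : ‖complexMean L f‖ ≤ 2 * C := by
  refine (Complex.norm_le_abs_re_add_abs_im _).trans ?_
  rw [complexMean_re, complexMean_im, two_mul]
  exact add_le_add
    (abs_map_le_of_nonneg L hL h1 fun x => (Complex.abs_re_le_norm _).trans (hf x))
    (abs_map_le_of_nonneg L hL h1 fun x => (Complex.abs_im_le_norm _).trans (hf x))

end ComplexMean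

section Dilation

universe u v

variable {Γ : Type u} {V : Type v} [NormedAddCommGroup V] [InnerProductSpace ℂ V]

/-- The `V`-valued functions on `Γ` with bounded range. -/
def boundedVectorFunctions (Γ : Type u) (V : Type v) [NormedAddCommGroup V]
    [InnerProductSpace ℂ V] : Submodule ℂ (Γ → V) where
  carrier := {f | ∃ C, ∀ x, ‖f x‖ ≤ C}
  add_mem' := by
    rintro f g ⟨C, hC⟩ ⟨D, hD⟩
    exact ⟨C + D, fun x => (norm_add_le _ _).trans (add_le_add (hC x) (hD x))⟩
  zero_mem' := ⟨0, by simp⟩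
  smul_mem' := by
    rintro c f ⟨C, hC⟩
    refine ⟨‖c‖ * C, fun x => ?_⟩
    simpa [norm_smul] using mul_le_mul_of_nonneg_left (hC x) (norm_nonneg c)

/-- A copy of the bounded functions `Γ → V`, without the topology of pointwise convergence. -/
def BoundedVectorFunction (Γ : Type u) (V : Type v) [NormedAddCommGroup V]
    [InnerProductSpace ℂ V] : Type (max u v) := boundedVectorFunctions Γ V

noncomputable instance : AddCommGroup (BoundedVectorFunction Γ V) :=
  inferInstanceAs (AddCommGroup (boundedVectorFunctions Γ V))

noncomputable instance : Module ℂ (BoundedVectorFunction Γ V) :=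
  inferInstanceAs (Module ℂ (boundedVectorFunctions Γ V))

namespace BoundedVectorFunction

/-- The underlying function. -/
def fn (f : BoundedVectorFunction Γ V) : Γ → V := Subtype.val f

/-- The bounded function with a given underlying function. -/
def ofFn (f : Γ → V) (hf : ∃ C, ∀ x, ‖f x‖ ≤ C) : BoundedVectorFunction Γ V := Subtype.mk f hf

lemma fn_ofFn (f : Γ → V) (hf : ∃ C, ∀ x, ‖f x‖ ≤ C) : (ofFn f hf).fn = f := rfl

lemma fn_injective {f g : BoundedVectorFunction Γ V} (h : ∀ x, f.fn x = g.fn x) : f = g :=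
  Subtype.ext (funext h)

lemma exists_bound (f : BoundedVectorFunction Γ V) : ∃ C, ∀ x, ‖f.fn x‖ ≤ C := f.2

lemma fn_add (f g : BoundedVectorFunction Γ V) (x : Γ) : (f + g).fn x = f.fn x + g.fn x := rfl

lemma fn_smul (c : ℂ) (f : BoundedVectorFunction Γ V) (x : Γ) : (c • f).fn x = c • f.fn x := rfl

/-- The semi-inner product on bounded functions given by a mean. -/
noncomputable abbrev innerCore (L : (Γ → ℝ) →ₗ[ℝ] ℝ)
    (hL : ∀ f ∈ boundedFunctions Γ, (∀ x, 0 ≤ f x) → 0 ≤ L f) :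
    PreInnerProductSpace.Core ℂ (BoundedVectorFunction Γ V) where
  inner f g := complexMean L (fun x => inner ℂ (f.fn x) (g.fn x))
  conj_inner_symm f g := by
    simp only [← complexMean_conj, inner_conj_symm]
  re_inner_nonneg f := by
    obtain ⟨C, hC⟩ := f.exists_bound
    rw [RCLike.re_eq_complex_re, complexMean_re]
    refine hL _ ⟨C ^ 2, fun x => ?_⟩ fun x => inner_self_nonneg (𝕜 := ℂ)
    have := inner_self_eq_norm_sq (𝕜 := ℂ) (f.fn x)
    rw [RCLike.re_eq_complex_re] at this
    simp only [this]
    rw [abs_of_nonneg (by positivity)]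
    gcongr
    exact hC x
  add_left f g h := by
    simp only [fn_add, inner_add_left]
    exact map_add (complexMean L) (fun x => inner ℂ (f.fn x) (h.fn x)) fun x =>
      inner ℂ (g.fn x) (h.fn x)
  smul_left f g c := by
    simp only [fn_smul, inner_smul_left]
    exact map_smul (complexMean L) _ fun x => inner ℂ (f.fn x) (g.fn x)

/-- Right translation of bounded functions. -/
noncomputable def translate [Group Γ] :
    Representation ℂ Γ (BoundedVectorFunction Γ V) where
  toFun g :=
    { toFun := fun f => ofFn (fun x => f.fn (x * g)) (f.exists_bound.imp fun _ h x => h (x * g))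
      map_add' := fun _ _ => rfl
      map_smul' := fun _ _ => rfl }
  map_one' := by
    ext f
    exact fn_injective fun x => congrArg f.fn (mul_one x)
  map_mul' g h := by
    ext f
    exact fn_injective fun x => congrArg f.fn (mul_assoc x g h).symm

/-- The map sending a vector to its images under a family of isometries. -/
noncomputable def orbit (φ : Γ → V →ₗᵢ[ℂ] V) : V →ₗ[ℂ] BoundedVectorFunction Γ V where
  toFun w := ofFn (fun x => φ x w) ⟨‖w‖, fun x => ((φ x).norm_map w).le⟩
  map_add' w w' := fn_injective fun x => map_add (φ x) w w'
  map_smul' c w := fn_injective fun x => map_smul (φ x) c w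

end BoundedVectorFunction

/-- The extension of an isometric representation to the completion. -/
noncomputable def Representation.completion [Group Γ] {E : Type*} [SeminormedAddCommGroup E]
    [InnerProductSpace ℂ E] (τ : Representation ℂ Γ E) (hτ : ∀ g x, ‖τ g x‖ = ‖x‖) :
    Representation ℂ Γ (UniformSpace.Completion E) :=
  have hu : ∀ g, UniformContinuous (τ g) := fun g =>
    (AddMonoidHomClass.isometry_of_norm (τ g) (hτ g)).uniformContinuous
  { toFun g :=
      { toFun := UniformSpace.Completion.map (τ g)
        map_add' := fun x y => by
          have hc : Continuous (UniformSpace.Completion.map (τ g)) :=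
            UniformSpace.Completion.continuous_map
          induction x, y using UniformSpace.Completion.induction_on₂ with
          | hp =>
            exact isClosed_eq (hc.comp continuous_add)
              ((hc.comp continuous_fst).add (hc.comp continuous_snd))
          | ih x y =>
            rw [← UniformSpace.Completion.coe_add, UniformSpace.Completion.map_coe (hu g),
              UniformSpace.Completion.map_coe (hu g), UniformSpace.Completion.map_coe (hu g),
              map_add, UniformSpace.Completion.coe_add]
        map_smul' := fun c x => by
          have hc : Continuous (UniformSpace.Completion.map (τ g)) :=
            UniformSpace.Completion.continuous_map
          induction x using UniformSpace.Completion.induction_on with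
          | hp => exact isClosed_eq (hc.comp (continuous_const_smul c)) (hc.const_smul c)
          | ih x =>
            rw [← UniformSpace.Completion.coe_smul, UniformSpace.Completion.map_coe (hu g),
              UniformSpace.Completion.map_coe (hu g), map_smul,
              UniformSpace.Completion.coe_smul, RingHom.id_apply] }
    map_one' := by
      ext x
      change UniformSpace.Completion.map (τ 1) x = x
      induction x using UniformSpace.Completion.induction_on with
      | hp => exact isClosed_eq UniformSpace.Completion.continuous_map continuous_id
      | ih x => rw [UniformSpace.Completion.map_coe (hu 1), map_one]; rfl
    map_mul' g h := by
      ext x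
      change UniformSpace.Completion.map (τ (g * h)) x =
        UniformSpace.Completion.map (τ g) (UniformSpace.Completion.map (τ h) x)
      induction x using UniformSpace.Completion.induction_on with
      | hp =>
        exact isClosed_eq UniformSpace.Completion.continuous_map
          (UniformSpace.Completion.continuous_map.comp UniformSpace.Completion.continuous_map)
      | ih x =>
        rw [UniformSpace.Completion.map_coe (hu _), UniformSpace.Completion.map_coe (hu _),
          UniformSpace.Completion.map_coe (hu _), map_mul]
        rfl }

lemma Representation.completion_coe [Group Γ] {E : Type*} [SeminormedAddCommGroup E]
    [InnerProductSpace ℂ E] (τ : Representation ℂ Γ E) (hτ : ∀ g x, ‖τ g x‖ = ‖x‖) (g : Γ) (x : E) :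
    τ.completion hτ g (x : UniformSpace.Completion E) = (τ g x : E) :=
  UniformSpace.Completion.map_coe
    (AddMonoidHomClass.isometry_of_norm (τ g) (hτ g)).uniformContinuous x

lemma Representation.norm_completion [Group Γ] {E : Type*} [SeminormedAddCommGroup E]
    [InnerProductSpace ℂ E] (τ : Representation ℂ Γ E) (hτ : ∀ g x, ‖τ g x‖ = ‖x‖) (g : Γ)
    (x : UniformSpace.Completion E) : ‖τ.completion hτ g x‖ = ‖x‖ := by
  induction x using UniformSpace.Completion.induction_on with
  | hp =>
    exact isClosed_eq (continuous_norm.comp UniformSpace.Completion.continuous_map) continuous_norm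
  | ih x =>
    rw [τ.completion_coe, UniformSpace.Completion.norm_coe, UniformSpace.Completion.norm_coe, hτ]

/-- An isometric representation on a semi-inner product space can be completed. -/
lemma exists_completion_of_isometric [Group Γ] {E : Type (max u v)} [SeminormedAddCommGroup E]
    [InnerProductSpace ℂ E] (τ : Representation ℂ Γ E) (hτ : ∀ g x, ‖τ g x‖ = ‖x‖)
    (J₀ : V →ₗᵢ[ℂ] E) :
    ∃ (H : Type (max u v)) (_ : NormedAddCommGroup H) (_ : InnerProductSpace ℂ H)
      (_ : CompleteSpace H) (π : Representation ℂ Γ H) (J : V →ₗᵢ[ℂ] H),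
      (∀ g x, ‖π g x‖ = ‖x‖) ∧
      ∀ g w w', ‖π g (J w) - J w'‖ = ‖τ g (J₀ w) - J₀ w'‖ := by
  refine ⟨UniformSpace.Completion E, inferInstance, inferInstance,
    inferInstance, τ.completion hτ,
    UniformSpace.Completion.toComplₗᵢ.comp J₀, Representation.norm_completion _ hτ, fun g w w' => ?_⟩
  change ‖τ.completion hτ g (J₀ w : UniformSpace.Completion E) - (J₀ w' : E)‖ = _
  rw [Representation.completion_coe,
    ← UniformSpace.Completion.coe_sub, UniformSpace.Completion.norm_coe]

/-- An isometric representation on a space with a semi-inner product extends to a Hilbert space. -/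
lemma exists_completion_of_core [Group Γ] {E : Type (max u v)} [AddCommGroup E] [Module ℂ E]
    (core : PreInnerProductSpace.Core ℂ E) (q : E → ℝ) (hq : ∀ x, (core.inner x x).re = q x)
    (τ : Representation ℂ Γ E) (hτ : ∀ g x, q (τ g x) = q x)
    (J₀ : V →ₗ[ℂ] E) (hJ₀ : ∀ w, q (J₀ w) = ‖w‖ ^ 2) :
    ∃ (H : Type (max u v)) (_ : NormedAddCommGroup H) (_ : InnerProductSpace ℂ H)
      (_ : CompleteSpace H) (π : Representation ℂ Γ H) (J : V →ₗᵢ[ℂ] H),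
      (∀ g x, ‖π g x‖ = ‖x‖) ∧
      ∀ g w w', ‖π g (J w) - J w'‖ ^ 2 = q (τ g (J₀ w) - J₀ w') := by
  let i₁ : SeminormedAddCommGroup E := InnerProductSpace.Core.toSeminormedAddCommGroup (c := core)
  let i₂ : InnerProductSpace ℂ E := InnerProductSpace.ofCore core
  have hnorm : ∀ x : E, ‖x‖ ^ 2 = q x := fun x => by
    rw [← inner_self_eq_norm_sq (𝕜 := ℂ), ← hq]
    rfl
  obtain ⟨H, i₁, i₂, i₃, π, J, hπ, hJ⟩ := exists_completion_of_isometric τ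
    (fun g x => by rw [← sq_eq_sq₀ (norm_nonneg _) (norm_nonneg _), hnorm, hnorm, hτ])
    ⟨J₀, fun w => by rw [← sq_eq_sq₀ (norm_nonneg _) (norm_nonneg _), hnorm, hJ₀]⟩
  exact ⟨H, i₁, i₂, i₃, π, J, hπ, fun g w w' => by rw [hJ, hnorm]; rfl⟩

/-- A right invariant mean dilates a family of isometries to an isometric representation; the
failure of the dilation to be equivariant is the average multiplicative defect. -/
theorem exists_isometric_dilation [Group Γ] (L : (Γ → ℝ) →ₗ[ℝ] ℝ)
    (hL : ∀ f ∈ boundedFunctions Γ, (∀ x, 0 ≤ f x) → 0 ≤ L f) (h1 : L 1 = 1)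
    (hinv : ∀ g, ∀ f ∈ boundedFunctions Γ, L (fun x => f (x * g)) = L f)
    (φ : Γ → V →ₗᵢ[ℂ] V) :
    ∃ (H : Type (max u v)) (_ : NormedAddCommGroup H) (_ : InnerProductSpace ℂ H)
      (_ : CompleteSpace H) (π : Representation ℂ Γ H) (J : V →ₗᵢ[ℂ] H),
      (∀ g x, ‖π g x‖ = ‖x‖) ∧
      ∀ g w, ‖π g (J w) - J (φ g w)‖ ^ 2 = L (fun x => ‖φ (x * g) w - φ x (φ g w)‖ ^ 2) := by
  have hq : ∀ f : BoundedVectorFunction Γ V,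
      (complexMean L fun x => inner ℂ (f.fn x) (f.fn x)).re = L fun x => ‖f.fn x‖ ^ 2 := by
    intro f
    rw [complexMean_re]
    congr 1
    ext x
    exact inner_self_eq_norm_sq (𝕜 := ℂ) (f.fn x)
  have hτ : ∀ (g : Γ) (f : BoundedVectorFunction Γ V),
      (L fun x => ‖(BoundedVectorFunction.translate g f).fn x‖ ^ 2) =
        L fun x => ‖f.fn x‖ ^ 2 := by
    intro g f
    obtain ⟨C, hC⟩ := f.exists_bound
    refine hinv g (fun x => ‖f.fn x‖ ^ 2) ⟨C ^ 2, fun x => ?_⟩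
    change |‖f.fn x‖ ^ 2| ≤ C ^ 2
    rw [abs_of_nonneg (by positivity)]
    exact pow_le_pow_left₀ (norm_nonneg _) (hC x) 2
  have hJ₀ : ∀ w, (L fun x => ‖(BoundedVectorFunction.orbit φ w).fn x‖ ^ 2) = ‖w‖ ^ 2 := by
    intro w
    have : (fun x => ‖(BoundedVectorFunction.orbit φ w).fn x‖ ^ 2) = ‖w‖ ^ 2 • (1 : Γ → ℝ) := by
      ext x
      simp [BoundedVectorFunction.orbit, BoundedVectorFunction.fn_ofFn]
    rw [this, map_smul, h1, smul_eq_mul, mul_one]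
  obtain ⟨H, i₁, i₂, i₃, π, J, hπ, hJ⟩ :=
    exists_completion_of_core (BoundedVectorFunction.innerCore L hL)
      (fun f => L fun x => ‖f.fn x‖ ^ 2) hq BoundedVectorFunction.translate hτ
      (BoundedVectorFunction.orbit φ) hJ₀
  exact ⟨H, i₁, i₂, i₃, π, J, hπ, fun g w => hJ g w (φ g w)⟩

end Dilation

section SpectralTruncation

variable {A : Type*} [CStarAlgebra A]

/-- A continuous cut-off of the spectral projection of `T` onto `[1/2, ∞)`. -/
noncomputable def spectralTruncation (T : A) : A := cfc (fun t : ℝ => max (t - 1 / 2) 0) T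

lemma spectralTruncation_isSelfAdjoint (T : A) : IsSelfAdjoint (spectralTruncation T) :=
  cfc_predicate _ _

lemma spectralTruncation_commute {T S : A} (h : Commute T S) :
    Commute (spectralTruncation T) S :=
  Commute.cfc_real h _

lemma spectralTruncation_bounds [PartialOrder A] [StarOrderedRing A] {T : A} (h0 : 0 ≤ T) (h1 : T ≤ 1) :
    0 ≤ spectralTruncation T * (T - algebraMap ℝ A (1 / 2)) * spectralTruncation T ∧
    0 ≤ algebraMap ℝ A (1 / 2) - T + spectralTruncation T ∧
    0 ≤ spectralTruncation T * ((1 - T) * (T - algebraMap ℝ A (1 / 2))) *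
      spectralTruncation T := by
  have hT : IsSelfAdjoint T := IsSelfAdjoint.of_nonneg h0
  have hs : ∀ t ∈ spectrum ℝ T, 0 ≤ t ∧ t ≤ 1 := fun t ht =>
    ⟨spectrum_nonneg_of_nonneg h0 ht, (le_algebraMap_iff_spectrum_le (a := T) (r := (1:ℝ))).1
      (by simpa using h1) t ht⟩
  have hid : cfc (fun t : ℝ => t) T = T := cfc_id' ℝ T
  have hc : cfc (fun _ : ℝ => (1 / 2 : ℝ)) T = algebraMap ℝ A (1 / 2) := cfc_const _ T
  have hone : cfc (fun _ : ℝ => (1 : ℝ)) T = 1 := by rw [cfc_const _ T, map_one]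
  have hsub : T - algebraMap ℝ A (1 / 2) = cfc (fun t : ℝ => t - 1 / 2) T := by
    rw [cfc_sub (fun t : ℝ => t) (fun _ => 1 / 2) T, hid, hc]
  have hsub' : 1 - T = cfc (fun t : ℝ => 1 - t) T := by
    rw [cfc_sub (fun _ : ℝ => 1) (fun t => t) T, hid, hone]
  refine ⟨?_, ?_, ?_⟩
  · rw [hsub, spectralTruncation, ← cfc_mul .., ← cfc_mul ..]
    refine cfc_nonneg fun t _ => ?_
    rcases le_total (t - 1 / 2) 0 with h | h
    · rw [max_eq_right h]; simp
    · rw [max_eq_left h]; positivity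
  · rw [← neg_sub T, hsub, spectralTruncation, ← cfc_neg, ← cfc_add ..]
    refine cfc_nonneg fun t _ => ?_
    have := le_max_left (t - 1 / 2) 0
    linarith
  · rw [hsub, hsub', spectralTruncation, ← cfc_mul .., ← cfc_mul .., ← cfc_mul ..]
    refine cfc_nonneg fun t ht => ?_
    have := hs t ht
    rcases le_total (t - 1 / 2) 0 with h | h
    · rw [max_eq_right h]; simp
    · have : 0 ≤ 1 - t := by linarith
      rw [max_eq_left h]; positivity

end SpectralTruncation

section AveragedOperator

variable {Γ : Type*} [Group Γ] {H : Type*} [NormedAddCommGroup H] [InnerProductSpace ℂ H]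
  {ι : Type*}

lemma Representation.inner_map_map_of_norm {π : Representation ℂ Γ H}
    (hπ : ∀ g x, ‖π g x‖ = ‖x‖) (g : Γ) (x y : H) : inner ℂ (π g x) (π g y) = inner ℂ x y :=
  LinearIsometry.inner_map_map ⟨π g, hπ g⟩ x y

lemma Representation.inner_map_left_of_norm {π : Representation ℂ Γ H}
    (hπ : ∀ g x, ‖π g x‖ = ‖x‖) (g : Γ) (x y : H) :
    inner ℂ (π g x) y = inner ℂ x (π g⁻¹ y) := by
  rw [← Representation.inner_map_map_of_norm hπ g x (π g⁻¹ y), Representation.self_inv_apply]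

lemma Representation.inner_map_right_of_norm {π : Representation ℂ Γ H}
    (hπ : ∀ g x, ‖π g x‖ = ‖x‖) (g : Γ) (x y : H) :
    inner ℂ x (π g y) = inner ℂ (π g⁻¹ x) y := by
  rw [Representation.inner_map_left_of_norm hπ, inv_inv]

lemma Representation.orthonormal_map_of_norm {π : Representation ℂ Γ H}
    (hπ : ∀ g x, ‖π g x‖ = ‖x‖) {v : ι → H} (hv : Orthonormal ℂ v) (g : Γ) :
    Orthonormal ℂ fun i => π g (v i) :=
  hv.comp_linearIsometry ⟨π g, hπ g⟩

/-- The average over the group of the projections onto the translates of the span of `v`. -/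
lemma exists_averaged_operator [Fintype ι] [CompleteSpace H] {L : (Γ → ℝ) →ₗ[ℝ] ℝ}
    (hL : ∀ f ∈ boundedFunctions Γ, (∀ x, 0 ≤ f x) → 0 ≤ L f) (h1 : L 1 = 1)
    (hinv : ∀ g, ∀ f ∈ boundedFunctions Γ, L (fun x => f (g * x)) = L f)
    {π : Representation ℂ Γ H} (hπ : ∀ g x, ‖π g x‖ = ‖x‖) {v : ι → H} (hv : Orthonormal ℂ v) :
    ∃ T : H →L[ℂ] H, 0 ≤ T ∧ T ≤ 1 ∧ (∀ g x, T (π g x) = π g (T x)) ∧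
      ∀ x y, inner ℂ (T x) y =
        complexMean L fun g => ∑ i, inner ℂ x (π g (v i)) * inner ℂ (π g (v i)) y := by
  have hvn : ∀ i, ‖v i‖ = 1 := hv.1
  have hb : ∀ x y g, ‖∑ i, inner ℂ x (π g (v i)) * inner ℂ (π g (v i)) y‖ ≤
      Fintype.card ι * (‖x‖ * ‖y‖) := by
    intro x y g
    refine (norm_sum_le _ _).trans ?_
    rw [← nsmul_eq_mul, ← Finset.card_univ, ← Finset.sum_const]
    refine Finset.sum_le_sum fun i _ => ?_
    rw [norm_mul]
    have h1 := norm_inner_le_norm (𝕜 := ℂ) x (π g (v i))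
    have h2 := norm_inner_le_norm (𝕜 := ℂ) (π g (v i)) y
    rw [hπ, hvn] at h1 h2
    rw [mul_one] at h1
    rw [one_mul] at h2
    gcongr
  let F : H →ₗ⋆[ℂ] H →ₗ[ℂ] ℂ := LinearMap.mk₂'ₛₗ (starRingEnd ℂ) (RingHom.id ℂ)
    (fun x y => complexMean L fun g => ∑ i, inner ℂ x (π g (v i)) * inner ℂ (π g (v i)) y)
    (fun x x' y => by
      simp only [inner_add_left, add_mul, Finset.sum_add_distrib]
      exact map_add (complexMean L) (fun g => ∑ i, _) fun g => ∑ i, _)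
    (fun c x y => by
      simp only [inner_smul_left, mul_assoc, ← Finset.mul_sum]
      exact map_smul (complexMean L) _ fun g => ∑ i, _)
    (fun x y y' => by
      simp only [inner_add_right, mul_add, Finset.sum_add_distrib]
      exact map_add (complexMean L) (fun g => ∑ i, _) fun g => ∑ i, _)
    (fun c x y => by
      simp only [inner_smul_right, mul_left_comm, ← Finset.mul_sum]
      exact map_smul (complexMean L) _ fun g => ∑ i, _)
  let T : H →L[ℂ] H := InnerProductSpace.continuousLinearMapOfBilin
    (F.mkContinuous₂ (2 * Fintype.card ι) fun x y => by
      refine (norm_complexMean_le hL h1 (hb x y)).trans (le_of_eq (by ring)))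
  have hT : ∀ x y, inner ℂ (T x) y =
      complexMean L fun g => ∑ i, inner ℂ x (π g (v i)) * inner ℂ (π g (v i)) y := fun x y =>
    InnerProductSpace.continuousLinearMapOfBilin_apply _ x y
  have hsq : ∀ x g, ∑ i, inner ℂ x (π g (v i)) * inner ℂ (π g (v i)) x =
      ((∑ i, ‖inner ℂ (π g (v i)) x‖ ^ 2 : ℝ) : ℂ) := by
    intro x g
    push_cast
    refine Finset.sum_congr rfl fun i _ => ?_
    rw [← inner_conj_symm x, RCLike.conj_mul]
    rfl
  have hbes : ∀ x g, ∑ i, ‖inner ℂ (π g (v i)) x‖ ^ 2 ≤ ‖x‖ ^ 2 := fun x g =>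
    (Representation.orthonormal_map_of_norm hπ hv g).sum_inner_products_le x
  have hTx : ∀ x, inner ℂ (T x) x = ((L fun g => ∑ i, ‖inner ℂ (π g (v i)) x‖ ^ 2 : ℝ) : ℂ) := by
    intro x
    rw [hT]
    simp only [hsq]
    apply Complex.ext
    · rw [complexMean_re]; simp only [Complex.ofReal_re]
    · have : (fun _ => 0 : Γ → ℝ) = 0 := rfl
      rw [complexMean_im]; simp only [Complex.ofReal_im, this, map_zero]
  have hmem : ∀ x, (fun g => ∑ i, ‖inner ℂ (π g (v i)) x‖ ^ 2) ∈ boundedFunctions Γ := fun x =>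
    ⟨‖x‖ ^ 2, fun g => by
      rw [abs_of_nonneg (by positivity)]
      exact hbes x g⟩
  refine ⟨T, ?_, ?_, ?_, hT⟩
  · rw [ContinuousLinearMap.nonneg_iff_isPositive, ContinuousLinearMap.isPositive_iff_complex]
    intro x
    rw [hTx]
    refine ⟨by rw [RCLike.re_eq_complex_re, Complex.ofReal_re], ?_⟩
    exact hL _ (hmem x) fun g => by positivity
  · rw [ContinuousLinearMap.le_def, ContinuousLinearMap.isPositive_iff_complex]
    intro x
    have : inner ℂ ((1 - T) x) x =
        ((‖x‖ ^ 2 - L fun g => ∑ i, ‖inner ℂ (π g (v i)) x‖ ^ 2 : ℝ) : ℂ) := by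
      rw [sub_apply, inner_sub_left, hTx]
      simp [inner_self_eq_norm_sq_to_K]
    rw [this]
    refine ⟨by rw [RCLike.re_eq_complex_re, Complex.ofReal_re], ?_⟩
    rw [RCLike.re_eq_complex_re, Complex.ofReal_re, sub_nonneg]
    refine (le_abs_self _).trans (abs_map_le_of_nonneg L hL h1 fun g => ?_)
    rw [abs_of_nonneg (by positivity)]
    exact hbes x g
  · intro k x
    refine ext_inner_right ℂ fun y => ?_
    rw [Representation.inner_map_left_of_norm hπ, hT, hT,
      ← complexMean_invariant (hinv k) (hb (π k x) y)]
    congr 1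
    ext g
    refine Finset.sum_congr rfl fun i _ => ?_
    rw [map_mul, Module.End.mul_apply, Representation.inner_map_map_of_norm hπ,
      Representation.inner_map_left_of_norm hπ k]

end AveragedOperator

section SpectralSubspace

variable {H : Type*} [NormedAddCommGroup H] [InnerProductSpace ℂ H]

lemma finiteDimensional_of_orthonormal_card_le {N : ℕ}
    (h : ∀ (s : ℕ) (w : Fin s → H), Orthonormal ℂ w → s ≤ N) : FiniteDimensional ℂ H := by
  refine Module.finite_of_rank_eq_nat (n := (Module.rank ℂ H).toNat)
    (Cardinal.cast_toNat_of_lt_aleph0 ?_).symm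
  refine (rank_le (n := N) fun s hs => ?_).trans_lt Cardinal.natCast_lt_aleph0
  rw [← finrank_span_finset_eq_card hs]
  exact h _ _ ((stdOrthonormalBasis ℂ (Submodule.span ℂ (s : Set H))).orthonormal.comp_linearIsometry
    (Submodule.subtypeₗᵢ _))

lemma Submodule.starProjection_map_comm {W : Submodule ℂ H} [W.HasOrthogonalProjection]
    {S : H →ₗ[ℂ] H} (h : ∀ x ∈ W, S x ∈ W) (h' : ∀ x ∈ Wᗮ, S x ∈ Wᗮ) (x : H) :
    W.starProjection (S x) = S (W.starProjection x) := by
  refine (Submodule.eq_starProjection_of_mem_orthogonal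
    (h _ (W.starProjection_apply_mem x)) ?_)
  rw [← map_sub]
  exact h' _ (W.sub_starProjection_mem_orthogonal x)

lemma re_inner_real_smul_left (r : ℝ) (x y : H) :
    (inner ℂ (r • x) y).re = r * (inner ℂ x y).re := by
  rw [inner_smul_left_eq_smul, Complex.smul_re, smul_eq_mul]

lemma re_inner_self (x : H) : (inner ℂ x x).re = ‖x‖ ^ 2 := inner_self_eq_norm_sq (𝕜 := ℂ) x

lemma re_inner_map_nonneg {T : H →L[ℂ] H} (h : 0 ≤ T) (x : H) :
    0 ≤ (inner ℂ (T x) x).re :=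
  ((ContinuousLinearMap.nonneg_iff_isPositive T).1 h).re_inner_nonneg_left x

variable [CompleteSpace H] {T : H →L[ℂ] H}

lemma inner_map_of_nonneg (h : 0 ≤ T) (x y : H) :
    inner ℂ (T x) y = inner ℂ x (T y) :=
  (IsSelfAdjoint.of_nonneg h).isSymmetric x y

lemma inner_spectralTruncation (x y : H) :
    inner ℂ (spectralTruncation T x) y = inner ℂ x (spectralTruncation T y) :=
  (spectralTruncation_isSelfAdjoint T).isSymmetric x y

lemma norm_sq_le_of_mem_range_spectralTruncation (h0 : 0 ≤ T) (h1 : T ≤ 1) {w : H}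
    (hw : w ∈ (spectralTruncation T).range) : ‖w‖ ^ 2 ≤ 2 * (inner ℂ (T w) w).re := by
  obtain ⟨x, rfl⟩ := hw
  have h := re_inner_map_nonneg (spectralTruncation_bounds h0 h1).1 x
  rw [mul_apply_eq_comp, mul_apply_eq_comp, inner_spectralTruncation] at h
  rw [sub_apply, inner_sub_left, Algebra.algebraMap_eq_smul_one, smul_apply,
    one_apply_eq_self, Complex.sub_re, re_inner_real_smul_left, re_inner_self] at h
  simp only [ContinuousLinearMap.coe_coe]
  linarith

lemma re_inner_sub_le_of_mem_range_spectralTruncation (h0 : 0 ≤ T) (h1 : T ≤ 1) {w : H}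
    (hw : w ∈ (spectralTruncation T).range) :
    (inner ℂ w (w - T w)).re ≤ 2 * (inner ℂ (T w) (w - T w)).re := by
  obtain ⟨x, rfl⟩ := hw
  have h := re_inner_map_nonneg (spectralTruncation_bounds h0 h1).2.2 x
  rw [mul_apply_eq_comp, mul_apply_eq_comp, inner_spectralTruncation, mul_apply_eq_comp] at h
  have h' := inner_map_of_nonneg (sub_nonneg.2 h1)
    ((T - algebraMap ℝ (H →L[ℂ] H) (1 / 2)) (spectralTruncation T x)) (spectralTruncation T x)
  rw [h', sub_apply, sub_apply, inner_sub_left, Algebra.algebraMap_eq_smul_one, smul_apply,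
    one_apply_eq_self, Complex.sub_re, re_inner_real_smul_left] at h
  simp only [ContinuousLinearMap.coe_coe]
  linarith

lemma re_inner_le_of_mem_orthogonal_range_spectralTruncation (h0 : 0 ≤ T) (h1 : T ≤ 1) {x : H}
    (hx : x ∈ (spectralTruncation T).rangeᗮ) : 2 * (inner ℂ (T x) x).re ≤ ‖x‖ ^ 2 := by
  have h := re_inner_map_nonneg (spectralTruncation_bounds h0 h1).2.1 x
  have hB : inner ℂ (spectralTruncation T x) x = 0 :=
    (Submodule.mem_orthogonal _ x).1 hx _ ⟨x, rfl⟩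
  rw [add_apply, sub_apply, inner_add_left, hB, inner_sub_left,
    Algebra.algebraMap_eq_smul_one, smul_apply, one_apply_eq_self, add_zero, Complex.sub_re,
    re_inner_real_smul_left, re_inner_self] at h
  linarith

end SpectralSubspace

lemma le_map_of_nonneg {Γ : Type*} {L : (Γ → ℝ) →ₗ[ℝ] ℝ}
    (hL : ∀ f ∈ boundedFunctions Γ, (∀ x, 0 ≤ f x) → 0 ≤ L f) (h1 : L 1 = 1)
    {f : Γ → ℝ} (hf : f ∈ boundedFunctions Γ) {c : ℝ} (hc : ∀ x, c ≤ f x) : c ≤ L f := by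
  have hone : (1 : Γ → ℝ) ∈ boundedFunctions Γ := ⟨1, by simp⟩
  have h := hL _ (Submodule.sub_mem _ hf (Submodule.smul_mem _ c hone)) fun x => by simp [hc x]
  rw [map_sub, map_smul, h1] at h
  simpa using h

section InvariantSubspace

variable {Γ : Type*} [Group Γ] {H : Type*} [NormedAddCommGroup H] [InnerProductSpace ℂ H]
  {ι κ : Type*} [Fintype ι] [Fintype κ] {L : (Γ → ℝ) →ₗ[ℝ] ℝ} {π : Representation ℂ Γ H}
  {v : ι → H} {T : H →L[ℂ] H}

lemma re_inner_averaged
    (hT : ∀ x y, inner ℂ (T x) y =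
      complexMean L fun g => ∑ i, inner ℂ x (π g (v i)) * inner ℂ (π g (v i)) y) (x : H) :
    (inner ℂ (T x) x).re = L fun g => ∑ i, ‖inner ℂ (π g (v i)) x‖ ^ 2 := by
  rw [hT, complexMean_re]
  congr 1
  ext g
  rw [Complex.re_sum]
  refine Finset.sum_congr rfl fun i _ => ?_
  rw [← inner_conj_symm x, RCLike.conj_mul]
  exact_mod_cast Complex.ofReal_re _

lemma sum_re_inner_averaged
    (hT : ∀ x y, inner ℂ (T x) y =
      complexMean L fun g => ∑ i, inner ℂ x (π g (v i)) * inner ℂ (π g (v i)) y) (w : κ → H) :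
    ∑ k, (inner ℂ (T (w k)) (w k)).re =
      L fun g => ∑ k, ∑ i, ‖inner ℂ (π g (v i)) (w k)‖ ^ 2 := by
  simp only [re_inner_averaged hT]
  rw [← map_sum]
  congr 1
  ext g
  rw [Finset.sum_apply]

lemma sum_sum_norm_inner_sq_le (hπ : ∀ g x, ‖π g x‖ = ‖x‖) (hv : Orthonormal ℂ v) {w : κ → H}
    (hw : Orthonormal ℂ w) (g : Γ) :
    ∑ k, ∑ i, ‖inner ℂ (π g (v i)) (w k)‖ ^ 2 ≤ Fintype.card ι := by
  rw [Finset.sum_comm]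
  calc _ ≤ ∑ i : ι, (1 : ℝ) := Finset.sum_le_sum fun i _ => by
        simp only [norm_inner_symm (π g (v i))]
        refine (hw.sum_inner_products_le _).trans ?_
        rw [hπ, hv.1, one_pow]
    _ = _ := by simp

/-- Trace computation for the compression of an averaged projection to an invariant subspace. -/
lemma sum_inner_averaged (h1 : L 1 = 1) (hπ : ∀ g x, ‖π g x‖ = ‖x‖)
    (hT : ∀ x y, inner ℂ (T x) y =
      complexMean L fun g => ∑ i, inner ℂ x (π g (v i)) * inner ℂ (π g (v i)) y)
    {W : Submodule ℂ H} [W.HasOrthogonalProjection]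
    (hP : ∀ g x, W.starProjection (π g x) = π g (W.starProjection x))
    (w : OrthonormalBasis κ ℂ W) {S : H →L[ℂ] H} (hS : ∀ g x, S (π g x) = π g (S x)) :
    ∑ k, inner ℂ (T (w k)) (S (w k)) = ∑ i, inner ℂ (v i) (S (W.starProjection (v i))) := by
  have hsum : ∀ y z : H, ∑ k, inner ℂ (w k : H) y * inner ℂ z (S (w k)) =
      inner ℂ z (S (W.starProjection y)) := by
    intro y z
    rw [w.starProjection_eq_sum_rankOne]
    simp
  simp only [hT]
  rw [← map_sum, ← complexMean_const h1 (∑ i, inner ℂ (v i) (S (W.starProjection (v i))))]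
  congr 1
  ext g
  rw [Finset.sum_apply, Finset.sum_comm]
  refine Finset.sum_congr rfl fun i _ => ?_
  rw [hsum, hP, hS, Representation.inner_map_map_of_norm hπ]

/-- A finite orthonormal system whose span is almost invariant under an isometric representation
is close to a finite-dimensional invariant subspace of almost the same dimension. -/
theorem exists_finiteDimensional_invariant [CompleteSpace H]
    (hL : ∀ f ∈ boundedFunctions Γ, (∀ x, 0 ≤ f x) → 0 ≤ L f) (h1 : L 1 = 1)
    (hinv : ∀ g, ∀ f ∈ boundedFunctions Γ, L (fun x => f (g * x)) = L f)
    (hπ : ∀ g x, ‖π g x‖ = ‖x‖) (hv : Orthonormal ℂ v) {δ : ℝ}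
    (hδ : ∀ g, Fintype.card ι - δ ≤ ∑ j, ∑ i, ‖inner ℂ (π g (v i)) (v j)‖ ^ 2) :
    ∃ (W : Submodule ℂ H) (_ : FiniteDimensional ℂ W), (∀ g, ∀ x ∈ W, π g x ∈ W) ∧
      (Module.finrank ℂ W : ℝ) + Fintype.card ι ≤
        2 * ∑ i, ‖W.starProjection (v i)‖ ^ 2 + 2 * δ := by
  obtain ⟨T, h0, hone, hcomm, hT⟩ := exists_averaged_operator hL h1 hinv hπ hv
  have habs : ∀ {κ : Type} [Fintype κ] {w : κ → H}, Orthonormal ℂ w → ∀ g,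
      |∑ k, ∑ i, ‖inner ℂ (π g (v i)) (w k)‖ ^ 2| ≤ Fintype.card ι := fun hw g => by
    rw [abs_of_nonneg (by positivity)]
    exact sum_sum_norm_inner_sq_le hπ hv hw g
  set W : Submodule ℂ H := (spectralTruncation T).range with hW
  have hWπ : ∀ g, ∀ x ∈ W, π g x ∈ W := by
    rintro g _ ⟨x, rfl⟩
    have hc : Commute T (LinearIsometry.mk (π g) (hπ g)).toContinuousLinearMap :=
      ContinuousLinearMap.ext fun x => hcomm g x
    exact ⟨π g x, DFunLike.congr_fun (spectralTruncation_commute hc).eq x⟩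
  have hWT : ∀ x ∈ W, T x ∈ W := by
    rintro _ ⟨x, rfl⟩
    exact ⟨T x, DFunLike.congr_fun (spectralTruncation_commute (Commute.refl T)).eq x⟩
  have hfin : FiniteDimensional ℂ W := by
    refine finiteDimensional_of_orthonormal_card_le (N := 2 * Fintype.card ι) fun s w hw => ?_
    have hw' : Orthonormal ℂ fun k => (w k : H) := hw.comp_linearIsometry W.subtypeₗᵢ
    have hle := (le_abs_self _).trans (abs_map_le_of_nonneg L hL h1 (habs hw'))
    rw [← sum_re_inner_averaged hT] at hle
    have hge : (s : ℝ) ≤ ∑ k : Fin s, 2 * (inner ℂ (T (w k)) (w k : H)).re := by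
      calc (s : ℝ) = ∑ k : Fin s, ‖(w k : H)‖ ^ 2 := by simp [hw'.1]
        _ ≤ _ := Finset.sum_le_sum fun k _ =>
          norm_sq_le_of_mem_range_spectralTruncation h0 hone (w k).2
    rw [← Finset.mul_sum] at hge
    have : (s : ℝ) ≤ 2 * Fintype.card ι := by linarith
    exact_mod_cast this
  have hPπ : ∀ g x, W.starProjection (π g x) = π g (W.starProjection x) := fun g x =>
    Submodule.starProjection_map_comm (hWπ g) (fun x hx => by
      rw [Submodule.mem_orthogonal] at hx ⊢
      intro u hu
      rw [Representation.inner_map_right_of_norm hπ]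
      exact hx _ (hWπ _ _ hu)) x
  have hWT' : ∀ x ∈ Wᗮ, T x ∈ Wᗮ := fun x hx => by
    rw [Submodule.mem_orthogonal] at hx ⊢
    intro u hu
    rw [← inner_map_of_nonneg h0]
    exact hx _ (hWT _ hu)
  refine ⟨W, hfin, hWπ, ?_⟩
  let w := stdOrthonormalBasis ℂ W
  have hvn : ∀ i, ‖v i‖ ^ 2 = 1 := fun i => by rw [hv.1, one_pow]
  have hwn : ∀ k, ‖(w k : H)‖ ^ 2 = 1 := fun k => by
    rw [← Submodule.coe_norm, w.orthonormal.1, one_pow]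
  have htr := congrArg Complex.re
    (sum_inner_averaged h1 hπ hT hPπ w (S := 1) fun g x => rfl)
  have htr' := congrArg Complex.re
    (sum_inner_averaged h1 hπ hT hPπ w (S := 1 - T) fun g x => by simp [hcomm])
  simp only [Complex.re_sum, sub_apply, one_apply_eq_self] at htr htr'
  have hP : ∀ i, (inner ℂ (v i) (W.starProjection (v i))).re = ‖W.starProjection (v i)‖ ^ 2 := by
    intro i
    rw [← re_inner_self, Submodule.inner_starProjection_left_eq_right,
      Submodule.starProjection_eq_self_iff.2 (W.starProjection_apply_mem _)]
  have hlow : (Fintype.card ι : ℝ) - δ ≤ ∑ i, (inner ℂ (T (v i)) (v i)).re := by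
    rw [sum_re_inner_averaged hT]
    refine le_map_of_nonneg hL h1 ⟨Fintype.card ι, fun g => ?_⟩ hδ
    rw [abs_of_nonneg (by positivity)]
    exact sum_sum_norm_inner_sq_le hπ hv hv g
  have hk : ∀ k, 1 - (inner ℂ (T (w k)) (w k : H)).re ≤
      2 * (inner ℂ (T (w k)) ((w k : H) - T (w k))).re := fun k => by
    have := re_inner_sub_le_of_mem_range_spectralTruncation h0 hone (w k).2
    rw [inner_sub_right, Complex.sub_re, re_inner_self, hwn, ← inner_map_of_nonneg h0] at this
    exact this
  have hi : ∀ i, 1 - ‖W.starProjection (v i)‖ ^ 2 +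
      2 * (inner ℂ (v i) (W.starProjection (v i) - T (W.starProjection (v i)))).re ≤
      2 * (1 - (inner ℂ (T (v i)) (v i)).re) := fun i => by
    set p := W.starProjection (v i) with hp
    have hpm : p ∈ W := W.starProjection_apply_mem _
    have hqm : v i - p ∈ Wᗮ := W.sub_starProjection_mem_orthogonal _
    have hq := re_inner_le_of_mem_orthogonal_range_spectralTruncation h0 hone hqm
    have hn : ‖v i - p‖ ^ 2 = 1 - ‖p‖ ^ 2 := by
      have := hP i
      rw [← re_inner_self, inner_sub_left, inner_sub_right, inner_sub_right,
        Complex.sub_re, Complex.sub_re, Complex.sub_re, re_inner_self, re_inner_self, hvn, this,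
        ← inner_conj_symm p, Complex.conj_re, this]
      ring
    have h2 : inner ℂ p (T (v i - p)) = 0 :=
      (Submodule.mem_orthogonal _ _).1 (hWT' _ hqm) _ hpm
    have h5 : inner ℂ (T (v i)) (v i) = inner ℂ (T (v i - p)) (v i - p) + inner ℂ (v i) (T p) := by
      rw [inner_map_of_nonneg h0, inner_map_of_nonneg h0, inner_sub_left, h2, sub_zero, map_sub,
        inner_sub_right, sub_add_cancel]
    rw [inner_sub_right, Complex.sub_re, hP i, h5, Complex.add_re]
    rw [hn] at hq
    linarith
  have hk' := Finset.sum_le_sum fun k (_ : k ∈ Finset.univ) => hk k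
  have hi' := Finset.sum_le_sum fun i (_ : i ∈ Finset.univ) => hi i
  simp only [Finset.sum_sub_distrib, Finset.sum_add_distrib, ← Finset.mul_sum, htr, htr', hP,
    Finset.sum_const, Finset.card_univ, Fintype.card_fin, nsmul_eq_mul, mul_one] at hk' hi'
  linarith

end InvariantSubspace

section UnitaryMatrices

variable {Γ : Type*} [Group Γ]

/-- An isometric representation is a homomorphism to unitary matrices in an orthonormal basis. -/
lemma exists_unitaryGroup_hom {K : Type*} [NormedAddCommGroup K] [InnerProductSpace ℂ K]
    {σ : Representation ℂ Γ K} (hσ : ∀ g x, ‖σ g x‖ = ‖x‖) {k : ℕ}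
    (b : EuclideanSpace ℂ (Fin k) ≃ₗᵢ[ℂ] K) :
    ∃ ρ : Γ →* Matrix.unitaryGroup (Fin k) ℂ, ∀ g x,
      b (Matrix.toEuclideanLin (ρ g : Matrix (Fin k) (Fin k) ℂ) x) = σ g (b x) := by
  let e : Γ →* (EuclideanSpace ℂ (Fin k) ≃ₗᵢ[ℂ] EuclideanSpace ℂ (Fin k)) :=
    { toFun g :=
        { toLinearEquiv := LinearEquiv.ofLinearMap
            (b.symm.toLinearEquiv.toLinearMap ∘ₗ σ g ∘ₗ b.toLinearEquiv.toLinearMap)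
            (b.symm.toLinearEquiv.toLinearMap ∘ₗ σ g⁻¹ ∘ₗ b.toLinearEquiv.toLinearMap)
            (by ext x; simp) (by ext x; simp)
          norm_map' := fun x => by simp [hσ] }
      map_one' := by ext x; simp
      map_mul' g h := by ext x; simp }
  let c : (EuclideanSpace ℂ (Fin k) →L[ℂ] EuclideanSpace ℂ (Fin k)) ≃⋆ₐ[ℂ]
    Matrix (Fin k) (Fin k) ℂ := (Matrix.toEuclideanCLM (𝕜 := ℂ) (n := Fin k)).symm
  let u : Γ →* unitary (EuclideanSpace ℂ (Fin k) →L[ℂ] EuclideanSpace ℂ (Fin k)) :=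
    Unitary.linearIsometryEquiv.symm.toMonoidHom.comp e
  let ρ : Γ →* Matrix.unitaryGroup (Fin k) ℂ :=
    { toFun g := ⟨c (u g), Unitary.map_mem c (u g).2⟩
      map_one' := Subtype.ext (by simp)
      map_mul' g h := Subtype.ext (by simp) }
  refine ⟨ρ, fun g x => ?_⟩
  have : Matrix.toEuclideanCLM (𝕜 := ℂ) (n := Fin k) (ρ g : Matrix (Fin k) (Fin k) ℂ) = u g :=
    (Matrix.toEuclideanCLM (𝕜 := ℂ) (n := Fin k)).apply_symm_apply _
  rw [← Matrix.coe_toEuclideanCLM_eq_toEuclideanLin, this]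
  exact b.apply_symm_apply _

variable {H : Type*} [NormedAddCommGroup H] [InnerProductSpace ℂ H] {π : Representation ℂ Γ H}

/-- A minimal invariant subspace gives an irreducible representation by unitary matrices. -/
lemma finrank_le_of_minimal_invariant {d : ℕ}
    (hd : ∀ (k : ℕ) (π : Γ →* Matrix.unitaryGroup (Fin k) ℂ), IsIrreducibleRep π → k ≤ d)
    (hπ : ∀ g x, ‖π g x‖ = ‖x‖) {V : Submodule ℂ H} [FiniteDimensional ℂ V]
    (hV : ∀ g, ∀ x ∈ V, π g x ∈ V)
    (hmin : ∀ V' ≤ V, (∀ g, ∀ x ∈ V', π g x ∈ V') → V' ≠ ⊥ →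
      Module.finrank ℂ V ≤ Module.finrank ℂ V') :
    Module.finrank ℂ V ≤ d := by
  obtain ⟨ρ, hρ⟩ := exists_unitaryGroup_hom (σ := π.subrepresentation V hV)
    (fun g x => hπ g x) (stdOrthonormalBasis ℂ V).repr.symm
  refine hd _ ρ fun W hW => ?_
  let ψ : (Fin (Module.finrank ℂ V) → ℂ) →ₗ[ℂ] H := V.subtype ∘ₗ
    (stdOrthonormalBasis ℂ V).repr.symm.toLinearEquiv.toLinearMap ∘ₗ
      (WithLp.linearEquiv 2 ℂ (Fin (Module.finrank ℂ V) → ℂ)).symm.toLinearMap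
  have hψ : Function.Injective ψ := V.injective_subtype.comp
    ((stdOrthonormalBasis ℂ V).repr.symm.injective.comp
      (WithLp.linearEquiv 2 ℂ (Fin (Module.finrank ℂ V) → ℂ)).symm.injective)
  have hπψ : ∀ g x, π g (ψ x) = ψ ((ρ g : Matrix _ _ ℂ).mulVec x) := fun g x =>
    (congrArg Subtype.val (hρ g (WithLp.toLp 2 x))).symm
  by_cases hbot : W = ⊥
  · exact Or.inl hbot
  refine Or.inr (Submodule.eq_top_of_finrank_eq (le_antisymm (Submodule.finrank_le _) ?_))
  rw [Module.finrank_fin_fun, (Submodule.equivMapOfInjective ψ hψ W).finrank_eq]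
  refine hmin _ ?_ ?_ ?_
  · rintro _ ⟨x, -, rfl⟩
    exact Subtype.property _
  · rintro g _ ⟨x, hx, rfl⟩
    exact ⟨_, hW g x hx, (hπψ g x).symm⟩
  · rw [← Submodule.map_bot ψ]
    exact fun h => hbot (Submodule.map_injective_of_injective hψ h)

lemma one_le_of_isIrreducibleRep_imp_le {d : ℕ}
    (hd : ∀ (k : ℕ) (π : Γ →* Matrix.unitaryGroup (Fin k) ℂ), IsIrreducibleRep π → k ≤ d) :
    1 ≤ d :=
  hd 1 1 fun W _ => by
    rcases Nat.eq_zero_or_pos (Module.finrank ℂ W) with h | h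
    · exact Or.inl (Submodule.finrank_eq_zero.1 h)
    · refine Or.inr (Submodule.eq_top_of_finrank_eq (le_antisymm (Submodule.finrank_le _) ?_))
      rw [Module.finrank_fin_fun]
      exact h

lemma exists_minimal_invariant {U : Submodule ℂ H} [FiniteDimensional ℂ U] (hU0 : U ≠ ⊥)
    (hU : ∀ g, ∀ x ∈ U, π g x ∈ U) :
    ∃ V ≤ U, V ≠ ⊥ ∧ (∀ g, ∀ x ∈ V, π g x ∈ V) ∧
      ∀ V' ≤ V, (∀ g, ∀ x ∈ V', π g x ∈ V') → V' ≠ ⊥ →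
        Module.finrank ℂ V ≤ Module.finrank ℂ V' := by
  classical
  have hex : ∃ m : ℕ, ∃ V ≤ U, V ≠ ⊥ ∧ (∀ g, ∀ x ∈ V, π g x ∈ V) ∧ Module.finrank ℂ V = m :=
    ⟨_, U, le_rfl, hU0, hU, rfl⟩
  obtain ⟨V, hVU, hV0, hV, hm⟩ := Nat.find_spec hex
  refine ⟨V, hVU, hV0, hV, fun V' hV' h h0 => ?_⟩
  rw [hm]
  exact Nat.find_min' hex ⟨V', hV'.trans hVU, h0, h, rfl⟩

/-- Invariant subspaces of any dimension up to a bounded error can be found inside a given one. -/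
lemma exists_invariant_finrank_le {d : ℕ}
    (hd : ∀ (k : ℕ) (π : Γ →* Matrix.unitaryGroup (Fin k) ℂ), IsIrreducibleRep π → k ≤ d)
    (hπ : ∀ g x, ‖π g x‖ = ‖x‖) {W : Submodule ℂ H} [FiniteDimensional ℂ W]
    (hW : ∀ g, ∀ x ∈ W, π g x ∈ W) {N : ℕ} (hN : N ≤ Module.finrank ℂ W) :
    ∃ W' ≤ W, (∀ g, ∀ x ∈ W', π g x ∈ W') ∧ Module.finrank ℂ W' ≤ N ∧
      N < Module.finrank ℂ W' + d := by
  classical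
  let p : ℕ → Prop := fun m => ∃ W' ≤ W, (∀ g, ∀ x ∈ W', π g x ∈ W') ∧ Module.finrank ℂ W' = m
  have hp0 : p 0 := ⟨⊥, bot_le, fun g x hx => by simp [(Submodule.mem_bot ℂ).1 hx], finrank_bot ℂ H⟩
  obtain ⟨W', hW'W, hW', hm⟩ := Nat.findGreatest_spec (Nat.zero_le N) hp0
  have hle : Module.finrank ℂ W' ≤ N := hm.trans_le (Nat.findGreatest_le N)
  refine ⟨W', hW'W, hW', hle, ?_⟩
  by_contra! hlt
  have hd1 := one_le_of_isIrreducibleRep_imp_le hd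
  have hfin' : FiniteDimensional ℂ W' := Submodule.finiteDimensional_of_le hW'W
  have hfinU : FiniteDimensional ℂ ↥(W ⊓ W'ᗮ) := Submodule.finiteDimensional_of_le inf_le_left
  have hU0 : W ⊓ W'ᗮ ≠ ⊥ := fun h => by
    have hWW : W ≤ W' := fun x hx => by
      have hmem : x - W'.starProjection x ∈ W ⊓ W'ᗮ :=
        ⟨W.sub_mem hx (hW'W (W'.starProjection_apply_mem x)),
          W'.sub_starProjection_mem_orthogonal x⟩
      rw [h, Submodule.mem_bot, sub_eq_zero] at hmem
      rw [hmem]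
      exact W'.starProjection_apply_mem x
    have := Submodule.finrank_mono hWW
    omega
  obtain ⟨V, hVU, hV0, hV, hmin⟩ := exists_minimal_invariant (π := π) hU0 (fun g x hx =>
    ⟨hW g x hx.1, (Submodule.mem_orthogonal _ _).2 fun u hu => by
      rw [Representation.inner_map_right_of_norm hπ]
      exact (Submodule.mem_orthogonal _ _).1 hx.2 _ (hW' _ _ hu)⟩)
  have hfinV : FiniteDimensional ℂ V := Submodule.finiteDimensional_of_le hVU
  have hVd := finrank_le_of_minimal_invariant hd hπ hV hmin
  have hsum := Submodule.finrank_sup_add_finrank_inf_eq W' V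
  have hinf : W' ⊓ V = ⊥ := by
    refine eq_bot_iff.2 ((inf_le_inf_left W' (hVU.trans inf_le_right)).trans ?_)
    rw [W'.inf_orthogonal_eq_bot]
  have hVpos : 0 < Module.finrank ℂ V :=
    Nat.pos_of_ne_zero fun h => hV0 (Submodule.finrank_eq_zero.1 h)
  rw [hinf, finrank_bot, add_zero] at hsum
  have hgreat := Nat.le_findGreatest (P := p) (n := N) (m := Module.finrank ℂ ↥(W' ⊔ V))
    (by omega) ⟨W' ⊔ V, sup_le hW'W (hVU.trans inf_le_left), fun g x hx => by
      obtain ⟨a, ha, c, hc, rfl⟩ := Submodule.mem_sup.1 hx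
      rw [map_add]
      exact Submodule.add_mem_sup (hW' g a ha) (hV g c hc), rfl⟩
  change _ = Nat.findGreatest p N at hm
  omega

end UnitaryMatrices

section NearestIsometry

variable {E K : Type*} [NormedAddCommGroup E] [InnerProductSpace ℂ E] [FiniteDimensional ℂ E]
  [NormedAddCommGroup K] [InnerProductSpace ℂ K] [FiniteDimensional ℂ K]

lemma sum_norm_sq_map_eq_trace {ι : Type*} [Fintype ι] (b : OrthonormalBasis ι ℂ E)
    (A : E →ₗ[ℂ] K) :
    ((∑ i, ‖A (b i)‖ ^ 2 : ℝ) : ℂ) = LinearMap.trace ℂ E (LinearMap.adjoint A ∘ₗ A) := by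
  rw [LinearMap.trace_eq_sum_inner _ b, Complex.ofReal_sum]
  refine Finset.sum_congr rfl fun i _ => ?_
  rw [LinearMap.comp_apply, LinearMap.adjoint_inner_right, inner_self_eq_norm_sq_to_K]
  push_cast
  rfl

lemma sum_norm_sq_map_orthonormalBasis {ι κ : Type*} [Fintype ι] [Fintype κ]
    (b : OrthonormalBasis ι ℂ E) (b' : OrthonormalBasis κ ℂ E) (A : E →ₗ[ℂ] K) :
    ∑ i, ‖A (b i)‖ ^ 2 = ∑ i, ‖A (b' i)‖ ^ 2 := by
  exact_mod_cast (sum_norm_sq_map_eq_trace b A).trans (sum_norm_sq_map_eq_trace b' A).symm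

/-- A contraction between spaces of the same dimension is as close to an isometry as its
Hilbert-Schmidt norm is to the maximal one. -/
lemma exists_isometry_near_contraction {n : ℕ} (hE : Module.finrank ℂ E = n)
    (hK : Module.finrank ℂ K = n) (A : E →ₗ[ℂ] K) (hA : ∀ x, ‖A x‖ ≤ ‖x‖) :
    ∃ u : E ≃ₗᵢ[ℂ] K, ∀ b : OrthonormalBasis (Fin n) ℂ E,
      ∑ i, ‖u (b i) - A (b i)‖ ^ 2 ≤ n - ∑ i, ‖A (b i)‖ ^ 2 := by
  have hS : (LinearMap.adjoint A ∘ₗ A).IsSymmetric := fun x y => by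
    rw [LinearMap.comp_apply, LinearMap.comp_apply, LinearMap.adjoint_inner_left,
      LinearMap.adjoint_inner_right]
  let f := hS.eigenvectorBasis hE
  have hfn : ∀ i, ‖f i‖ = 1 := f.orthonormal.1
  have horth : Pairwise fun i j => inner ℂ (A (f i)) (A (f j)) = 0 := by
    intro i j hij
    rw [← LinearMap.adjoint_inner_right, ← LinearMap.comp_apply, hS.apply_eigenvectorBasis,
      inner_smul_right]
    change _ * inner ℂ (f i) (f j) = 0
    rw [f.orthonormal.2 hij, mul_zero]
  let c := InnerProductSpace.gramSchmidtOrthonormalBasis (𝕜 := ℂ) (hK.trans (Fintype.card_fin n).symm)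
    fun i => A (f i)
  have hc : ∀ i, ‖c i - A (f i)‖ ^ 2 ≤ 1 - ‖A (f i)‖ ^ 2 := by
    intro i
    by_cases h : A (f i) = 0
    · simp [h]
    · have hci : c i = (‖A (f i)‖⁻¹ : ℂ) • A (f i) :=
        InnerProductSpace.gramSchmidtOrthonormalBasis_apply_of_orthogonal _ horth h
      have hpos : 0 < ‖A (f i)‖ := norm_pos_iff.2 h
      have hle : ‖A (f i)‖ ≤ 1 := (hA _).trans_eq (hfn i)
      have hd : c i - A (f i) = (((1 - ‖A (f i)‖) * ‖A (f i)‖⁻¹ : ℝ) : ℂ) • A (f i) := by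
        have hs := sub_smul (‖A (f i)‖⁻¹ : ℂ) 1 (A (f i))
        rw [one_smul] at hs
        rw [hci, ← hs]
        congr 1
        push_cast
        rw [sub_mul, one_mul, mul_inv_cancel₀ (by exact_mod_cast hpos.ne')]
      have hn : ‖c i - A (f i)‖ = 1 - ‖A (f i)‖ := by
        rw [hd, norm_smul, Complex.norm_real, Real.norm_of_nonneg (by
          have : 0 ≤ 1 - ‖A (f i)‖ := by linarith
          positivity), inv_mul_cancel_right₀ hpos.ne']
      rw [hn]
      nlinarith
  let u := f.equiv c (Equiv.refl _)
  refine ⟨u, fun b => ?_⟩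
  have huf : ∀ i, u (f i) = c i := fun i => by simp [u]
  rw [sum_norm_sq_map_orthonormalBasis b f A]
  calc ∑ i, ‖u (b i) - A (b i)‖ ^ 2
      = ∑ i, ‖u (f i) - A (f i)‖ ^ 2 :=
        sum_norm_sq_map_orthonormalBasis b f (u.toLinearEquiv.toLinearMap - A)
    _ ≤ ∑ i, (1 - ‖A (f i)‖ ^ 2) := Finset.sum_le_sum fun i _ => by rw [huf]; exact hc i
    _ = _ := by simp

end NearestIsometry

section Correction

variable {Γ : Type*} [Group Γ] {H : Type*} [NormedAddCommGroup H] [InnerProductSpace ℂ H]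
  {π : Representation ℂ Γ H}

/-- Adding a trivial summand to an isometric representation. -/
noncomputable def Representation.prodTrivial {V : Type*} [NormedAddCommGroup V]
    [InnerProductSpace ℂ V] (σ : Representation ℂ Γ V) (Z : Type*) [NormedAddCommGroup Z]
    [InnerProductSpace ℂ Z] : Representation ℂ Γ (WithLp 2 (V × Z)) where
  toFun g := (WithLp.linearEquiv 2 ℂ (V × Z)).symm.toLinearMap ∘ₗ
    LinearMap.prodMap (σ g) LinearMap.id ∘ₗ (WithLp.linearEquiv 2 ℂ (V × Z)).toLinearMap
  map_one' := LinearMap.ext fun x => by simp; rfl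
  map_mul' g h := LinearMap.ext fun x => by simp

lemma Representation.norm_prodTrivial {V Z : Type*} [NormedAddCommGroup V]
    [InnerProductSpace ℂ V] {σ : Representation ℂ Γ V} (hσ : ∀ g x, ‖σ g x‖ = ‖x‖)
    [NormedAddCommGroup Z] [InnerProductSpace ℂ Z] (g : Γ) (x : WithLp 2 (V × Z)) :
    ‖σ.prodTrivial Z g x‖ = ‖x‖ := by
  rw [← sq_eq_sq₀ (norm_nonneg _) (norm_nonneg _), WithLp.prod_norm_sq_eq_of_L2,
    WithLp.prod_norm_sq_eq_of_L2]
  simp [Representation.prodTrivial, hσ]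

/-- Compressing an isometric representation to an invariant subspace that almost contains the
image of `J`, and padding it by a trivial representation. -/
lemma exists_unitaryGroup_hom_near (hπ : ∀ g x, ‖π g x‖ = ‖x‖) {W : Submodule ℂ H}
    [FiniteDimensional ℂ W] (hW : ∀ g, ∀ x ∈ W, π g x ∈ W)
    (hP : ∀ g x, W.starProjection (π g x) = π g (W.starProjection x)) {n : ℕ}
    (hWn : Module.finrank ℂ W ≤ n) (J : EuclideanSpace ℂ (Fin n) →ₗᵢ[ℂ] H)
    (b : OrthonormalBasis (Fin n) ℂ (EuclideanSpace ℂ (Fin n))) :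
    ∃ ρ : Γ →* Matrix.unitaryGroup (Fin n) ℂ, ∀ g
      (Φ : EuclideanSpace ℂ (Fin n) ≃ₗᵢ[ℂ] EuclideanSpace ℂ (Fin n)),
      √(∑ j, ‖Φ (b j) - Matrix.toEuclideanLin (ρ g : Matrix (Fin n) (Fin n) ℂ) (b j)‖ ^ 2) ≤
        √(∑ j, ‖π g (J (b j)) - J (Φ (b j))‖ ^ 2) +
          2 * √(n - ∑ j, ‖W.starProjection (J (b j))‖ ^ 2) := by
  let Z := EuclideanSpace ℂ (Fin (n - Module.finrank ℂ W))
  let K := WithLp 2 (W × Z)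
  let σ : Representation ℂ Γ K := (π.subrepresentation W hW).prodTrivial Z
  have hσ : ∀ g x, ‖σ g x‖ = ‖x‖ := fun g x =>
    Representation.norm_prodTrivial (σ := π.subrepresentation W hW) (fun g x => hπ g x) g x
  let A : EuclideanSpace ℂ (Fin n) →ₗ[ℂ] K := (WithLp.linearEquiv 2 ℂ (W × Z)).symm.toLinearMap ∘ₗ
    LinearMap.inl ℂ W Z ∘ₗ W.orthogonalProjectionOnto.toLinearMap ∘ₗ J.toLinearMap
  have hA : ∀ x, ‖A x‖ = ‖W.starProjection (J x)‖ := fun x =>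
    WithLp.norm_toLp_fst 2 W Z (W.orthogonalProjectionOnto (J x))
  have hK : Module.finrank ℂ K = n := by
    rw [(WithLp.linearEquiv 2 ℂ (W × Z)).finrank_eq, Module.finrank_prod, finrank_euclideanSpace_fin]
    omega
  obtain ⟨u, hu⟩ := exists_isometry_near_contraction (finrank_euclideanSpace_fin) hK A fun x => by
    rw [hA, ← J.norm_map]
    exact W.norm_starProjection_apply_le _
  obtain ⟨ρ, hρ⟩ := exists_unitaryGroup_hom hσ u
  refine ⟨ρ, fun g Φ => ?_⟩
  have hAσ : ∀ x, ‖σ g (A x) - A (Φ x)‖ ≤ ‖π g (J x) - J (Φ x)‖ := fun x => by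
    have h1 : σ g (A x) - A (Φ x) = (WithLp.toLp 2
        ((W.orthogonalProjectionOnto (π g (J x) - J (Φ x)), (0 : Z)) : W × Z) : K) := by
      have hcomm : π.subrepresentation W hW g (W.orthogonalProjectionOnto (J x)) =
          W.orthogonalProjectionOnto (π g (J x)) := Subtype.ext (hP g (J x)).symm
      rw [map_sub, ← hcomm]
      change WithLp.toLp 2 _ - WithLp.toLp 2 _ = _
      rw [← WithLp.toLp_sub]
      congr 1
      simp [A]
    rw [h1]
    refine (WithLp.norm_toLp_fst 2 W Z _).trans_le ?_
    exact W.norm_starProjection_apply_le _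
  have hdec : ∀ j, ‖Φ (b j) - Matrix.toEuclideanLin (ρ g : Matrix (Fin n) (Fin n) ℂ) (b j)‖ ≤
      ‖π g (J (b j)) - J (Φ (b j))‖ + ‖u (b.map Φ j) - A (b.map Φ j)‖ + ‖u (b j) - A (b j)‖ := by
    intro j
    rw [← u.norm_map, map_sub, hρ, OrthonormalBasis.map_apply]
    have h2 : u (Φ (b j)) - σ g (u (b j)) = (A (Φ (b j)) - σ g (A (b j))) +
        (u (Φ (b j)) - A (Φ (b j))) - σ g (u (b j) - A (b j)) := by
      rw [map_sub]
      abel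
    rw [h2]
    refine (norm_sub_le _ _).trans (add_le_add ((norm_add_le _ _).trans
      (add_le_add ?_ le_rfl)) (hσ _ _).le)
    rw [norm_sub_rev]
    exact hAσ _
  let vec : (Fin n → ℝ) → EuclideanSpace ℝ (Fin n) := WithLp.toLp 2
  have hvec : ∀ f : Fin n → ℝ, ‖vec f‖ = √(∑ j, f j ^ 2) := fun f => by
    rw [EuclideanSpace.norm_eq]
    simp [vec]
  have hsum : ∑ j, ‖A (b.map Φ j)‖ ^ 2 = ∑ j, ‖A (b j)‖ ^ 2 :=
    sum_norm_sq_map_orthonormalBasis _ _ A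
  have hb := hu b
  have hb' := hu (b.map Φ)
  rw [hsum] at hb'
  simp only [hA] at hb hb'
  calc _ ≤ √(∑ j, (‖π g (J (b j)) - J (Φ (b j))‖ + ‖u (b.map Φ j) - A (b.map Φ j)‖ +
        ‖u (b j) - A (b j)‖) ^ 2) := by
        refine Real.sqrt_le_sqrt (Finset.sum_le_sum fun j _ => ?_)
        exact pow_le_pow_left₀ (norm_nonneg _) (hdec j) 2
    _ = ‖vec (fun j => ‖π g (J (b j)) - J (Φ (b j))‖) +
        vec (fun j => ‖u (b.map Φ j) - A (b.map Φ j)‖) + vec fun j => ‖u (b j) - A (b j)‖‖ :=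
        (hvec _).symm
    _ ≤ _ := by
        refine (norm_add_le _ _).trans ((add_le_add_left (norm_add_le _ _) _).trans ?_)
        rw [hvec, hvec, hvec, two_mul, add_assoc]
        gcongr

end Correction

section HilbertSchmidt

lemma sum_norm_sq_toEuclideanLin {n : ℕ} (A : Matrix (Fin n) (Fin n) ℂ) :
    ∑ j, ‖Matrix.toEuclideanLin A (EuclideanSpace.basisFun (Fin n) ℂ j)‖ ^ 2 =
      (Matrix.trace (A * Aᴴ)).re := by
  rw [Matrix.trace_mul_comm]
  simp only [Matrix.trace, Matrix.diag, Matrix.mul_apply, Matrix.conjTranspose_apply,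
    Complex.re_sum, EuclideanSpace.norm_sq_eq]
  refine Finset.sum_congr rfl fun j _ => Finset.sum_congr rfl fun i _ => ?_
  rw [← Complex.normSq_eq_norm_sq]
  simp [Matrix.toLpLin_apply, Complex.normSq_apply]

lemma hsNorm_eq_sqrt_div {n : ℕ} (A : Matrix (Fin n) (Fin n) ℂ) :
    hsNorm A = √(∑ j, ‖Matrix.toEuclideanLin A (EuclideanSpace.basisFun (Fin n) ℂ j)‖ ^ 2) / √n := by
  rw [hsNorm, sum_norm_sq_toEuclideanLin, one_div_mul_eq_div, Real.sqrt_div' _ (Nat.cast_nonneg n)]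

lemma sum_norm_sq_le_of_hsNorm_lt {n : ℕ} {A : Matrix (Fin n) (Fin n) ℂ} {ε : ℝ}
    (hA : hsNorm A < ε) :
    ∑ j, ‖Matrix.toEuclideanLin A (EuclideanSpace.basisFun (Fin n) ℂ j)‖ ^ 2 ≤ n * ε ^ 2 := by
  rcases Nat.eq_zero_or_pos n with rfl | hn
  · simp
  have hn' : (0 : ℝ) < n := Nat.cast_pos.2 hn
  rw [hsNorm_eq_sqrt_div, div_lt_iff₀ (Real.sqrt_pos.2 hn')] at hA
  have h := Real.sqrt_le_left (Real.sqrt_nonneg _ |>.trans hA.le) |>.1 hA.le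
  rw [mul_pow, Real.sq_sqrt hn'.le] at h
  linarith

end HilbertSchmidt

section Projections

variable {H : Type*} [NormedAddCommGroup H] [InnerProductSpace ℂ H]

lemma norm_sq_starProjection_eq_sum {W : Submodule ℂ H} [FiniteDimensional ℂ W] {κ : Type*}
    [Fintype κ] (w : OrthonormalBasis κ ℂ W) (x : H) :
    ‖W.starProjection x‖ ^ 2 = ∑ k, ‖inner ℂ (w k : H) x‖ ^ 2 := by
  change ‖W.orthogonalProjectionOnto x‖ ^ 2 = _
  rw [← w.sum_sq_norm_inner_right]
  simp

/-- An orthonormal family has total weight at most the dimension on any subspace. -/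
lemma sum_norm_sq_starProjection_le_finrank {ι : Type*} [Fintype ι] {v : ι → H}
    (hv : Orthonormal ℂ v) (W : Submodule ℂ H) [FiniteDimensional ℂ W] :
    ∑ i, ‖W.starProjection (v i)‖ ^ 2 ≤ Module.finrank ℂ W := by
  let w := stdOrthonormalBasis ℂ W
  calc ∑ i, ‖W.starProjection (v i)‖ ^ 2 = ∑ k, ∑ i, ‖inner ℂ (v i) (w k : H)‖ ^ 2 := by
        rw [Finset.sum_comm]
        refine Finset.sum_congr rfl fun i _ => ?_
        rw [norm_sq_starProjection_eq_sum w]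
        exact Finset.sum_congr rfl fun k _ => by rw [norm_inner_symm]
    _ ≤ ∑ k, ‖(w k : H)‖ ^ 2 :=
        Finset.sum_le_sum fun k _ => hv.sum_inner_products_le _
    _ = _ := by
      have hw : ∀ k, ‖(w k : H)‖ = 1 := w.orthonormal.1
      simp [hw]

lemma sum_norm_sq_starProjection_le_add {ι : Type*} [Fintype ι] {v : ι → H}
    (hv : Orthonormal ℂ v) {W W' : Submodule ℂ H} [FiniteDimensional ℂ W]
    [FiniteDimensional ℂ W'] (h : W' ≤ W) :
    ∑ i, ‖W.starProjection (v i)‖ ^ 2 + Module.finrank ℂ W' ≤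
      ∑ i, ‖W'.starProjection (v i)‖ ^ 2 + Module.finrank ℂ W := by
  have hfin : FiniteDimensional ℂ ↥(W'ᗮ ⊓ W) := Submodule.finiteDimensional_of_le inf_le_right
  have hdim := Submodule.finrank_add_inf_finrank_orthogonal h
  have hle := sum_norm_sq_starProjection_le_finrank hv (W'ᗮ ⊓ W)
  have hpyth : ∀ x, ‖W.starProjection x‖ ^ 2 =
      ‖W'.starProjection x‖ ^ 2 + ‖(W'ᗮ ⊓ W).starProjection x‖ ^ 2 := by
    intro x
    have hp : W'.starProjection (W.starProjection x) = W'.starProjection x :=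
      DFunLike.congr_fun (Submodule.starProjection_comp_starProjection_of_le h) x
    have hq : (W'ᗮ ⊓ W).starProjection x = W'ᗮ.starProjection (W.starProjection x) := by
      rw [Submodule.starProjection_orthogonal_val, hp]
      have hmem : W.starProjection x - W'.starProjection x ∈ W'ᗮ ⊓ W := by
        refine ⟨?_, W.sub_mem (W.starProjection_apply_mem x) (h (W'.starProjection_apply_mem x))⟩
        rw [← hp]
        exact W'.sub_starProjection_mem_orthogonal _
      refine Submodule.eq_starProjection_of_mem_orthogonal hmem ?_
      rw [sub_sub_eq_add_sub, add_sub_right_comm]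
      exact Submodule.add_mem _ (Submodule.orthogonal_le inf_le_right
        (W.sub_starProjection_mem_orthogonal x)) (Submodule.orthogonal_le inf_le_left
          (Submodule.le_orthogonal_orthogonal W' (W'.starProjection_apply_mem x)))
    rw [hq, Submodule.norm_sq_eq_add_norm_sq_starProjection (W.starProjection x) W', hp]
  simp only [hpyth, Finset.sum_add_distrib]
  have : (Module.finrank ℂ W : ℝ) = Module.finrank ℂ W' + Module.finrank ℂ ↥(W'ᗮ ⊓ W) := by
    exact_mod_cast hdim.symm
  linarith

end Projections

section Stability

variable {Γ : Type*} [Group Γ]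

/-- A left invariant mean yields a right invariant one. -/
lemma exists_rightInvariant_mean {L : (Γ → ℝ) →ₗ[ℝ] ℝ}
    (hL : ∀ f ∈ boundedFunctions Γ, (∀ x, 0 ≤ f x) → 0 ≤ L f) (h1 : L 1 = 1)
    (hinv : ∀ g, ∀ f ∈ boundedFunctions Γ, L (fun x => f (g * x)) = L f) :
    ∃ R : (Γ → ℝ) →ₗ[ℝ] ℝ, (∀ f ∈ boundedFunctions Γ, (∀ x, 0 ≤ f x) → 0 ≤ R f) ∧ R 1 = 1 ∧
      ∀ g, ∀ f ∈ boundedFunctions Γ, R (fun x => f (x * g)) = R f := by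
  have hmem : ∀ f ∈ boundedFunctions Γ, (fun x => f x⁻¹) ∈ boundedFunctions Γ := by
    rintro f ⟨C, hC⟩
    exact ⟨C, fun x => hC x⁻¹⟩
  refine ⟨L ∘ₗ LinearMap.funLeft ℝ ℝ Inv.inv, fun f hf h0 => hL _ (hmem f hf) fun x => h0 x⁻¹, h1,
    fun g f hf => ?_⟩
  change L (fun x => f (x⁻¹ * g)) = L fun x => f x⁻¹
  rw [← hinv g⁻¹ _ (hmem f hf)]
  simp

/-- The defect of an orthonormal system from spanning an invariant subspace is controlled by the
distance to any isometry of its span. -/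
lemma card_sub_le_sum_norm_inner_sq {H ι : Type*} [NormedAddCommGroup H] [InnerProductSpace ℂ H]
    [Fintype ι] {v : ι → H} (hv : Orthonormal ℂ v) {a w : ι → H} (ha : ∀ i, ‖a i‖ = 1)
    (hw : ∀ i, w i ∈ Submodule.span ℂ (Set.range v)) {δ : ℝ}
    (hδ : ∑ i, ‖a i - w i‖ ^ 2 ≤ δ) :
    Fintype.card ι - δ ≤ ∑ j, ∑ i, ‖inner ℂ (a i) (v j)‖ ^ 2 := by
  have hone : ∀ i, 1 - ‖a i - w i‖ ^ 2 ≤ ∑ j, ‖inner ℂ (a i) (v j)‖ ^ 2 := by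
    intro i
    let S := Submodule.span ℂ (Set.range v)
    have hfin : FiniteDimensional ℂ S := FiniteDimensional.span_of_finite ℂ (Set.finite_range v)
    let e : OrthonormalBasis ι ℂ S :=
      (Module.Basis.span hv.linearIndependent).toOrthonormalBasis (by
        convert! orthonormal_span hv
        exact congrArg Subtype.val (Module.Basis.span_apply hv.linearIndependent _))
    have he : ∀ j, (e j : H) = v j := fun j => by
      simp [e, Module.Basis.span_apply hv.linearIndependent]
    have hsum := norm_sq_starProjection_eq_sum e (a i)
    simp only [he, norm_inner_symm (v _)] at hsum
    have hpyth := Submodule.norm_sq_eq_add_norm_sq_starProjection (a i) S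
    have hperp : Sᗮ.starProjection (a i) = Sᗮ.starProjection (a i - w i) := by
      rw [map_sub, Submodule.starProjection_orthogonal_apply_eq_zero (hw i), sub_zero]
    have hle := pow_le_pow_left₀ (norm_nonneg _) (Sᗮ.norm_starProjection_apply_le (a i - w i)) 2
    rw [ha, hperp] at hpyth
    linarith
  rw [Finset.sum_comm]
  calc (Fintype.card ι : ℝ) - δ ≤ ∑ i, (1 - ‖a i - w i‖ ^ 2) := by
        rw [Finset.sum_sub_distrib]
        simpa using sub_le_sub_left hδ (Fintype.card ι : ℝ)
    _ ≤ _ := Finset.sum_le_sum fun i _ => hone i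

/-- Inside a representation with bounded dimensions of irreducibles, an almost invariant
orthonormal system of size `n` is close to an invariant subspace of dimension at most `n`. -/
lemma exists_invariant_finrank_le_card {H : Type*} [NormedAddCommGroup H] [InnerProductSpace ℂ H]
    [CompleteSpace H] {π : Representation ℂ Γ H} {d : ℕ} {L : (Γ → ℝ) →ₗ[ℝ] ℝ}
    (hd : ∀ (k : ℕ) (π : Γ →* Matrix.unitaryGroup (Fin k) ℂ), IsIrreducibleRep π → k ≤ d)
    (hL : ∀ f ∈ boundedFunctions Γ, (∀ x, 0 ≤ f x) → 0 ≤ L f) (h1 : L 1 = 1)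
    (hinv : ∀ g, ∀ f ∈ boundedFunctions Γ, L (fun x => f (g * x)) = L f)
    (hπ : ∀ g x, ‖π g x‖ = ‖x‖) {n : ℕ} {v : Fin n → H} (hv : Orthonormal ℂ v) {δ : ℝ}
    (hδ0 : 0 ≤ δ) (hδ : ∀ g, n - δ ≤ ∑ j, ∑ i, ‖inner ℂ (π g (v i)) (v j)‖ ^ 2) :
    ∃ (W : Submodule ℂ H) (_ : FiniteDimensional ℂ W), (∀ g, ∀ x ∈ W, π g x ∈ W) ∧
      Module.finrank ℂ W ≤ n ∧ n - ∑ i, ‖W.starProjection (v i)‖ ^ 2 ≤ 2 * d * δ := by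
  obtain ⟨W, hfin, hW, hWn⟩ := exists_finiteDimensional_invariant hL h1 hinv hπ hv (δ := δ)
    (by simpa using hδ)
  rw [Fintype.card_fin] at hWn
  have hd1 : (1 : ℝ) ≤ d := by exact_mod_cast one_le_of_isIrreducibleRep_imp_le hd
  have hsum := sum_norm_sq_starProjection_le_finrank hv W
  rcases le_or_gt (Module.finrank ℂ W) n with hle | hlt
  · refine ⟨W, hfin, hW, hle, ?_⟩
    nlinarith
  · obtain ⟨W', hW'W, hW', hn, hnd⟩ := exists_invariant_finrank_le hd hπ hW hlt.le
    have hfin' : FiniteDimensional ℂ W' := Submodule.finiteDimensional_of_le hW'W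
    refine ⟨W', hfin', hW', hn, ?_⟩
    have hcut := sum_norm_sq_starProjection_le_add hv hW'W
    have hlow : ∑ i, ‖W.starProjection (v i)‖ ^ 2 ≤ n := by
      calc _ ≤ ∑ i, ‖v i‖ ^ 2 := Finset.sum_le_sum fun i _ =>
            pow_le_pow_left₀ (norm_nonneg _) (W.norm_starProjection_apply_le _) 2
        _ = n := by simp [hv.1]
    have hlt' : (n : ℝ) + 1 ≤ Module.finrank ℂ W := by exact_mod_cast hlt
    have hnd' : (n : ℝ) + 1 ≤ Module.finrank ℂ W' + d := by exact_mod_cast hnd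
    nlinarith

/-- Uniform approximate representations by unitary matrices are close to representations. -/
lemma exists_unitaryGroup_hom_hsNorm_sub_le (ham : IsAmenable Γ) {d : ℕ}
    (hd : ∀ (k : ℕ) (π : Γ →* Matrix.unitaryGroup (Fin k) ℂ), IsIrreducibleRep π → k ≤ d)
    {ε : ℝ} (hε : 0 < ε) {n : ℕ} (φ : Γ → Matrix.unitaryGroup (Fin n) ℂ)
    (hφ : ∀ g h : Γ, hsNorm ((φ g : Matrix (Fin n) (Fin n) ℂ) * (φ h : Matrix (Fin n) (Fin n) ℂ)
      - (φ (g * h) : Matrix (Fin n) (Fin n) ℂ)) < ε) :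
    ∃ ρ : Γ →* Matrix.unitaryGroup (Fin n) ℂ, ∀ g,
      hsNorm ((φ g : Matrix (Fin n) (Fin n) ℂ) - (ρ g : Matrix (Fin n) (Fin n) ℂ)) ≤
        (1 + 2 * √(2 * d)) * ε := by
  obtain ⟨L, hL, h1, hinv⟩ := ham.exists_leftInvariant_mean
  obtain ⟨R, hR, hR1, hRinv⟩ := exists_rightInvariant_mean hL h1 hinv
  let Φ : Γ → EuclideanSpace ℂ (Fin n) ≃ₗᵢ[ℂ] EuclideanSpace ℂ (Fin n) := fun g =>
    Unitary.linearIsometryEquiv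
      ⟨Matrix.toEuclideanCLM (𝕜 := ℂ) (n := Fin n) (φ g), Unitary.map_mem _ (φ g).2⟩
  have hΦ : ∀ g x, Φ g x = Matrix.toEuclideanLin (φ g : Matrix (Fin n) (Fin n) ℂ) x :=
    fun g x => rfl
  let b := EuclideanSpace.basisFun (Fin n) ℂ
  have hφΦ : ∀ x g, ∑ j, ‖Φ (x * g) (b j) - Φ x (Φ g (b j))‖ ^ 2 ≤ n * ε ^ 2 := by
    intro x g
    refine le_of_eq_of_le (Finset.sum_congr rfl fun j _ => ?_)
      (sum_norm_sq_le_of_hsNorm_lt (hφ x g))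
    rw [norm_sub_rev, map_sub, LinearMap.sub_apply, hΦ, hΦ, hΦ]
    simp [Matrix.toLpLin_apply, b]
  obtain ⟨H, _, _, _, π, J, hπ, hJ⟩ := exists_isometric_dilation R hR hR1 hRinv
    fun g => (Φ g).toLinearIsometry
  have hdil : ∀ g, ∑ j, ‖π g (J (b j)) - J (Φ g (b j))‖ ^ 2 ≤ n * ε ^ 2 := by
    intro g
    have hsum : ∑ j, ‖π g (J (b j)) - J (Φ g (b j))‖ ^ 2 =
        R (fun x => ∑ j, ‖Φ (x * g) (b j) - Φ x (Φ g (b j))‖ ^ 2) := by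
      rw [← Finset.sum_fn, map_sum]
      exact Finset.sum_congr rfl fun j _ => hJ g (b j)
    rw [hsum]
    refine (le_abs_self _).trans (abs_map_le_of_nonneg R hR hR1 fun x => ?_)
    rw [abs_of_nonneg (by positivity)]
    exact hφΦ x g
  have hv : Orthonormal ℂ fun j => J (b j) := b.orthonormal.comp_linearIsometry J
  obtain ⟨W, hfin, hW, hWn, hWδ⟩ := exists_invariant_finrank_le_card hd hL h1 hinv hπ hv
    (δ := n * ε ^ 2) (by positivity) fun g => by
      have := card_sub_le_sum_norm_inner_sq hv (a := fun i => π g (J (b i)))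
        (fun i => by rw [hπ]; exact hv.1 i) (w := fun i => J (Φ g (b i)))
        (fun i => by
          have : Set.range (fun j => J (b j)) = J.toLinearMap '' Set.range b :=
            (Set.range_comp _ _)
          rw [this, Submodule.span_image, ← b.coe_toBasis, b.toBasis.span_eq]
          exact ⟨_, trivial, rfl⟩) (hdil g)
      simpa using this
  obtain ⟨ρ, hρ⟩ := exists_unitaryGroup_hom_near hπ hW
    (fun g => Submodule.starProjection_map_comm (hW g) fun x hx =>
      (Submodule.mem_orthogonal _ _).2 fun u hu => by
        rw [Representation.inner_map_right_of_norm hπ]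
        exact (Submodule.mem_orthogonal _ _).1 hx _ (hW _ _ hu)) hWn J b
  refine ⟨ρ, fun g => ?_⟩
  have h2 := (hρ g (Φ g)).trans (add_le_add (Real.sqrt_le_sqrt (hdil g))
    (mul_le_mul_of_nonneg_left (Real.sqrt_le_sqrt hWδ) zero_le_two))
  rw [show 2 * (d : ℝ) * (n * ε ^ 2) = n * ε ^ 2 * (2 * d) by ring,
    Real.sqrt_mul (x := n * ε ^ 2) (by positivity), Real.sqrt_mul (Nat.cast_nonneg n),
    Real.sqrt_sq hε.le] at h2
  rw [hsNorm_eq_sqrt_div]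
  refine div_le_of_le_mul₀ (Real.sqrt_nonneg _) (by positivity) ?_
  refine le_of_eq_of_le ?_ (h2.trans_eq (by ring))
  simp only [map_sub, LinearMap.sub_apply, hΦ]
  rfl

end Stability

/-- A countable amenable group whose finite dimensional irreducible unitary
representations all have dimension ≤ d satisfies the explicit quantitative
uniform HS stability estimate. -/
theorem stmt_2 (d : ℕ) (Γ : Type*) [Group Γ] [Countable Γ] (ham : IsAmenable Γ)
    (hd : ∀ (k : ℕ) (π : Γ →* Matrix.unitaryGroup (Fin k) ℂ), IsIrreducibleRep π → k ≤ d)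
    (ε : ℝ) (hε : 0 < ε) (n : ℕ) (φ : Γ → Matrix.unitaryGroup (Fin n) ℂ)
    (hφ : ∀ g h : Γ, hsNorm ((φ g : Matrix (Fin n) (Fin n) ℂ) * (φ h : Matrix (Fin n) (Fin n) ℂ)
      - (φ (g * h) : Matrix (Fin n) (Fin n) ℂ)) < ε) :
    ∃ ρ : Γ →* Matrix.unitaryGroup (Fin n) ℂ,
      ∀ g : Γ, hsNorm ((φ g : Matrix (Fin n) (Fin n) ℂ) - (ρ g : Matrix (Fin n) (Fin n) ℂ)) <
        161 * ε + 100 * ((Real.sqrt 2 + 1) * Real.sqrt (1 + 2500 * ε ^ 2)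
          + Real.sqrt ((d : ℝ) - 1)) * ε := by
  obtain ⟨ρ, hρ⟩ := exists_unitaryGroup_hom_hsNorm_sub_le ham hd hε φ hφ
  refine ⟨ρ, fun g => (hρ g).trans_lt ?_⟩
  have hd1 : (0 : ℝ) ≤ d - 1 := sub_nonneg.2 (by exact_mod_cast one_le_of_isIrreducibleRep_imp_le hd)
  have hs : √(2 * d) ≤ √2 * (1 + √((d : ℝ) - 1)) := by
    rw [Real.sqrt_mul zero_le_two]
    refine mul_le_mul_of_nonneg_left (Real.sqrt_le_iff.2 ⟨by positivity, ?_⟩) (Real.sqrt_nonneg _)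
    nlinarith [Real.sq_sqrt hd1, Real.sqrt_nonneg ((d : ℝ) - 1)]
  have h2 : √2 ≤ 2 := Real.sqrt_le_iff.2 ⟨zero_le_two, by norm_num⟩
  have h3 : (0 : ℝ) ≤ (√2 + 1) * √(1 + 2500 * ε ^ 2) := by positivity
  have h4 : √(2 * d) ≤ 2 * (1 + √((d : ℝ) - 1)) :=
    hs.trans (mul_le_mul_of_nonneg_right h2 (by positivity))
  nlinarith [Real.sqrt_nonneg ((d : ℝ) - 1)]
end
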